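/- arXiv:2002.12594 — 3 statements merged into one kernel-verified Lean document; each statement's English description precedes it below -/
import Mathlib

section
/- Let r ≥ 3 be an integer and let η > 0. Then there exist n₀ ∈ ℕ and γ > 0 such that the following holds. Let G be a graph on n ≥ n₀ vertices where r divides n and δ(G) ≥ (1 − 1/(r+1) + η)n. Then for every labelling f: E(G) → {−1,1} there exists a perfect K_r-tiling 𝒯 in G with |Σ_{e ∈ E(𝒯)} f(e)| ≥ γn. -/
/-- A perfect `K_r`-tiling of a graph `G`: a collection of vertex-disjoint
copies of `K_r` (given as `r`-cliques) covering every vertex. -/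
def IsPerfectKTiling {V : Type*} (G : SimpleGraph V) (r : ℕ)
    (T : Finset (Finset V)) : Prop :=
  (∀ S ∈ T, G.IsNClique r S) ∧
  (T : Set (Finset V)).Pairwise (fun S S' => Disjoint S S') ∧
  (∀ v : V, ∃ S ∈ T, v ∈ S)

/-- The edge set `E(𝒯)` of a tiling: the union of the edge sets of its cliques. -/
def tilingEdges {V : Type*} [DecidableEq V] (T : Finset (Finset V)) : Finset (Sym2 V) :=
  T.biUnion fun S => S.sym2.filter fun e => ¬ e.IsDiag

set_option linter.unusedSectionVars false
namespace HSz
open Finset Relation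

section digraph
variable {κ : Type*} [DecidableEq κ]

def Res (R : κ → κ → Prop) (D : Finset κ) (x y : κ) : Prop := R x y ∧ x ∈ D ∧ y ∈ D

def Reach (R : κ → κ → Prop) (D : Finset κ) (x y : κ) : Prop := ReflTransGen (Res R D) x y

lemma last_entry {R : κ → κ → Prop} {D : Finset κ} {i p : κ} (h : Reach R D i p) (hip : i ≠ p) :
    ∃ j ∈ D.erase p, R j p ∧ p ∈ D ∧ Reach R (D.erase p) i j := by
  have key : ∀ x, Reach R D i x → (x ≠ p ∧ Reach R (D.erase p) i x) ∨
      ∃ j ∈ D.erase p, R j p ∧ p ∈ D ∧ Reach R (D.erase p) i j := by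
    intro x hx
    induction hx with
    | refl => exact Or.inl ⟨hip, ReflTransGen.refl⟩
    | @tail x y hx hxy ih =>
      rcases ih with ⟨h1, h2⟩ | ih
      · by_cases hy : y = p
        · subst hy
          exact Or.inr ⟨x, mem_erase.2 ⟨h1, hxy.2.1⟩, hxy.1, hxy.2.2, h2⟩
        · exact Or.inl ⟨hy, h2.tail ⟨hxy.1, mem_erase.2 ⟨h1, hxy.2.1⟩, mem_erase.2 ⟨hy, hxy.2.2⟩⟩⟩
      · exact Or.inr ih
  rcases key p h with h | h
  · exact absurd rfl h.1
  · exact h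

lemma first_exit {R : κ → κ → Prop} {D : Finset κ} {i p : κ} (h : Reach R D i p) (hip : i ≠ p) :
    ∃ j ∈ D.erase i, R i j ∧ i ∈ D ∧ Reach R (D.erase i) j p := by
  have key : ∀ x, Reach R D x p → (x ≠ i ∧ Reach R (D.erase i) x p) ∨
      ∃ j ∈ D.erase i, R i j ∧ i ∈ D ∧ Reach R (D.erase i) j p := by
    intro x hx
    induction hx using ReflTransGen.head_induction_on with
    | refl => exact Or.inl ⟨hip.symm, ReflTransGen.refl⟩
    | @head x y hxy hy ih =>
      rcases ih with ⟨h1, h2⟩ | ih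
      · by_cases hx : x = i
        · subst hx
          exact Or.inr ⟨y, mem_erase.2 ⟨h1, hxy.2.2⟩, hxy.1, hxy.2.1, h2⟩
        · exact Or.inl ⟨hx, ReflTransGen.head ⟨hxy.1, mem_erase.2 ⟨hx, hxy.2.1⟩,
            mem_erase.2 ⟨h1, hxy.2.2⟩⟩ h2⟩
      · exact Or.inr ih
  rcases key i h with h | h
  · exact absurd rfl h.1
  · exact h

open scoped Classical in
/-- vertices whose every path to `p` goes through `U` -/
noncomputable def blocked (R : κ → κ → Prop) (A : Finset κ) (p U : κ) : Finset κ :=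
  A.filter fun i => i ≠ U ∧ ¬ Reach R (A.erase U) i p

lemma mem_blocked {R : κ → κ → Prop} {A : Finset κ} {p U i : κ} :
    i ∈ blocked R A p U ↔ i ∈ A ∧ i ≠ U ∧ ¬ Reach R (A.erase U) i p := by
  classical
  simp [blocked]

lemma reach_avoid {R : κ → κ → Prop} {A : Finset κ} {p U W x : κ} (hW : W ∈ blocked R A p U)
    (hx : Reach R (A.erase U) x p) : Reach R (A.erase W) x p := by
  rw [mem_blocked] at hW
  induction hx using ReflTransGen.head_induction_on with
  | refl => exact ReflTransGen.refl
  | @head x y hxy hy ih =>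
    refine ReflTransGen.head ⟨hxy.1, mem_erase.2 ⟨?_, (mem_erase.1 hxy.2.1).2⟩,
      mem_erase.2 ⟨?_, (mem_erase.1 hxy.2.2).2⟩⟩ ih
    · rintro rfl; exact hW.2.2 (ReflTransGen.head hxy hy)
    · rintro rfl; exact hW.2.2 hy

lemma exists_terminal {R : κ → κ → Prop} {A : Finset κ} {p : κ} (hp : p ∈ A)
    (hA : ∀ i ∈ A, Reach R A i p) (h2 : ∃ i ∈ A, i ≠ p) :
    ∃ U ∈ A, ∃ T ⊆ A, T.Nonempty ∧ U ∉ T ∧ p ∉ T ∧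
      (∀ W ∈ T, ∀ i ∈ A, i ≠ W → Reach R (A.erase W) i p) ∧
      (∀ W ∈ T, ∀ X ∈ A, X ≠ U → X ∉ T → ¬ R W X) := by
  classical
  set F := A.filter fun U => (blocked R A p U).Nonempty with hF
  have hpF : p ∈ F := by
    obtain ⟨i, hi, hip⟩ := h2
    rw [hF, mem_filter]
    refine ⟨hp, i, mem_blocked.2 ⟨hi, hip, fun h => ?_⟩⟩
    obtain ⟨j, hj, -, hpe, -⟩ := last_entry h hip
    simp at hpe
  obtain ⟨U, hU, hmin⟩ := F.exists_min_image (fun U => (blocked R A p U).card) ⟨p, hpF⟩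
  rw [hF, mem_filter] at hU
  refine ⟨U, hU.1, blocked R A p U, fun i hi => (mem_blocked.1 hi).1, hU.2, ?_, ?_, ?_, ?_⟩
  · intro h; exact (mem_blocked.1 h).2.1 rfl
  · intro h; exact (mem_blocked.1 h).2.2 ReflTransGen.refl
  · intro W hW
    by_contra hcon
    push Not at hcon
    obtain ⟨X, hX, hXW, hXr⟩ := hcon
    have hW' := mem_blocked.1 hW
    have hWF : W ∈ F := by
      rw [hF, mem_filter]
      exact ⟨hW'.1, X, mem_blocked.2 ⟨hX, hXW, hXr⟩⟩
    have hlt : (blocked R A p W).card < (blocked R A p U).card := by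
      apply card_lt_card
      rw [ssubset_iff_of_subset]
      · exact ⟨W, hW, fun h => (mem_blocked.1 h).2.1 rfl⟩
      · intro Y hY
        have hY' := mem_blocked.1 hY
        refine mem_blocked.2 ⟨hY'.1, ?_, fun h => hY'.2.2 (reach_avoid hW h)⟩
        rintro rfl
        have hYp : Y ≠ p := by
          rintro rfl; exact hY'.2.2 ReflTransGen.refl
        obtain ⟨j, hj, hRj, -, hr⟩ := first_exit (hA Y hY'.1) hYp
        apply hY'.2.2
        refine ReflTransGen.head ⟨hRj, mem_erase.2 ⟨hY'.2.1, hY'.1⟩, mem_erase.2 ⟨?_, (mem_erase.1 hj).2⟩⟩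
          (reach_avoid hW hr)
        rintro rfl
        exact hW'.2.2 hr
    exact absurd (hmin W hWF) (not_le.2 hlt)
  · intro W hW X hX hXU hXT hR
    have hW' := mem_blocked.1 hW
    have : Reach R (A.erase U) X p := by
      by_contra h
      exact hXT (mem_blocked.2 ⟨hX, hXU, h⟩)
    exact hW'.2.2 (ReflTransGen.head ⟨hR, mem_erase.2 ⟨hW'.2.1, hW'.1⟩, mem_erase.2 ⟨hXU, hX⟩⟩ this)

lemma reach_mono {R R' : κ → κ → Prop} {D D' : Finset κ} (hD : D ⊆ D')
    (hR : ∀ x ∈ D, ∀ y ∈ D, R x y → R' x y) {x y : κ} (h : Reach R D x y) : Reach R' D' x y :=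
  ReflTransGen.mono (fun a b hab => ⟨hR a hab.2.1 b hab.2.2 hab.1, hD hab.2.1, hD hab.2.2⟩) _ _ h

end digraph

section coloring
variable {V κ : Type*} [DecidableEq V] [DecidableEq κ]

def fib (S : Finset V) (c : V → κ) (i : κ) : Finset V := S.filter fun v => c v = i

open scoped Classical in
noncomputable def nb (H : SimpleGraph V) (S : Finset V) (v : V) : Finset V := S.filter fun u => H.Adj v u

lemma mem_fib {S : Finset V} {c : V → κ} {i : κ} {v : V} : v ∈ fib S c i ↔ v ∈ S ∧ c v = i := by
  simp [fib]

lemma mem_nb {H : SimpleGraph V} {S : Finset V} {v u : V} : u ∈ nb H S v ↔ u ∈ S ∧ H.Adj v u := by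
  classical
  simp [nb]

def Proper (H : SimpleGraph V) (S : Finset V) (c : V → κ) : Prop :=
  ∀ u ∈ S, ∀ v ∈ S, c u = c v → ¬ H.Adj u v

def Mv (H : SimpleGraph V) (S : Finset V) (c : V → κ) (i j : κ) : Prop :=
  ∃ w ∈ S, c w = i ∧ ∀ x ∈ S, c x = j → ¬ H.Adj w x

lemma card_fib_update {S : Finset V} {c : V → κ} {w : V} (hw : w ∈ S) (p l : κ) :
    (fib S (Function.update c w p) l).card + (if l = c w then 1 else 0) =
      (fib S c l).card + (if l = p then 1 else 0) := by
  unfold fib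
  rw [card_filter, card_filter, ← add_sum_erase _ _ hw, ← add_sum_erase S (fun v => if c v = l then 1 else 0) hw]
  have : ∑ x ∈ S.erase w, (if Function.update c w p x = l then 1 else 0) =
      ∑ x ∈ S.erase w, (if c x = l then 1 else 0) := by
    apply sum_congr rfl
    intro x hx
    rw [Function.update_of_ne (mem_erase.1 hx).1]
  rw [this]
  simp only [Function.update_self, eq_comm (a := l)]
  omega

lemma proper_update {H : SimpleGraph V} {S : Finset V} {c : V → κ} {w : V} {p : κ}
    (hc : Proper H S c) (hw : ∀ x ∈ S, x ≠ w → c x = p → ¬ H.Adj w x) :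
    Proper H S (Function.update c w p) := by
  intro u hu v hv huv
  by_cases h1 : u = w
  · subst h1
    by_cases h2 : v = u
    · subst h2; exact H.irrefl
    · simp [Function.update_of_ne h2] at huv
      exact hw v hv h2 huv.symm
  · by_cases h2 : v = w
    · subst h2
      simp [Function.update_of_ne h1] at huv
      exact fun h => hw u hu h1 huv h.symm
    · rw [Function.update_of_ne h1, Function.update_of_ne h2] at huv
      exact hc u hu v hv huv

lemma shift {H : SimpleGraph V} {S : Finset V} {c : V → κ} (hc : Proper H S c) (i : κ) :
    ∀ m : ℕ, ∀ D : Finset κ, D.card = m → ∀ p, Reach (Mv H S c) D i p →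
    ∃ c' : V → κ, Proper H S c' ∧ (∀ v, c v ∉ D → c' v = c v) ∧ (∀ v, c v ∈ D → c' v ∈ D) ∧
      (∀ v, c v = p → c' v = p) ∧ (∀ v, c' v = i → c v = i) ∧
      ∀ j, (fib S c' j).card + (if j = i then 1 else 0) = (fib S c j).card + (if j = p then 1 else 0) := by
  intro m
  induction m with
  | zero =>
    intro D hD p h
    rw [card_eq_zero] at hD
    by_cases hip : i = p
    · subst hip
      exact ⟨c, hc, fun _ _ => rfl, fun _ h => h, fun _ h => h, fun _ h => h, fun _ => rfl⟩
    · obtain ⟨j, hj, -⟩ := last_entry h hip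
      simp [hD] at hj
  | succ m ih =>
    intro D hD p h
    by_cases hip : i = p
    · subst hip
      exact ⟨c, hc, fun _ _ => rfl, fun _ h => h, fun _ h => h, fun _ h => h, fun _ => rfl⟩
    · obtain ⟨j, hj, hjp, hpD, hr⟩ := last_entry h hip
      obtain ⟨c1, h1, h2, h3, h4, h5, h6⟩ := ih (D.erase p) (by rw [card_erase_of_mem hpD]; omega) j hr
      obtain ⟨w, hwS, hwj, hw⟩ := hjp
      have hc1w : c1 w = j := h4 w hwj
      have hc1p : ∀ v, c1 v = p → c v = p := by
        intro v hv
        by_contra hne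
        by_cases hvD : c v ∈ D.erase p
        · have := h3 v hvD
          rw [hv] at this; simp at this
        · rw [h2 v hvD] at hv; exact hne hv
      have hjp : j ≠ p := (mem_erase.1 hj).1
      refine ⟨Function.update c1 w p, proper_update h1 ?_, ?_, ?_, ?_, ?_, ?_⟩
      · intro x hx _ hxp
        exact hw x hx (hc1p x hxp)
      · intro v hv
        have : v ≠ w := by
          rintro rfl; rw [hwj] at hv; exact hv (mem_erase.1 hj).2
        rw [Function.update_of_ne this]
        exact h2 v (fun h => hv (mem_erase.1 h).2)
      · intro v hv
        by_cases hvw : v = w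
        · subst hvw; simpa using hpD
        · rw [Function.update_of_ne hvw]
          by_cases hvp : c v = p
          · rw [h2 v (by simp [hvp]), hvp]; exact hpD
          · exact (mem_erase.1 (h3 v (mem_erase.2 ⟨hvp, hv⟩))).2
      · intro v hv
        by_cases hvw : v = w
        · subst hvw; simp
        · rw [Function.update_of_ne hvw, h2 v (by simp [hv]), hv]
      · intro v hv
        by_cases hvw : v = w
        · subst hvw; simp at hv; exact absurd hv.symm hip
        · rw [Function.update_of_ne hvw] at hv; exact h5 v hv
      · intro l
        have e1 := card_fib_update (c := c1) hwS p l
        have e2 := h6 l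
        rw [hc1w] at e1
        omega

def Eqt (H : SimpleGraph V) (r : ℕ) (S : Finset V) (C : Finset κ) (c : V → κ) : Prop :=
  Proper H S c ∧ (∀ v ∈ S, c v ∈ C) ∧ ∀ i ∈ C, (fib S c i).card = r

structure NE (H : SimpleGraph V) (r : ℕ) (S : Finset V) (C : Finset κ) (c : V → κ) (p q : κ) : Prop where
  hp : p ∈ C
  hq : q ∈ C
  hpq : p ≠ q
  proper : Proper H S c
  maps : ∀ v ∈ S, c v ∈ C
  size : ∀ i ∈ C, (fib S c i).card + (if i = p then 1 else 0) = r + (if i = q then 1 else 0)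

lemma card_fiber_sum (S : Finset V) (c : V → κ) (D : Finset κ) :
    (S.filter fun v => c v ∈ D).card = ∑ i ∈ D, (fib S c i).card := by
  rw [card_eq_sum_card_fiberwise (f := c) (t := D)]
  · apply sum_congr rfl
    intro i hi
    congr 1
    ext v
    simp only [mem_filter, mem_fib]
    constructor
    · rintro ⟨⟨a, b⟩, d⟩; exact ⟨a, d⟩
    · rintro ⟨a, d⟩; exact ⟨⟨a, d ▸ hi⟩, d⟩
  · intro v hv
    simp at hv ⊢; exact hv.2

end coloring
end HSz

set_option linter.unusedSectionVars false
namespace HSz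
open Finset Relation
section coloring2
variable {V κ : Type*} [DecidableEq V] [DecidableEq κ]

lemma nb_mono {H : SimpleGraph V} {S S' : Finset V} (h : S ⊆ S') (v : V) : nb H S v ⊆ nb H S' v := by
  intro x hx
  rw [mem_nb] at hx ⊢
  exact ⟨h hx.1, hx.2⟩

lemma deg_split (H : SimpleGraph V) (S : Finset V) (c : V → κ) (D : Finset κ) (v : V) :
    (nb H S v).card = ∑ i ∈ D, (nb H (fib S c i) v).card + (nb H (S.filter fun u => c u ∉ D) v).card := by
  have h1 : ∑ i ∈ D, (nb H (fib S c i) v).card = ((nb H S v).filter fun u => c u ∈ D).card := by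
    rw [card_fiber_sum]
    apply sum_congr rfl
    intro i _
    congr 1
    ext u
    simp only [mem_nb, mem_fib]
    tauto
  have h2 : nb H (S.filter fun u => c u ∉ D) v = (nb H S v).filter fun u => ¬ c u ∈ D := by
    ext u
    simp only [mem_nb, mem_filter]
    tauto
  rw [h1, h2, card_filter_add_card_filter_not]

lemma nb_pos {H : SimpleGraph V} {S : Finset V} {c : V → κ} {i : κ} {v : V} :
    1 ≤ (nb H (fib S c i) v).card ↔ ∃ x ∈ S, c x = i ∧ H.Adj v x := by
  rw [Nat.one_le_iff_ne_zero, ← Nat.pos_iff_ne_zero, card_pos]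
  constructor
  · rintro ⟨x, hx⟩
    rw [mem_nb, mem_fib] at hx
    exact ⟨x, hx.1.1, hx.1.2, hx.2⟩
  · rintro ⟨x, a, b, d⟩
    exact ⟨x, mem_nb.2 ⟨mem_fib.2 ⟨a, b⟩, d⟩⟩

lemma Proper.mono {H : SimpleGraph V} {S S' : Finset V} {c : V → κ} (h : Proper H S c) (hS : S' ⊆ S) :
    Proper H S' c := fun u hu v hv => h u (hS hu) v (hS hv)

lemma proper_update' {H : SimpleGraph V} {S : Finset V} {c : V → κ} {w : V} {p : κ}
    (hc : Proper H (S.erase w) c) (hw : ∀ x ∈ S, x ≠ w → c x = p → ¬ H.Adj w x) :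
    Proper H S (Function.update c w p) := by
  intro u hu v hv huv
  by_cases h1 : u = w
  · subst h1
    by_cases h2 : v = u
    · subst h2; exact H.irrefl
    · simp [Function.update_of_ne h2] at huv
      exact hw v hv h2 huv.symm
  · by_cases h2 : v = w
    · subst h2
      simp [Function.update_of_ne h1] at huv
      exact fun h => hw u hu h1 huv h.symm
    · rw [Function.update_of_ne h1, Function.update_of_ne h2] at huv
      exact hc u (mem_erase.2 ⟨h1, hu⟩) v (mem_erase.2 ⟨h2, hv⟩) huv

/-- the accessible-classes context -/
structure Ctx (H : SimpleGraph V) (r : ℕ) (S : Finset V) (C : Finset κ) (c : V → κ) (p q : κ)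
    (A : Finset κ) : Prop where
  ne : NE H r S C c p q
  sub : A ⊆ C
  pA : p ∈ A
  qA : q ∉ A
  nbr : ∀ y ∈ S, c y ∉ A → ∀ i ∈ A, 1 ≤ (nb H (fib S c i) y).card
  deg : ∀ v ∈ S, (nb H S v).card + 1 ≤ C.card
  IH : ∀ (S' : Finset V) (C' : Finset κ), C'.card < C.card → S'.card = r * C'.card →
    (∀ v ∈ S', (nb H S' v).card + 1 ≤ C'.card) → ∃ g, Eqt H r S' C' g

variable {H : SimpleGraph V} {r : ℕ} {S : Finset V} {C : Finset κ} {c : V → κ} {p q : κ} {A : Finset κ}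

lemma Ctx.cardB (h : Ctx H r S C c p q A) :
    (S.filter fun v => c v ∉ A).card = r * (C \ A).card + 1 := by
  have h1 : (S.filter fun v => c v ∉ A) = S.filter fun v => c v ∈ C \ A := by
    apply filter_congr
    intro v hv
    simp [h.ne.maps v hv]
  rw [h1, card_fiber_sum]
  have h2 : ∀ i ∈ C \ A, (fib S c i).card = r + (if i = q then 1 else 0) := by
    intro i hi
    rw [mem_sdiff] at hi
    have := h.ne.size i hi.1
    have hip : i ≠ p := by rintro rfl; exact hi.2 h.pA
    simpa [hip] using this
  rw [sum_congr rfl h2, sum_add_distrib, sum_ite_eq' (C \ A) q]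
  simp [h.ne.hq, h.qA, mul_comm]

lemma Ctx.card_add (h : Ctx H r S C c p q A) : A.card + (C \ A).card = C.card := by
  rw [add_comm]; exact card_sdiff_add_card_eq_card h.sub

lemma Ctx.degB (h : Ctx H r S C c p q A) {y : V} (hy : y ∈ S) (hyA : c y ∉ A) :
    (nb H (S.filter fun v => c v ∉ A) y).card + 1 ≤ (C \ A).card := by
  have h1 := deg_split H S c A y
  have h2 := h.deg y hy
  have h3 : ∑ i ∈ A, 1 ≤ ∑ i ∈ A, (nb H (fib S c i) y).card := sum_le_sum (h.nbr y hy hyA)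
  have h4 := h.card_add
  simp at h3
  omega

lemma Ctx.colorB (h : Ctx H r S C c p q A) {y : V} (hy : y ∈ S) (hyA : c y ∉ A) :
    ∃ g, Eqt H r ((S.filter fun v => c v ∉ A).erase y) (C \ A) g := by
  apply h.IH
  · have := h.card_add
    have : 0 < A.card := card_pos.2 ⟨p, h.pA⟩
    omega
  · rw [card_erase_of_mem (by simp [hy, hyA]), h.cardB]; simp
  · intro v hv
    have hv' := (mem_erase.1 hv).2
    rw [mem_filter] at hv'
    have := h.degB hv'.1 hv'.2
    have h2 := card_le_card (nb_mono (H := H) (erase_subset y (S.filter fun v => c v ∉ A)) v)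
    omega

lemma combine {S1 S2 : Finset V} {C1 C2 : Finset κ} {c1 c2 : V → κ} (hS : Disjoint S1 S2)
    (hC : Disjoint C1 C2) (h1 : Eqt H r S1 C1 c1) (h2 : Eqt H r S2 C2 c2) :
    Eqt H r (S1 ∪ S2) (C1 ∪ C2) (fun v => if v ∈ S1 then c1 v else c2 v) := by
  rw [disjoint_left] at hS hC
  obtain ⟨a1, b1, d1⟩ := h1
  obtain ⟨a2, b2, d2⟩ := h2
  refine ⟨?_, ?_, ?_⟩
  · intro u hu v hv huv
    rw [mem_union] at hu hv
    by_cases hu1 : u ∈ S1 <;> by_cases hv1 : v ∈ S1 <;> simp only [hu1, hv1, if_true, if_false] at huv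
    · exact a1 u hu1 v hv1 huv
    · exact absurd (huv ▸ b2 v (by tauto)) (hC (b1 u hu1))
    · exact absurd (huv ▸ b2 u (by tauto)) (hC (b1 v hv1))
    · exact a2 u (by tauto) v (by tauto) huv
  · intro v hv
    rw [mem_union] at hv ⊢
    by_cases hv1 : v ∈ S1
    · simp only [hv1, if_true]; exact Or.inl (b1 v hv1)
    · simp only [hv1, if_false]; exact Or.inr (b2 v (by tauto))
  · intro i hi
    rw [mem_union] at hi
    rcases hi with hi | hi
    · rw [← d1 i hi]
      congr 1
      ext v
      simp only [mem_fib, mem_union]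
      by_cases hv1 : v ∈ S1
      · simp [hv1]
      · simp only [hv1, if_false, false_or, false_and, iff_false]
        rintro ⟨x, rfl⟩
        exact hC hi (b2 v x)
    · rw [← d2 i hi]
      congr 1
      ext v
      simp only [mem_fib, mem_union]
      by_cases hv1 : v ∈ S1
      · simp only [hv1, if_true, true_or, true_and, hS hv1, false_and, iff_false]
        rintro rfl
        exact hC (b1 v hv1) hi
      · simp [hv1]

lemma Ctx.stepX (h : Ctx H r S C c p q A) {W X : κ} (hW : W ∈ A) (hX : X ∈ A)
    (hXW : X ≠ W) (hr : Reach (Mv H S c) (A.erase W) X p) {w y : V} (hw : w ∈ S) (hwW : c w = W)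
    (hwX : ∀ x ∈ S, c x = X → ¬ H.Adj w x) (hy : y ∈ S) (hyA : c y ∉ A)
    (hyw : ∀ x ∈ S, c x = W → H.Adj y x → x = w) : ∃ c' : V → κ, Eqt H r S C c' := by
  obtain ⟨c1, h1, h2, h3, h4, h5, h6⟩ := shift h.ne.proper X _ _ rfl p hr
  have hc1w : c1 w = W := by rw [h2 w (by simp [hwW]), hwW]
  have hc1y : c1 y = c y := h2 y (fun hh => hyA (mem_erase.1 hh).2)
  have hyw' : y ≠ w := by rintro rfl; exact hyA (hwW ▸ hW)
  have hc1W : ∀ v, c1 v = W → c v = W := by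
    intro v hv
    by_cases hvD : c v ∈ A.erase W
    · have := h3 v hvD
      rw [hv] at this; simp at this
    · rw [← h2 v hvD, hv]
  set c2 := Function.update c1 w X with hc2
  have P2 : Proper H S c2 := proper_update h1 fun x hx _ hxX => hwX x hx (h5 x hxX)
  set c3 := Function.update c2 y W with hc3
  have P3 : Proper H S c3 := by
    apply proper_update P2
    intro x hx hxy hxW hadj
    by_cases hxw : x = w
    · subst hxw; rw [hc2, Function.update_self] at hxW; exact hXW hxW
    · rw [hc2, Function.update_of_ne hxw] at hxW
      exact hxw (hyw x hx (hc1W x hxW) hadj)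
  have hc2y : c2 y = c y := by rw [hc2, Function.update_of_ne hyw', hc1y]
  obtain ⟨g, hg⟩ := h.colorB hy hyA
  set A' := insert y (S.filter fun v => c v ∈ A) with hA'
  have hA'S : A' ⊆ S := by
    intro v hv
    rw [hA', mem_insert, mem_filter] at hv
    rcases hv with rfl | hv
    · exact hy
    · exact hv.1
  have hE : Eqt H r A' A c3 := by
    refine ⟨P3.mono hA'S, ?_, ?_⟩
    · intro v hv
      by_cases hvy : v = y
      · subst hvy; rw [hc3, Function.update_self]; exact hW
      · rw [hA', mem_insert, mem_filter] at hv
        rw [hc3, Function.update_of_ne hvy]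
        by_cases hvw : v = w
        · subst hvw; rw [hc2, Function.update_self]; exact hX
        · rw [hc2, Function.update_of_ne hvw]
          have hvA : c v ∈ A := by tauto
          by_cases hvW : c v = W
          · rw [h2 v (by simp [hvW]), hvW]; exact hW
          · exact (mem_erase.1 (h3 v (mem_erase.2 ⟨hvW, hvA⟩))).2
    · intro i hi
      have e0 : fib A' c3 i = fib S c3 i := by
        ext v
        simp only [mem_fib]
        constructor
        · rintro ⟨a, b⟩; exact ⟨hA'S a, b⟩
        · rintro ⟨a, b⟩
          refine ⟨?_, b⟩
          rw [hA', mem_insert, mem_filter]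
          by_contra hcon
          push Not at hcon
          have hvA := hcon.2 a
          have hvw : v ≠ w := by rintro rfl; exact hvA (hwW ▸ hW)
          rw [hc3, Function.update_of_ne hcon.1, hc2, Function.update_of_ne hvw,
            h2 v (fun hh => hvA (mem_erase.1 hh).2)] at b
          exact hvA (b ▸ hi)
      rw [e0]
      have e1 := card_fib_update (c := c2) hy W i
      have e2 := card_fib_update (c := c1) hw X i
      have e3 := h6 i
      have e4 := h.ne.size i (h.sub hi)
      rw [← hc3, hc2y] at e1
      rw [← hc2, hc1w] at e2
      have n1 : i ≠ c y := by rintro rfl; exact hyA hi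
      have n2 : i ≠ q := by rintro rfl; exact h.qA hi
      simp only [n1, n2, if_false] at e1 e4
      omega
  have hfin := combine (S1 := A') (S2 := (S.filter fun v => c v ∉ A).erase y) (C1 := A) (C2 := C \ A)
    (by
      rw [disjoint_left]
      intro v hv hv2
      rw [hA', mem_insert, mem_filter] at hv
      rw [mem_erase, mem_filter] at hv2
      tauto) disjoint_sdiff hE hg
  rw [union_sdiff_of_subset h.sub] at hfin
  have hU : A' ∪ (S.filter fun v => c v ∉ A).erase y = S := by
    ext v
    rw [hA', mem_union, mem_insert, mem_filter, mem_erase, mem_filter]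
    by_cases hvy : v = y
    · subst hvy; simp [hy]
    · simp only [hvy, false_or, not_false_iff, true_and, ne_eq]; tauto
  rw [hU] at hfin
  exact ⟨_, hfin⟩

lemma Ctx.stepY (h : Ctx H r S C c p q A) {W : κ} (hW : W ∈ A) {w y : V}
    (hw : w ∈ S) (hwW : c w = W)
    (hwX : ∀ X ∈ A, X ≠ W → 1 ≤ (nb H (fib S c X) w).card) (hy : y ∈ S) (hyA : c y ∉ A)
    (hadj : H.Adj w y)
    (hyw : ∀ x ∈ S, c x = W → H.Adj y x → x = w) : ∃ (c' : V → κ) (q' : κ), NE H r S C c' p q' ∧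
      q' ∉ A ∧ (∀ v ∈ S, v ≠ w → c v ∈ A → c' v = c v) ∧ c' y = W ∧ c' w ∉ A ∧
      (∀ v ∈ S, c v ∉ A → v ≠ y → c' v ∈ C \ A) := by
  obtain ⟨g, g1, g2, g3⟩ := h.colorB hy hyA
  have hyw' : y ≠ w := by rintro rfl; exact hyA (hwW ▸ hW)
  obtain ⟨Y, hY, hYg⟩ : ∃ Y ∈ C \ A, ∀ x ∈ (S.filter fun v => c v ∉ A).erase y, g x = Y → ¬ H.Adj w x := by
    by_contra hcon
    push Not at hcon
    have hsub : C \ A ⊆ (nb H ((S.filter fun v => c v ∉ A).erase y) w).image g := by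
      intro Y hY
      obtain ⟨x, hx, hx2, hx3⟩ := hcon Y hY
      exact mem_image.2 ⟨x, mem_nb.2 ⟨hx, hx3⟩, hx2⟩
    have e1 := (card_le_card hsub).trans card_image_le
    have e2 : (nb H ((S.filter fun v => c v ∉ A).erase y) w) = (nb H (S.filter fun v => c v ∉ A) w).erase y := by
      ext v; simp only [mem_nb, mem_erase]; tauto
    have hym : y ∈ nb H (S.filter fun v => c v ∉ A) w := by
      rw [mem_nb, mem_filter]; exact ⟨⟨hy, hyA⟩, hadj⟩
    have e3 := card_erase_add_one hym
    rw [e2] at e1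
    have e4 := deg_split H S c A w
    have e5 : ∑ i ∈ A.erase W, 1 ≤ ∑ i ∈ A.erase W, (nb H (fib S c i) w).card :=
      sum_le_sum fun i hi => hwX i (mem_erase.1 hi).2 (mem_erase.1 hi).1
    have e6 : ∑ i ∈ A.erase W, (nb H (fib S c i) w).card ≤ ∑ i ∈ A, (nb H (fib S c i) w).card :=
      sum_le_sum_of_subset (erase_subset _ _)
    have e7 := h.deg w hw
    have e8 := h.card_add
    have e9 := card_erase_add_one hW
    simp at e5
    omega
  rw [mem_sdiff] at hY
  have hYW : Y ≠ W := by rintro rfl; exact hY.2 hW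
  set h0 : V → κ := fun v => if c v ∈ A then c v else g v with hh0
  have h0A : ∀ v, c v ∈ A → h0 v = c v := fun v hv => by simp [hh0, hv]
  have h0B : ∀ v, c v ∉ A → h0 v = g v := fun v hv => by simp [hh0, hv]
  have gB : ∀ v ∈ S, c v ∉ A → v ≠ y → g v ∈ C \ A := fun v hv hvA hvy =>
    g2 v (by rw [mem_erase, mem_filter]; exact ⟨hvy, hv, hvA⟩)
  set h1 := Function.update h0 y W with hh1
  set c' := Function.update h1 w Y with hc'
  have h1y : h1 y = W := by rw [hh1, Function.update_self]
  have h1w : h1 w = W := by rw [hh1, Function.update_of_ne hyw'.symm, h0A w (hwW ▸ hW), hwW]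
  have P0 : Proper H ((S.erase w).erase y) h0 := by
    intro u hu v hv huv
    simp only [mem_erase] at hu hv
    by_cases hu1 : c u ∈ A <;> by_cases hv1 : c v ∈ A
    · rw [h0A u hu1, h0A v hv1] at huv
      exact h.ne.proper u hu.2.2 v hv.2.2 huv
    · rw [h0A u hu1, h0B v hv1] at huv
      have := gB v hv.2.2 hv1 hv.1
      rw [← huv, mem_sdiff] at this; exact absurd hu1 this.2
    · rw [h0B u hu1, h0A v hv1] at huv
      have := gB u hu.2.2 hu1 hu.1
      rw [huv, mem_sdiff] at this; exact absurd hv1 this.2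
    · rw [h0B u hu1, h0B v hv1] at huv
      exact g1 u (by simp [hu, hu1]) v (by simp [hv, hv1]) huv
  have P1 : Proper H (S.erase w) h1 := by
    apply proper_update' P0
    intro x hx hxy hxW hax
    rw [mem_erase] at hx
    by_cases hxA : c x ∈ A
    · rw [h0A x hxA] at hxW
      exact hx.1 (hyw x hx.2 hxW hax)
    · rw [h0B x hxA] at hxW
      have := gB x hx.2 hxA hxy
      rw [hxW, mem_sdiff] at this; exact this.2 hW
  have P2 : Proper H S c' := by
    apply proper_update' P1
    intro x hx hxw hxY
    have hxy : x ≠ y := by rintro rfl; rw [h1y] at hxY; exact hYW hxY.symm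
    rw [hh1, Function.update_of_ne hxy] at hxY
    by_cases hxA : c x ∈ A
    · rw [h0A x hxA] at hxY
      exact absurd (hxY ▸ hxA) hY.2
    · rw [h0B x hxA] at hxY
      exact hYg x (by rw [mem_erase, mem_filter]; exact ⟨hxy, hx, hxA⟩) hxY
  have cA : ∀ v ∈ S, v ≠ w → c v ∈ A → c' v = c v := by
    intro v _ hvw hvA
    have hvy : v ≠ y := by rintro rfl; exact hyA hvA
    rw [hc', Function.update_of_ne hvw, hh1, Function.update_of_ne hvy, h0A v hvA]
  have cB : ∀ v ∈ S, c v ∉ A → v ≠ y → c' v ∈ C \ A := by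
    intro v hv hvA hvy
    have hvw : v ≠ w := by rintro rfl; exact hvA (hwW ▸ hW)
    rw [hc', Function.update_of_ne hvw, hh1, Function.update_of_ne hvy, h0B v hvA]
    exact gB v hv hvA hvy
  have cy : c' y = W := by rw [hc', Function.update_of_ne hyw', h1y]
  have cw : c' w = Y := by rw [hc', Function.update_self]
  refine ⟨c', Y, ⟨h.ne.hp, hY.1, ?_, P2, ?_, ?_⟩, hY.2, cA, cy, cw ▸ hY.2, cB⟩
  · rintro rfl; exact hY.2 h.pA
  · intro v hv
    by_cases hvw : v = w
    · subst hvw; rw [cw]; exact hY.1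
    by_cases hvA : c v ∈ A
    · rw [cA v hv hvw hvA]; exact h.sub hvA
    by_cases hvy : v = y
    · subst hvy; rw [cy]; exact h.sub hW
    exact (mem_sdiff.1 (cB v hv hvA hvy)).1
  · intro i hi
    have e1 := card_fib_update (c := h1) hw Y i
    rw [← hc', h1w] at e1
    by_cases hiA : i ∈ A
    · have e2 := h.ne.size i hi
      have n2 : i ≠ q := by rintro rfl; exact h.qA hiA
      have n3 : i ≠ Y := by rintro rfl; exact hY.2 hiA
      have e3 : (fib S h1 i).card = (fib S c i).card + (if i = W then 1 else 0) := by
        by_cases hiW : i = W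
        · subst hiW
          have : fib S h1 i = insert y (fib S c i) := by
            ext v
            rw [mem_insert, mem_fib, mem_fib]
            by_cases hvy : v = y
            · subst hvy; simp [hy, h1y]
            · simp only [hvy, false_or]
              apply and_congr_right
              intro hv
              rw [hh1, Function.update_of_ne hvy]
              by_cases hvA : c v ∈ A
              · rw [h0A v hvA]
              · rw [h0B v hvA]
                have := gB v hv hvA hvy
                constructor
                · rintro rfl; exact absurd hW (mem_sdiff.1 this).2
                · rintro rfl; exact absurd hW hvA
          rw [this, card_insert_of_notMem (by rw [mem_fib]; rintro ⟨-, rfl⟩; exact hyA hW)]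
          simp
        · have : fib S h1 i = fib S c i := by
            ext v
            rw [mem_fib, mem_fib]
            apply and_congr_right
            intro hv
            by_cases hvy : v = y
            · subst hvy; rw [h1y]
              constructor
              · rintro rfl; exact absurd rfl hiW
              · rintro rfl; exact absurd hiA hyA
            · rw [hh1, Function.update_of_ne hvy]
              by_cases hvA : c v ∈ A
              · rw [h0A v hvA]
              · rw [h0B v hvA]
                have := gB v hv hvA hvy
                constructor
                · rintro rfl; exact absurd hiA (mem_sdiff.1 this).2
                · rintro rfl; exact absurd hiA hvA
          simp [this, hiW]
      simp only [n2, n3, if_false] at e1 e2 ⊢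
      omega
    · have n1 : i ≠ p := by rintro rfl; exact hiA h.pA
      have n2 : i ≠ W := by rintro rfl; exact hiA hW
      have e3 : (fib S h1 i).card = r := by
        rw [← g3 i (mem_sdiff.2 ⟨hi, hiA⟩)]
        congr 1
        ext v
        rw [mem_fib, mem_fib, mem_erase, mem_filter]
        by_cases hvy : v = y
        · subst hvy; rw [h1y]
          simp [n2.symm]
        · rw [hh1, Function.update_of_ne hvy]
          by_cases hvA : c v ∈ A
          · rw [h0A v hvA]
            simp only [hvA, not_true, and_false, false_and, iff_false]
            rintro ⟨-, rfl⟩; exact hiA hvA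
          · rw [h0B v hvA]; simp [hvA, hvy]
      simp only [n1, n2, if_false] at e1 ⊢
      omega
end coloring2
end HSz

set_option linter.unusedSectionVars false
namespace HSz
open Finset Relation
section coloring3
variable {V κ : Type*} [DecidableEq V] [DecidableEq κ]
variable {H : SimpleGraph V} {r : ℕ} {S : Finset V} {C : Finset κ} {c : V → κ} {p q : κ} {A : Finset κ}

lemma swap_nb {M : Type*} [AddCommMonoid M] (H : SimpleGraph V) (X Y : Finset V) (F : V → V → M) :
    ∑ y ∈ Y, ∑ w ∈ nb H X y, F w y = ∑ w ∈ X, ∑ y ∈ nb H Y w, F w y := by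
  apply sum_comm'
  intro x y
  simp only [mem_nb, H.adj_comm x y]
  tauto

lemma Ctx.count1 (h : Ctx H r S C c p q A) {U : κ} {T : Finset κ} (hT : T ⊆ A) (hne : T.Nonempty)
    (hpT : p ∉ T)
    (hmv : ∀ w ∈ S, c w ∈ T → ∀ X ∈ A, X ≠ U → X ∉ T → 1 ≤ (nb H (fib S c X) w).card)
    (hX : ∀ w ∈ S, c w ∈ T → ∀ y ∈ S, c y ∉ A → H.Adj w y → (nb H (fib S c (c w)) y).card = 1 →
      ∀ X ∈ A, X ≠ c w → 1 ≤ (nb H (fib S c X) w).card) : (C \ A).card < T.card := by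
  classical
  by_contra hle
  push Not at hle
  obtain ⟨W, hWT⟩ := hne
  set B := S.filter fun v => c v ∉ A with hB
  set solo : V → Prop := fun w => ∃ y ∈ B, H.Adj w y ∧ (nb H (fib S c W) y).card = 1 with hsolo
  set wt : V → ℕ := fun w => if solo w then 2 else 1 with hwt
  have hWA := hT hWT
  have s1 : ∑ y ∈ B, 2 ≤ ∑ y ∈ B, ∑ w ∈ nb H (fib S c W) y, wt w := by
    apply sum_le_sum
    intro y hy
    have hy' := mem_filter.1 hy
    have h1 := h.nbr y hy'.1 hy'.2 W hWA
    by_cases hone : (nb H (fib S c W) y).card = 1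
    · obtain ⟨w, hw⟩ := card_eq_one.1 hone
      rw [hw, sum_singleton]
      have : w ∈ nb H (fib S c W) y := by rw [hw]; simp
      have hs : solo w := ⟨y, hy, (mem_nb.1 this).2.symm, hone⟩
      simp [hwt, hs]
    · calc 2 ≤ (nb H (fib S c W) y).card := by omega
        _ = ∑ w ∈ nb H (fib S c W) y, 1 := by simp
        _ ≤ _ := by
          apply sum_le_sum
          intro w _
          simp only [hwt]; split_ifs <;> omega
  rw [swap_nb] at s1
  have s2 : ∑ w ∈ fib S c W, ∑ y ∈ nb H B w, wt w ≤ ∑ w ∈ fib S c W, 2 * (C \ A).card := by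
    apply sum_le_sum
    intro w hw
    obtain ⟨hwS, hwW⟩ := mem_fib.1 hw
    have e1 := deg_split H S c A w
    have e2 := h.deg w hwS
    have e3 := h.card_add
    rw [sum_const, smul_eq_mul]
    rw [← hB] at e1
    by_cases hs : solo w
    · obtain ⟨y, hy, hadj, hone⟩ := hs
      have hs : solo w := ⟨y, hy, hadj, hone⟩
      have hy' := mem_filter.1 hy
      have e5 : ∑ i ∈ A.erase W, 1 ≤ ∑ i ∈ A.erase W, (nb H (fib S c i) w).card := by
        apply sum_le_sum
        intro i hi
        exact hX w hwS (hwW ▸ hWT) y hy'.1 hy'.2 hadj (hwW ▸ hone) i (mem_erase.1 hi).2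
          (hwW ▸ (mem_erase.1 hi).1)
      have e6 : ∑ i ∈ A.erase W, (nb H (fib S c i) w).card ≤ ∑ i ∈ A, (nb H (fib S c i) w).card :=
        sum_le_sum_of_subset (erase_subset _ _)
      have e9 := card_erase_add_one hWA
      simp only [sum_const, smul_eq_mul, mul_one] at e5
      simp only [hwt, hs, if_true]
      omega
    · have e5 : ∑ i ∈ (A \ T).erase U, 1 ≤ ∑ i ∈ (A \ T).erase U, (nb H (fib S c i) w).card := by
        apply sum_le_sum
        intro i hi
        rw [mem_erase, mem_sdiff] at hi
        exact hmv w hwS (hwW ▸ hWT) i hi.2.1 hi.1 hi.2.2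
      have e6 : ∑ i ∈ (A \ T).erase U, (nb H (fib S c i) w).card ≤ ∑ i ∈ A, (nb H (fib S c i) w).card :=
        sum_le_sum_of_subset ((erase_subset _ _).trans sdiff_subset)
      have e9 : (A \ T).card - 1 ≤ ((A \ T).erase U).card := pred_card_le_card_erase
      have e10 := card_sdiff_add_card_eq_card hT
      simp only [sum_const, smul_eq_mul, mul_one] at e5
      simp only [hwt, hs, if_false]
      omega
  have hsz := h.ne.size W (h.sub hWA)
  have n1 : W ≠ p := by rintro rfl; exact hpT hWT
  have n2 : W ≠ q := by rintro rfl; exact h.qA hWA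
  simp only [n1, n2, if_false, add_zero] at hsz
  rw [sum_const, smul_eq_mul, hsz] at s2
  rw [sum_const, smul_eq_mul, h.cardB] at s1
  nlinarith

lemma Ctx.count2 (h : Ctx H r S C c p q A) {T : Finset κ} (hT : T ⊆ A) (hne : T.Nonempty)
    (hpT : p ∉ T) (hlt : (C \ A).card < T.card)
    (hY : ∀ w ∈ S, c w ∈ T → ∀ y ∈ S, c y ∉ A → ∀ z ∈ S, c z ∉ A → H.Adj w y → H.Adj w z →
      (nb H (fib S c (c w)) y).card = 1 → (nb H (fib S c (c w)) z).card = 1 → y ≠ z → H.Adj y z) :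
    False := by
  classical
  set B := S.filter fun v => c v ∉ A with hB
  set X := S.filter fun v => c v ∈ T with hXd
  set b := (C \ A).card with hb
  set t := T.card with ht
  have hXcard : X.card = t * r := by
    rw [hXd, card_fiber_sum, ht, ← smul_eq_mul, ← sum_const]
    apply sum_congr rfl
    intro W hWT
    have hWA := hT hWT
    have hsz := h.ne.size W (h.sub hWA)
    have n1 : W ≠ p := by rintro rfl; exact hpT hWT
    have n2 : W ≠ q := by rintro rfl; exact h.qA hWA
    simpa [n1, n2] using hsz
  set so : V → V → Prop := fun w y => (nb H (fib S c (c w)) y).card = 1 with hso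
  set Sw : V → Finset V := fun w => (nb H B w).filter fun y => so w y with hSw
  set F : V → V → ℚ := fun w y => if so w y then 1 / ((Sw w).card : ℚ) else 0 with hF
  have s1 : ∑ w ∈ X, ∑ y ∈ nb H B w, F w y ≤ ∑ w ∈ X, (1 : ℚ) := by
    apply sum_le_sum
    intro w _
    simp only [hF]
    rw [← sum_filter, sum_const, nsmul_eq_mul]
    change ((Sw w).card : ℚ) * (1 / ((Sw w).card : ℚ)) ≤ 1
    rw [mul_one_div]
    exact div_self_le_one _
  rw [← swap_nb] at s1
  have hBpos : 0 < B.card := by rw [hB, h.cardB]; omega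
  have s2 : ∑ y ∈ B, ((t : ℚ) / b) ≤ ∑ y ∈ B, ∑ w ∈ nb H X y, F w y := by
    apply sum_le_sum
    intro y hy
    have hy' := mem_filter.1 hy
    set d := (nb H B y).card with hd
    have hdb : d + 1 ≤ b := h.degB hy'.1 hy'.2
    set Q := (nb H X y).filter fun w => so w y with hQ
    have hQc : t + d + 1 ≤ Q.card + b := by
      have q1 : Q.card = ∑ W ∈ T, (fib Q c W).card := by
        rw [← card_fiber_sum]
        congr 1
        rw [eq_comm, filter_eq_self]
        intro w hw
        rw [hQ, mem_filter, mem_nb, hXd, mem_filter] at hw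
        exact hw.1.1.2
      have q2 : ∑ W ∈ T, 2 ≤ ∑ W ∈ T, ((nb H (fib S c W) y).card + (fib Q c W).card) := by
        apply sum_le_sum
        intro W hW
        have h1 := h.nbr y hy'.1 hy'.2 W (hT hW)
        by_cases hone : (nb H (fib S c W) y).card = 1
        · have : nb H (fib S c W) y ⊆ fib Q c W := by
            intro w hw
            rw [mem_nb, mem_fib] at hw
            obtain ⟨⟨a1, a2⟩, a3⟩ := hw
            rw [mem_fib, hQ, mem_filter, mem_nb, hXd, mem_filter]
            refine ⟨⟨⟨⟨a1, a2 ▸ hW⟩, a3⟩, ?_⟩, a2⟩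
            simp only [hso, a2, hone]
          have := card_le_card this
          omega
        · omega
      rw [sum_add_distrib, ← q1, sum_const, smul_eq_mul] at q2
      have q3 := deg_split H S c A y
      have q4 := h.deg y hy'.1
      have q5 := h.card_add
      have q6 := sum_sdiff (f := fun i => (nb H (fib S c i) y).card) hT
      have q7 : ∑ i ∈ A \ T, 1 ≤ ∑ i ∈ A \ T, (nb H (fib S c i) y).card :=
        sum_le_sum fun i hi => h.nbr y hy'.1 hy'.2 i (mem_sdiff.1 hi).1
      have q8 := card_sdiff_add_card_eq_card hT
      simp only [sum_const, smul_eq_mul, mul_one] at q7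
      rw [← hB] at q3
      omega
    have s3 : ∑ w ∈ Q, (1 / ((d : ℚ) + 1)) ≤ ∑ w ∈ nb H X y, F w y := by
      simp only [hF]
      rw [← sum_filter]
      apply sum_le_sum
      intro w hw
      rw [hQ, mem_filter, mem_nb, hXd, mem_filter] at hw
      obtain ⟨⟨⟨w1, w2⟩, w3⟩, w4⟩ := hw
      have hyS : y ∈ Sw w := by
        rw [hSw]; simp only [mem_filter, mem_nb]; exact ⟨⟨hy, w3.symm⟩, w4⟩
      have hsub : Sw w ⊆ insert y (nb H B y) := by
        intro z hz
        rw [hSw] at hz; simp only [mem_filter, mem_nb] at hz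
        obtain ⟨⟨z1, z2⟩, z3⟩ := hz
        have z1' := mem_filter.1 z1
        rw [mem_insert]
        by_cases hzy : z = y
        · exact Or.inl hzy
        · right
          rw [mem_nb]
          exact ⟨z1, hY w w1 w2 y hy'.1 hy'.2 z z1'.1 z1'.2 w3.symm z2 w4 z3 (Ne.symm hzy)⟩
      have hc := (card_le_card hsub).trans (card_insert_le _ _)
      have hpos : 0 < (Sw w).card := card_pos.2 ⟨y, hyS⟩
      apply one_div_le_one_div_of_le
      · exact_mod_cast hpos
      · exact_mod_cast hc
    refine le_trans ?_ s3
    rw [sum_const, nsmul_eq_mul, mul_one_div]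
    have hb0 : (0 : ℚ) < b := by exact_mod_cast (by omega : 0 < b)
    rw [div_le_div_iff₀ hb0 (by positivity)]
    have a1 : (t : ℚ) + d + 1 ≤ Q.card + b := by exact_mod_cast hQc
    have a2 : (d : ℚ) + 1 ≤ b := by exact_mod_cast hdb
    have a3 : (b : ℚ) + 1 ≤ t := by exact_mod_cast hlt
    nlinarith
  have s4 := s2.trans s1
  rw [sum_const, sum_const, nsmul_eq_mul, nsmul_eq_mul, hXcard, hB, h.cardB, mul_one] at s4
  have hb0 : 0 < b := by
    obtain ⟨y, hy⟩ := card_pos.1 hBpos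
    have hy' := mem_filter.1 hy
    have := h.degB hy'.1 hy'.2
    omega
  have hb0' : (0 : ℚ) < b := by exact_mod_cast hb0
  have ht0 : (0 : ℚ) < t := by exact_mod_cast (by omega : 0 < t)
  rw [mul_div_assoc', div_le_iff₀ hb0'] at s4
  push_cast at s4
  rw [← hb] at s4
  nlinarith

open scoped Classical in
theorem nearly (H : SimpleGraph V) (r : ℕ) (S : Finset V) (C : Finset κ)
    (deg : ∀ v ∈ S, (nb H S v).card + 1 ≤ C.card)
    (IH : ∀ (S' : Finset V) (C' : Finset κ), C'.card < C.card → S'.card = r * C'.card →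
      (∀ v ∈ S', (nb H S' v).card + 1 ≤ C'.card) → ∃ g, Eqt H r S' C' g) :
    ∀ (b : ℕ) (c : V → κ) (p q : κ), NE H r S C c p q →
      (C.filter fun i => ¬ Reach (Mv H S c) C i p).card = b → ∃ c', Eqt H r S C c' := by
  intro b
  induction b using Nat.strong_induction_on with
  | _ b ih =>
  intro c p q hNE hbc
  by_cases hqr : Reach (Mv H S c) C q p
  · obtain ⟨c1, h1, h2, h3, h4, h5, h6⟩ := shift hNE.proper q _ _ rfl p hqr
    refine ⟨c1, h1, fun v hv => h3 v (hNE.maps v hv), fun i hi => ?_⟩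
    have e1 := h6 i
    have e2 := hNE.size i hi
    omega
  set A := C.filter fun i => Reach (Mv H S c) C i p with hA
  have memA : ∀ i, i ∈ A ↔ i ∈ C ∧ Reach (Mv H S c) C i p := fun i => by rw [hA, mem_filter]
  have hpA : p ∈ A := (memA p).2 ⟨hNE.hp, ReflTransGen.refl⟩
  have hAreach : ∀ i ∈ A, Reach (Mv H S c) A i p := by
    intro i hi
    have := ((memA i).1 hi).2
    induction this using ReflTransGen.head_induction_on with
    | refl => exact ReflTransGen.refl
    | @head x y hxy hy ih2 =>
      have hyA : y ∈ A := (memA y).2 ⟨hxy.2.2, hy⟩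
      exact ReflTransGen.head ⟨hxy.1, hi, hyA⟩ (ih2 hyA)
  have ctx : Ctx H r S C c p q A := by
    refine ⟨hNE, filter_subset _ _, hpA, fun hh => hqr ((memA q).1 hh).2, ?_, deg, IH⟩
    intro y hy hyA i hi
    rw [nb_pos]
    by_contra hcon
    push Not at hcon
    apply hyA
    rw [memA] at hi ⊢
    exact ⟨hNE.maps y hy, ReflTransGen.head ⟨⟨y, hy, rfl, hcon⟩, hNE.maps y hy, hi.1⟩ hi.2⟩
  by_contra hno
  by_cases h2 : ∃ i ∈ A, i ≠ p
  · obtain ⟨U, hU, T, hTA, hTne, hUT, hpT, hterm, hmv⟩ := exists_terminal hpA hAreach h2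
    have hmv' : ∀ w ∈ S, c w ∈ T → ∀ X ∈ A, X ≠ U → X ∉ T → 1 ≤ (nb H (fib S c X) w).card := by
      intro w hw hwT X hX hXU hXT
      rw [nb_pos]
      by_contra hcon
      push Not at hcon
      exact hmv _ hwT X hX hXU hXT ⟨w, hw, rfl, hcon⟩
    have hsolo : ∀ {w y : V}, w ∈ S → H.Adj w y → (nb H (fib S c (c w)) y).card = 1 →
        ∀ x ∈ S, c x = c w → H.Adj y x → x = w := by
      intro w y hw hadj hone x hx hxw hyx
      obtain ⟨z, hz⟩ := card_eq_one.1 hone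
      have m1 : x ∈ nb H (fib S c (c w)) y := mem_nb.2 ⟨mem_fib.2 ⟨hx, hxw⟩, hyx⟩
      have m2 : w ∈ nb H (fib S c (c w)) y := mem_nb.2 ⟨mem_fib.2 ⟨hw, rfl⟩, hadj.symm⟩
      rw [hz, mem_singleton] at m1 m2
      rw [m1, m2]
    have hX : ∀ w ∈ S, c w ∈ T → ∀ y ∈ S, c y ∉ A → H.Adj w y → (nb H (fib S c (c w)) y).card = 1 →
        ∀ X ∈ A, X ≠ c w → 1 ≤ (nb H (fib S c X) w).card := by
      intro w hw hwT y hy hyA hadj hone X hX hXw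
      rw [nb_pos]
      by_contra hcon
      push Not at hcon
      exact hno (ctx.stepX (hTA hwT) hX hXw (hterm _ hwT X hX hXw) hw rfl hcon hy hyA
        (hsolo hw hadj hone))
    refine ctx.count2 hTA hTne hpT (ctx.count1 hTA hTne hpT hmv' hX) ?_
    intro w hw hwT y hy hyA z hz hzA hwy hwz hone1 hone2 hyz
    by_contra hnadj
    have hWA := hTA hwT
    obtain ⟨c', q', hNE', hq'A, k1, k2, k3, k4⟩ := ctx.stepY hWA hw rfl (hX w hw hwT y hy hyA hwy hone1)
      hy hyA hwy (hsolo hw hwy hone1)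
    apply hno
    refine ih _ ?_ c' p q' hNE' rfl
    rw [← hbc]
    apply card_lt_card
    -- classes of `A` other than that of `w` are unchanged
    have hcls : ∀ x ∈ S, c' x ∈ A → c' x ≠ c w → c x = c' x := by
      intro x hx hxA hxw
      have n1 : x ≠ w := by rintro rfl; exact k3 hxA
      have n2 : x ≠ y := by rintro rfl; exact hxw k2
      by_cases hcx : c x ∈ A
      · exact (k1 x hx n1 hcx).symm
      · exact absurd hxA (mem_sdiff.1 (k4 x hx hcx n2)).2
    have hR : ∀ i ∈ A.erase (c w), ∀ j ∈ A.erase (c w), Mv H S c i j → Mv H S c' i j := by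
      rintro i hi j hj ⟨v, hv, hvi, hvj⟩
      rw [mem_erase] at hi hj
      refine ⟨v, hv, ?_, ?_⟩
      · rw [k1 v hv (by rintro rfl; exact hi.1 hvi.symm) (hvi ▸ hi.2), hvi]
      · intro x hx hxj
        exact hvj x hx (by rw [hcls x hx (hxj ▸ hj.2) (hxj ▸ hj.1), hxj])
    have r1 : ∀ i ∈ A, i ≠ c w → Reach (Mv H S c') C i p := fun i hi hiw =>
      reach_mono ((erase_subset _ _).trans ctx.sub) hR (hterm _ hwT i hi hiw)
    have hwp : c w ≠ p := by intro hh; exact hpT (hh ▸ hwT)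
    have r2 : Reach (Mv H S c') C (c w) p := by
      obtain ⟨X, hXA, ⟨v, hv, hvw, hvX⟩, -, -⟩ := first_exit (hAreach _ hWA) hwp
      rw [mem_erase] at hXA
      refine ReflTransGen.head ⟨⟨v, hv, ?_, ?_⟩, ctx.sub hWA, ctx.sub hXA.2⟩ (r1 X hXA.2 hXA.1)
      · rw [← hvw]
        apply k1 v hv ?_ (hvw ▸ hWA)
        rintro rfl
        have := hX v hw hwT y hy hyA hwy hone1 X hXA.2 hXA.1
        rw [nb_pos] at this
        obtain ⟨x, x1, x2, x3⟩ := this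
        exact hvX x x1 x2 x3
      · intro x hx hxj
        exact hvX x hx (by rw [hcls x hx (hxj ▸ hXA.2) (hxj ▸ hXA.1), hxj])
    have hz4 := mem_sdiff.1 (k4 z hz hzA (Ne.symm hyz))
    have r3 : Reach (Mv H S c') C (c' z) p := by
      refine ReflTransGen.head ⟨⟨z, hz, rfl, ?_⟩, hz4.1, ctx.sub hWA⟩ r2
      intro x hx hxw hzx
      by_cases hxy : x = y
      · subst hxy; exact hnadj hzx.symm
      have n1 : x ≠ w := by rintro rfl; exact k3 (hxw ▸ hWA)
      have hcx : c x ∈ A := by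
        by_contra hcx
        exact (mem_sdiff.1 (k4 x hx hcx hxy)).2 (hxw ▸ hWA)
      exact n1 (hsolo hw hwz hone2 x hx ((k1 x hx n1 hcx).symm.trans hxw) hzx)
    rw [ssubset_iff_of_subset]
    · refine ⟨c' z, mem_filter.2 ⟨hz4.1, fun hh => hz4.2 ((memA _).2 ⟨hz4.1, hh⟩)⟩, ?_⟩
      rw [mem_filter]; exact fun hh => hh.2 r3
    · intro i hi
      rw [mem_filter] at hi ⊢
      refine ⟨hi.1, fun hh => hi.2 ?_⟩
      by_cases hiw : i = c w
      · rw [hiw]; exact r2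
      · exact r1 i ((memA i).2 ⟨hi.1, hh⟩) hiw
  · push Not at h2
    have hAp : A = {p} := by
      ext i; rw [mem_singleton]; exact ⟨h2 i, fun h => h ▸ hpA⟩
    have s1 : ∑ y ∈ S.filter (fun v => c v ∉ A), 1 ≤
        ∑ y ∈ S.filter (fun v => c v ∉ A), ∑ w ∈ nb H (fib S c p) y, 1 := by
      apply sum_le_sum
      intro y hy
      rw [mem_filter] at hy
      have := ctx.nbr y hy.1 hy.2 p hpA
      simpa using this
    rw [swap_nb] at s1
    have s2 : ∑ w ∈ fib S c p, ∑ y ∈ nb H (S.filter (fun v => c v ∉ A)) w, 1 ≤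
        ∑ w ∈ fib S c p, (C \ A).card := by
      apply sum_le_sum
      intro w hw
      have e1 := deg w (mem_fib.1 hw).1
      have e2 := card_le_card (nb_mono (H := H) (filter_subset (fun v => c v ∉ A) S) w)
      have e3 := ctx.card_add
      rw [hAp, card_singleton] at e3
      rw [sum_const, smul_eq_mul, mul_one]
      rw [hAp] at e2 ⊢
      omega
    have s3 := s1.trans s2
    rw [sum_const, sum_const, smul_eq_mul, smul_eq_mul, ctx.cardB] at s3
    have hsz := hNE.size p hNE.hp
    simp [hNE.hpq] at hsz
    nlinarith

lemma exists_equi [Nonempty κ] (r : ℕ) (C : Finset κ) : ∀ S : Finset V, S.card = r * C.card →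
    ∃ c : V → κ, Eqt (⊥ : SimpleGraph V) r S C c := by
  induction C using Finset.induction_on with
  | empty =>
    intro S hS
    simp at hS
    subst hS
    exact ⟨fun _ => Classical.arbitrary κ, by intro u hu; simp at hu, by simp, by simp⟩
  | insert i C hi ih =>
    intro S hS
    rw [card_insert_of_notMem hi] at hS
    obtain ⟨S1, hS1, hc1⟩ := exists_subset_card_eq (s := S) (n := r) (by rw [hS]; nlinarith)
    have hcs := card_sdiff_add_card_eq_card hS1
    obtain ⟨c, hc⟩ := ih (S \ S1) (by rw [hS, hc1] at hcs; linarith)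
    have h1 : Eqt (⊥ : SimpleGraph V) r S1 {i} (fun _ => i) := by
      refine ⟨fun u _ v _ _ => by simp, by simp, ?_⟩
      intro j hj
      rw [mem_singleton] at hj
      subst hj
      rw [← hc1]; congr 1; ext v; simp [mem_fib]
    have := combine disjoint_sdiff (by simpa using hi) h1 hc
    rw [union_sdiff_of_subset hS1] at this
    exact ⟨_, this⟩

/-- restriction of a graph to edges inside `T` -/
def rs (H : SimpleGraph V) (T : Finset V) : SimpleGraph V where
  Adj x y := H.Adj x y ∧ x ∈ T ∧ y ∈ T
  symm := ⟨fun _ _ h => ⟨h.1.symm, h.2.2, h.2.1⟩⟩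
  loopless := ⟨fun _ h => H.irrefl h.1⟩

/-- Hajnal–Szemerédi. -/
theorem hajnal_szemeredi [Nonempty κ] (r : ℕ) : ∀ (k : ℕ) (H : SimpleGraph V) (S : Finset V) (C : Finset κ),
    C.card = k → S.card = r * k → (∀ v ∈ S, (nb H S v).card + 1 ≤ k) → ∃ c : V → κ, Eqt H r S C c := by
  intro k
  induction k using Nat.strong_induction_on with
  | _ k IH =>
  intro H S C hC hS hdeg
  have key : ∀ T ⊆ S, ∃ c : V → κ, Eqt (rs H T) r S C c := by
    intro T
    induction T using Finset.induction_on with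
    | empty =>
      intro _
      obtain ⟨c, h1, h2, h3⟩ := exists_equi r C S (by rw [hC, hS])
      exact ⟨c, fun u hu v hv huv h => by simpa using h.2.1, h2, h3⟩
    | insert u T hu ih =>
      intro hTS
      obtain ⟨c, h1, h2, h3⟩ := ih ((subset_insert _ _).trans hTS)
      have huS : u ∈ S := hTS (mem_insert_self _ _)
      have hdeg' : ∀ v ∈ S, (nb (rs H (insert u T)) S v).card + 1 ≤ C.card := by
        intro v hv
        have : nb (rs H (insert u T)) S v ⊆ nb H S v := by
          intro x hx
          rw [mem_nb] at hx ⊢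
          exact ⟨hx.1, hx.2.1⟩
        have e1 := card_le_card this
        have e2 := hdeg v hv
        omega
      obtain ⟨j, hj, hjn⟩ : ∃ j ∈ C, ∀ x ∈ S, c x = j → ¬ (rs H (insert u T)).Adj u x := by
        by_contra hcon
        push Not at hcon
        have hsub : C ⊆ (nb (rs H (insert u T)) S u).image c := by
          intro Y hY
          obtain ⟨x, hx, hx2, hx3⟩ := hcon Y hY
          exact mem_image.2 ⟨x, mem_nb.2 ⟨hx, hx3⟩, hx2⟩
        have e1 := (card_le_card hsub).trans card_image_le
        have e2 := hdeg' u huS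
        omega
      have hP : Proper (rs H (insert u T)) S (Function.update c u j) := by
        apply proper_update'
        · intro x hx y hy hxy hadj
          rw [mem_erase] at hx hy
          refine h1 x hx.2 y hy.2 hxy ⟨hadj.1, ?_, ?_⟩
          · exact (mem_insert.1 hadj.2.1).resolve_left hx.1
          · exact (mem_insert.1 hadj.2.2).resolve_left hy.1
        · intro x hx _ hxj
          exact hjn x hx hxj
      by_cases hju : j = c u
      · subst hju
        rw [Function.update_eq_self] at hP
        exact ⟨c, hP, h2, h3⟩
      · have hNE : NE (rs H (insert u T)) r S C (Function.update c u j) (c u) j := by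
          refine ⟨h2 u huS, hj, Ne.symm hju, hP, ?_, ?_⟩
          · intro v hv
            by_cases hvu : v = u
            · subst hvu; simpa using hj
            · rw [Function.update_of_ne hvu]; exact h2 v hv
          · intro i hi
            rw [card_fib_update huS, h3 i hi]
        exact nearly _ r S C hdeg' (fun S' C' hlt hS' hd' => IH _ (hC ▸ hlt) _ S' C' rfl hS' hd') _ _ _ _ hNE rfl
  obtain ⟨c, h1, h2, h3⟩ := key S subset_rfl
  exact ⟨c, fun u hu v hv huv h => h1 u hu v hv huv ⟨h, hu, hv⟩, h2, h3⟩
end coloring3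
end HSz

set_option linter.unusedSectionVars false
namespace HSz
open Finset Relation
section disc
variable {V : Type*} [DecidableEq V]

def edg (K : Finset V) : Finset (Sym2 V) := K.sym2.filter fun e => ¬ e.IsDiag

def wK (f : Sym2 V → ℤ) (K : Finset V) : ℤ := ∑ e ∈ edg K, f e

def val (f : Sym2 V → ℤ) (T : Finset (Finset V)) : ℤ := ∑ e ∈ tilingEdges T, f e

lemma mem_edg {K : Finset V} {a b : V} : s(a, b) ∈ edg K ↔ a ∈ K ∧ b ∈ K ∧ a ≠ b := by
  simp [edg, and_assoc]

lemma edg_insert {x : V} {Q : Finset V} :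
    edg (insert x Q) = edg Q ∪ (Q.erase x).image fun u => s(x, u) := by
  ext e
  induction e using Sym2.ind with
  | _ a b =>
  rw [mem_union, mem_edg, mem_edg, mem_image]
  simp only [mem_insert, mem_erase]
  constructor
  · rintro ⟨ha | ha, hb | hb, hab⟩
    · subst ha hb; exact absurd rfl hab
    · subst ha; right; exact ⟨b, ⟨Ne.symm hab, hb⟩, rfl⟩
    · subst hb; right; exact ⟨a, ⟨hab, ha⟩, Sym2.eq_swap⟩
    · left; exact ⟨ha, hb, hab⟩
  · rintro (⟨ha, hb, hab⟩ | ⟨u, ⟨hux, huQ⟩, he⟩)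
    · exact ⟨Or.inr ha, Or.inr hb, hab⟩
    · rw [Sym2.eq_iff] at he
      rcases he with ⟨rfl, rfl⟩ | ⟨rfl, rfl⟩
      · exact ⟨Or.inl rfl, Or.inr huQ, Ne.symm hux⟩
      · exact ⟨Or.inr huQ, Or.inl rfl, hux⟩

lemma wK_insert (f : Sym2 V → ℤ) {x : V} {Q : Finset V} (hx : x ∉ Q) :
    wK f (insert x Q) = wK f Q + ∑ u ∈ Q, f s(x, u) := by
  unfold wK
  rw [edg_insert, erase_eq_of_notMem hx, sum_union, sum_image]
  · intro a _ b _ hab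
    simp only [Sym2.eq_iff] at hab
    rcases hab with h | ⟨h1, h2⟩
    · exact h.2
    · exact h2.trans h1
  · rw [disjoint_left]
    intro e he he2
    rw [mem_image] at he2
    obtain ⟨u, _, rfl⟩ := he2
    exact hx (mem_edg.1 he).1

structure Til (G : SimpleGraph V) (r : ℕ) (X : Finset V) (T : Finset (Finset V)) : Prop where
  clq : ∀ K ∈ T, G.IsNClique r K
  dj : (T : Set (Finset V)).Pairwise (fun S S' => Disjoint S S')
  cov : ∀ v, v ∈ X ↔ ∃ K ∈ T, v ∈ K

variable {G : SimpleGraph V} {r : ℕ} {f : Sym2 V → ℤ}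

lemma Til.val_eq {X : Finset V} {T : Finset (Finset V)} (h : Til G r X T) :
    val f T = ∑ K ∈ T, wK f K := by
  unfold val wK
  apply sum_biUnion
  intro K hK K' hK' hne
  have : Disjoint K K' := h.dj hK hK' hne
  rw [Function.onFun, disjoint_left]
  rw [disjoint_left] at this
  intro e he he2
  induction e using Sym2.ind with
  | _ a b => exact this (mem_edg.1 he).1 (mem_edg.1 he2).1

lemma Til.union {X Y : Finset V} {T T' : Finset (Finset V)} (hr : 0 < r) (h : Til G r X T) (h' : Til G r Y T')
    (hXY : Disjoint X Y) : Til G r (X ∪ Y) (T ∪ T') ∧ val f (T ∪ T') = val f T + val f T' := by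
  rw [disjoint_left] at hXY
  have hx : ∀ K ∈ T, ∀ K' ∈ T', Disjoint K K' := by
    intro K hK K' hK'
    rw [disjoint_left]
    intro v hv hv'
    exact hXY ((h.cov v).2 ⟨K, hK, hv⟩) ((h'.cov v).2 ⟨K', hK', hv'⟩)
  have hT : Til G r (X ∪ Y) (T ∪ T') := by
    refine ⟨?_, ?_, ?_⟩
    · intro K hK
      rcases mem_union.1 hK with hK | hK
      · exact h.clq K hK
      · exact h'.clq K hK
    · intro K hK K' hK' hne
      rcases mem_union.1 (mem_coe.1 hK) with hK | hK <;> rcases mem_union.1 (mem_coe.1 hK') with hK' | hK'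
      · exact h.dj hK hK' hne
      · exact hx K hK K' hK'
      · exact (hx K' hK' K hK).symm
      · exact h'.dj hK hK' hne
    · intro v
      rw [mem_union, h.cov, h'.cov]
      simp only [mem_union]
      constructor
      · rintro (⟨K, a, b⟩ | ⟨K, a, b⟩)
        · exact ⟨K, Or.inl a, b⟩
        · exact ⟨K, Or.inr a, b⟩
      · rintro ⟨K, a | a, b⟩
        · exact Or.inl ⟨K, a, b⟩
        · exact Or.inr ⟨K, a, b⟩
  refine ⟨hT, ?_⟩
  rw [hT.val_eq, h.val_eq, h'.val_eq]
  apply sum_union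
  rw [disjoint_left]
  intro K hK hK'
  have := hx K hK K hK'
  rw [disjoint_self] at this
  have h2 := (h.clq K hK).card_eq
  rw [this] at h2
  simp at h2
  omega

lemma Til.single {K : Finset V} (h : G.IsNClique r K) : Til G r K {K} ∧ val f {K} = wK f K := by
  have : Til G r K {K} := ⟨by simpa using h, by simp, by simp⟩
  refine ⟨this, ?_⟩
  rw [this.val_eq, sum_singleton]

lemma Til.card {X : Finset V} {T : Finset (Finset V)} (h : Til G r X T) : X.card = T.card * r := by
  have : X = T.biUnion fun K => K := by
    ext v; rw [h.cov]; simp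
  rw [this, card_biUnion (fun K hK K' hK' hne => h.dj hK hK' hne), sum_const_nat]
  intro K hK; exact (h.clq K hK).card_eq

lemma abs_wK_le (hf : ∀ e ∈ G.edgeSet, f e = 1 ∨ f e = -1) (K : Finset V) (hK : G.IsClique K) :
    |wK f K| ≤ (K.card : ℤ) ^ 2 := by
  induction K using Finset.induction_on with
  | empty => simp [wK, edg]
  | insert x Q hx ih =>
    rw [wK_insert f hx, card_insert_of_notMem hx]
    have h1 := ih (hK.subset (by simp))
    have h2 : |∑ u ∈ Q, f s(x, u)| ≤ ∑ u ∈ Q, (1 : ℤ) := by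
      refine (abs_sum_le_sum_abs _ _).trans (sum_le_sum ?_)
      intro u hu
      have : G.Adj x u := hK (by simp) (by simp [hu]) (by rintro rfl; exact hx hu)
      rcases hf s(x, u) this with h | h <;> rw [h] <;> simp
    rw [sum_const, nsmul_eq_mul, mul_one] at h2
    have h3 := abs_add_le (wK f Q) (∑ u ∈ Q, f s(x, u))
    push_cast
    nlinarith

lemma Til.abs_val_le (hf : ∀ e ∈ G.edgeSet, f e = 1 ∨ f e = -1) {X : Finset V} {T : Finset (Finset V)}
    (h : Til G r X T) : |val f T| ≤ (X.card : ℤ) * r := by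
  rw [h.val_eq, h.card]
  refine (abs_sum_le_sum_abs _ _).trans ?_
  have : ∑ K ∈ T, |wK f K| ≤ ∑ K ∈ T, (r : ℤ) ^ 2 := by
    apply sum_le_sum
    intro K hK
    have := h.clq K hK
    rw [← this.card_eq]
    exact abs_wK_le hf K this.isClique
  refine this.trans (le_of_eq ?_)
  rw [sum_const, nsmul_eq_mul]; push_cast; ring

lemma two_wK {g : V → ℤ} (K : Finset V) (hK : G.IsClique K)
    (hg : ∀ u ∈ K, ∀ v ∈ K, G.Adj u v → 2 * f s(u, v) = g u + g v) :
    2 * wK f K = ((K.card : ℤ) - 1) * ∑ v ∈ K, g v := by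
  induction K using Finset.induction_on with
  | empty => simp [wK, edg]
  | insert x Q hx ih =>
    rw [wK_insert f hx, card_insert_of_notMem hx, sum_insert hx, mul_add,
      ih (hK.subset (by simp)) (fun u hu v hv => hg u (by simp [hu]) v (by simp [hv]))]
    have : ∑ u ∈ Q, 2 * f s(x, u) = ∑ u ∈ Q, (g x + g u) := by
      apply sum_congr rfl
      intro u hu
      exact hg x (by simp) u (by simp [hu]) (hK (by simp) (by simp [hu]) (by rintro rfl; exact hx hu))
    rw [← mul_sum] at this
    rw [this, sum_add_distrib, sum_const, nsmul_eq_mul]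
    push_cast; ring

lemma Til.two_val {X : Finset V} {T : Finset (Finset V)} (h : Til G r X T) {g : V → ℤ}
    (hg : ∀ u ∈ X, ∀ v ∈ X, G.Adj u v → 2 * f s(u, v) = g u + g v) :
    2 * val f T = ((r : ℤ) - 1) * ∑ v ∈ X, g v := by
  have hX : X = T.biUnion fun K => K := by
    ext v; rw [h.cov]; simp
  rw [h.val_eq, mul_sum, hX, sum_biUnion (fun K hK K' hK' hne => h.dj hK hK' hne), mul_sum]
  apply sum_congr rfl
  intro K hK
  have hc := h.clq K hK
  rw [two_wK (g := g) K hc.isClique, hc.card_eq]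
  intro u hu v hv
  exact hg u ((h.cov u).2 ⟨K, hK, hu⟩) v ((h.cov v).2 ⟨K, hK, hv⟩)

/-- Greedy clique building. -/
lemma greedy {S : Finset V} {D : ℕ} (hD : ∀ v ∈ S, ∀ Z ⊆ S, (∀ u ∈ Z, ¬ G.Adj v u) → Z.card ≤ D)
    (F : Finset V) : ∀ (m : ℕ) (X : Finset V), X ⊆ S → (X.card + m) * D + F.card < S.card + D →
    ∃ Q ⊆ S, G.IsNClique m Q ∧ (∀ x ∈ X, ∀ u ∈ Q, G.Adj x u) ∧ Disjoint Q F := by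
  classical
  intro m
  induction m with
  | zero =>
    intro X _ _
    exact ⟨∅, by simp, by simp [SimpleGraph.isNClique_iff], by simp, by simp⟩
  | succ m ih =>
    intro X hX hlt
    obtain ⟨u, huS, huX, huF⟩ : ∃ u ∈ S, (∀ x ∈ X, G.Adj x u) ∧ u ∉ F := by
      by_contra hcon
      push Not at hcon
      have hsub : S ⊆ (X.biUnion fun x => S.filter fun u => ¬ G.Adj x u) ∪ F := by
        intro u hu
        rw [mem_union, mem_biUnion]
        by_contra h2
        push Not at h2
        refine h2.2 (hcon u hu fun x hx => ?_)
        have := h2.1 x hx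
        simp only [mem_filter, not_and, not_not] at this
        exact this hu
      have h1 := (card_le_card hsub).trans (card_union_le _ _)
      have h2 : (X.biUnion fun x => S.filter fun u => ¬ G.Adj x u).card ≤ X.card * D :=
        card_biUnion_le_card_mul _ _ _ fun x hx =>
          hD x (hX hx) _ (filter_subset _ _) fun u hu => (mem_filter.1 hu).2
      nlinarith
    have huX' : u ∉ X := fun h => G.irrefl (huX u h)
    obtain ⟨Q, hQ, hc, hadj, hdis⟩ := ih (insert u X) (insert_subset huS hX) (by
      rw [card_insert_of_notMem huX']; nlinarith)
    have huQ : ∀ v ∈ Q, G.Adj u v := fun v hv => hadj u (mem_insert_self _ _) v hv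
    refine ⟨insert u Q, insert_subset huS hQ, hc.insert huQ, ?_, ?_⟩
    · intro x hx v hv
      rcases mem_insert.1 hv with rfl | hv
      · exact huX x hx
      · exact hadj x (mem_insert_of_mem hx) v hv
    · rw [disjoint_insert_left]; exact ⟨huF, hdis⟩

/-- all tilings of a `2r`-set inside `S` have the same value -/
def NoGadget (G : SimpleGraph V) (r : ℕ) (f : Sym2 V → ℤ) (S : Finset V) : Prop :=
  ∀ Y ⊆ S, Y.card = 2 * r → ∀ T T', Til G r Y T → Til G r Y T' → val f T = val f T'

lemma no_gadget_swap {S : Finset V} (hr : 0 < r) (hN : NoGadget G r f S) {x y : V} (hx : x ∈ S) (hy : y ∈ S)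
    (hxy : x ≠ y) {Q Q' : Finset V} (hQ : Q ⊆ S) (hQ' : Q' ⊆ S) (hc : G.IsNClique (r - 1) Q)
    (hc' : G.IsNClique (r - 1) Q') (hd : Disjoint Q Q') (h1 : ∀ u ∈ Q, G.Adj x u) (h2 : ∀ u ∈ Q, G.Adj y u)
    (h1' : ∀ u ∈ Q', G.Adj x u) (h2' : ∀ u ∈ Q', G.Adj y u) :
    ∑ u ∈ Q, f s(x, u) - ∑ u ∈ Q, f s(y, u) = ∑ u ∈ Q', f s(x, u) - ∑ u ∈ Q', f s(y, u) := by
  have nx : x ∉ Q := fun h => G.irrefl (h1 x h)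
  have ny : y ∉ Q := fun h => G.irrefl (h2 y h)
  have nx' : x ∉ Q' := fun h => G.irrefl (h1' x h)
  have ny' : y ∉ Q' := fun h => G.irrefl (h2' y h)
  have hr1 : r - 1 + 1 = r := by omega
  have c1 := hc.insert h1
  have c2 := hc.insert h2
  have c1' := hc'.insert h1'
  have c2' := hc'.insert h2'
  rw [hr1] at c1 c2 c1' c2'
  obtain ⟨t1, v1⟩ := Til.single (f := f) c1
  obtain ⟨t2, v2⟩ := Til.single (f := f) c2
  obtain ⟨t1', v1'⟩ := Til.single (f := f) c1'
  obtain ⟨t2', v2'⟩ := Til.single (f := f) c2'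
  have d1 : Disjoint (insert x Q) (insert y Q') := by
    rw [disjoint_insert_left, disjoint_insert_right]
    simp [hxy, nx', ny, hd]
  have d2 : Disjoint (insert y Q) (insert x Q') := by
    rw [disjoint_insert_left, disjoint_insert_right]
    simp [hxy.symm, nx, ny', hd]
  obtain ⟨T1, e1⟩ := t1.union (f := f) hr t2' d1
  obtain ⟨T2, e2⟩ := t2.union (f := f) hr t1' d2
  have hE : insert x Q ∪ insert y Q' = insert y Q ∪ insert x Q' := by
    ext v; simp only [mem_union, mem_insert]; tauto
  have hs := hN (insert x Q ∪ insert y Q') (union_subset (insert_subset hx hQ) (insert_subset hy hQ'))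
    (by rw [card_union_of_disjoint d1, c1.card_eq, c2'.card_eq]; omega) _ _ T1 (hE ▸ T2)
  rw [e1, e2, v1, v2, v1', v2', wK_insert f nx, wK_insert f ny, wK_insert f nx', wK_insert f ny'] at hs
  linarith

lemma four_cycle {S : Finset V} {D : ℕ} (hr : 3 ≤ r)
    (hD : ∀ v ∈ S, ∀ Z ⊆ S, (∀ u ∈ Z, ¬ G.Adj v u) → Z.card ≤ D)
    (hS : (r + 1) * D + 2 * r + 2 < S.card) (hN : NoGadget G r f S) {x y u w : V} (hx : x ∈ S) (hy : y ∈ S)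
    (hu : u ∈ S) (hw : w ∈ S) (hxy : x ≠ y) (xu : G.Adj x u) (xw : G.Adj x w) (yu : G.Adj y u)
    (yw : G.Adj y w) : f s(x, u) + f s(y, w) = f s(x, w) + f s(y, u) := by
  have hX : ({x, y, u, w} : Finset V) ⊆ S := by
    simp [insert_subset_iff, hx, hy, hu, hw]
  have hXc : ({x, y, u, w} : Finset V).card ≤ 4 := card_le_four
  obtain ⟨R, hR, hRc, hRa, -⟩ := greedy hD ∅ (r - 2) {x, y, u, w} hX (by
    have : (({x, y, u, w} : Finset V).card + (r - 2)) * D ≤ (r + 2) * D := Nat.mul_le_mul_right _ (by omega)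
    rw [card_empty]
    nlinarith)
  have hxR := hRa x (by simp)
  have hyR := hRa y (by simp)
  have huR := hRa u (by simp)
  have hwR := hRa w (by simp)
  have nu : u ∉ R := fun h => G.irrefl (huR u h)
  have nw : w ∉ R := fun h => G.irrefl (hwR w h)
  have c1 := hRc.insert huR
  have c2 := hRc.insert hwR
  have hr1 : r - 2 + 1 = r - 1 := by omega
  rw [hr1] at c1 c2
  have hFc : (insert u R ∪ insert w R).card ≤ 2 * r := by
    refine (card_union_le _ _).trans ?_
    rw [c1.card_eq, c2.card_eq]; omega
  have hX2 : ({x, y} : Finset V) ⊆ S := by simp [insert_subset_iff, hx, hy]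
  obtain ⟨Q, hQ, hQc, hQa, hQd⟩ := greedy hD (insert u R ∪ insert w R) (r - 1) {x, y} hX2 (by
    have : (({x, y} : Finset V).card + (r - 1)) * D ≤ (r + 1) * D :=
      Nat.mul_le_mul_right _ (by have : ({x, y} : Finset V).card ≤ 2 := card_le_two
                                 omega)
    omega)
  rw [disjoint_union_right] at hQd
  have ins : ∀ z t : V, G.Adj z t → (∀ v ∈ R, G.Adj z v) → ∀ v ∈ insert t R, G.Adj z v := by
    intro z t h1 h2 v hv
    rcases mem_insert.1 hv with rfl | hv
    · exact h1
    · exact h2 v hv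
  have e1 := no_gadget_swap (by omega) hN hx hy hxy (insert_subset hu hR) hQ c1 hQc hQd.1.symm
    (ins x u xu hxR) (ins y u yu hyR) (hQa x (by simp)) (hQa y (by simp))
  have e2 := no_gadget_swap (by omega) hN hx hy hxy (insert_subset hw hR) hQ c2 hQc hQd.2.symm
    (ins x w xw hxR) (ins y w yw hyR) (hQa x (by simp)) (hQa y (by simp))
  rw [sum_insert nu, sum_insert nu] at e1
  rw [sum_insert nw, sum_insert nw] at e2
  linarith

lemma structure_bound {S : Finset V} {D : ℕ} (hr : 3 ≤ r)
    (hf : ∀ e ∈ G.edgeSet, f e = 1 ∨ f e = -1)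
    (hD : ∀ v ∈ S, ∀ Z ⊆ S, (∀ u ∈ Z, ¬ G.Adj v u) → Z.card ≤ D)
    (hS : (r + 1) * D + 2 * r + 2 < S.card) (hN : NoGadget G r f S) {T : Finset (Finset V)}
    (hT : Til G r S T) : (S.card : ℤ) - 4 * D ≤ |val f T| := by
  have hcom : ∀ x ∈ S, ∀ y ∈ S, ∀ z ∈ S, ∃ w ∈ S, G.Adj x w ∧ G.Adj y w ∧ G.Adj z w := by
    intro x hx y hy z hz
    have hX : ({x, y, z} : Finset V) ⊆ S := by simp [insert_subset_iff, hx, hy, hz]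
    obtain ⟨Q, hQ, hQc, hQa, -⟩ := greedy hD ∅ 1 {x, y, z} hX (by
      have : (({x, y, z} : Finset V).card + 1) * D ≤ (r + 1) * D :=
        Nat.mul_le_mul_right _ (by have : ({x, y, z} : Finset V).card ≤ 3 := card_le_three
                                   omega)
      rw [card_empty]; omega)
    obtain ⟨w, hw⟩ := card_eq_one.1 hQc.card_eq
    have hwQ : w ∈ Q := by simp [hw]
    exact ⟨w, hQ hwQ, hQa x (by simp) w hwQ, hQa y (by simp) w hwQ, hQa z (by simp) w hwQ⟩
  have hff : ∀ {u v}, G.Adj u v → f s(u, v) = 1 ∨ f s(u, v) = -1 := fun {u v} h => hf s(u, v) h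
  have htri : ∀ x : V, ∃ u v : V, x ∈ S → u ∈ S ∧ v ∈ S ∧ G.Adj x u ∧ G.Adj x v ∧ G.Adj u v := by
    intro x
    by_cases hx : x ∈ S
    · obtain ⟨u, hu, h1, -, -⟩ := hcom x hx x hx x hx
      obtain ⟨v, hv, h2, h3, -⟩ := hcom x hx u hu u hu
      exact ⟨u, v, fun _ => ⟨hu, hv, h1, h2, h3⟩⟩
    · exact ⟨x, x, fun h => absurd h hx⟩
  choose U W hUW using htri
  have sw : ∀ {x u v w}, x ∈ S → u ∈ S → v ∈ S → w ∈ S → G.Adj x u → G.Adj x v → G.Adj x w →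
      G.Adj u v → G.Adj u w → f s(x, v) - f s(u, v) = f s(x, w) - f s(u, w) := by
    intro x u v w hx hu hv hw xu xv xw uv uw
    have := four_cycle hr hD hS hN hx hu hv hw xu.ne xv xw uv uw
    linarith
  have ind : ∀ {x u v u' v'}, x ∈ S → u ∈ S → v ∈ S → u' ∈ S → v' ∈ S → G.Adj x u → G.Adj x v →
      G.Adj u v → G.Adj x u' → G.Adj x v' → G.Adj u' v' →
      f s(x, u) + f s(x, v) - f s(u, v) = f s(x, u') + f s(x, v') - f s(u', v') := by
    intro x u v u' v' hx hu hv hu' hv' xu xv uv xu' xv' uv'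
    obtain ⟨w, hw, xw, uw, uw'⟩ := hcom x hx u hu u' hu'
    have e1 := sw hx hu hv hw xu xv xw uv uw
    have e2 := sw hx hu' hv' hw xu' xv' xw uv' uw'
    have e3 := sw hx hw hu hu' xw xu xu' uw.symm uw'.symm
    rw [Sym2.eq_swap (a := w) (b := u), Sym2.eq_swap (a := w) (b := u')] at e3
    linarith
  set g : V → ℤ := fun x => f s(x, U x) + f s(x, W x) - f s(U x, W x) with hg
  have gtri : ∀ {x u v}, x ∈ S → u ∈ S → v ∈ S → G.Adj x u → G.Adj x v → G.Adj u v →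
      g x = f s(x, u) + f s(x, v) - f s(u, v) := by
    intro x u v hx hu hv xu xv uv
    obtain ⟨a1, a2, a3, a4, a5⟩ := hUW x hx
    exact ind hx a1 a2 hu hv a3 a4 a5 xu xv uv
  have gedge : ∀ u ∈ S, ∀ v ∈ S, G.Adj u v → 2 * f s(u, v) = g u + g v := by
    intro u hu v hv uv
    obtain ⟨w, hw, uw, vw, -⟩ := hcom u hu v hv v hv
    rw [gtri hu hv hw uv uw vw, gtri hv hu hw uv.symm vw uw, Sym2.eq_swap (a := v) (b := u)]
    ring
  have gval : ∀ x ∈ S, g x = 3 ∨ g x = 1 ∨ g x = -1 ∨ g x = -3 := by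
    intro x hx
    obtain ⟨a1, a2, a3, a4, a5⟩ := hUW x hx
    have b1 := hff a3
    have b2 := hff a4
    have b3 := hff a5
    simp only [hg]
    omega
  have hSne : S.Nonempty := card_pos.1 (by omega)
  obtain ⟨x0, hx0⟩ := hSne
  have h2v := hT.two_val gedge
  have hgen : ∀ s : ℤ, (s = 1 ∨ s = -1) → (∀ x ∈ S, g x = 3 * s ∨ g x = -s) →
      (S.card : ℤ) - 4 * D ≤ |val f T| := by
    intro s hs hgs
    set A := S.filter fun x => g x = 3 * s with hA
    have hAD : A.card ≤ D := by
      rcases A.eq_empty_or_nonempty with h0 | ⟨a, ha⟩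
      · rw [h0]; simp
      · have ha' := mem_filter.1 ha
        refine hD a ha'.1 A (filter_subset _ _) ?_
        intro u hu hau
        have hu' := mem_filter.1 hu
        have e1 := gedge a ha'.1 u hu'.1 hau
        rw [ha'.2, hu'.2] at e1
        have e2 := hff hau
        omega
    have hsum : ∑ v ∈ S, g v = s * (4 * A.card - S.card) := by
      have : ∀ v ∈ S, g v = s * (4 * (if g v = 3 * s then 1 else 0) - 1) := by
        intro v hv
        rcases hgs v hv with h | h
        · rw [if_pos h, h]; ring
        · rw [if_neg (by omega), h]; ring
      rw [sum_congr rfl this, ← mul_sum, sum_sub_distrib, ← mul_sum, ← Nat.cast_one,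
        hA, card_filter]
      simp
    rw [hsum] at h2v
    have hAD' : (A.card : ℤ) ≤ D := by exact_mod_cast hAD
    have hS' : ((r : ℤ) + 1) * D + 2 * r + 2 < S.card := by exact_mod_cast hS
    have hr' : (3 : ℤ) ≤ r := by exact_mod_cast hr
    have hD0 : (0 : ℤ) ≤ D := by positivity
    have h4 : 4 * (D : ℤ) ≤ ((r : ℤ) + 1) * D := mul_le_mul_of_nonneg_right (by linarith) hD0
    have hE : 0 ≤ (S.card : ℤ) - 4 * A.card := by linarith
    have hE2 : 2 * ((S.card : ℤ) - 4 * A.card) ≤ ((r : ℤ) - 1) * ((S.card : ℤ) - 4 * A.card) :=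
      mul_le_mul_of_nonneg_right (by linarith) hE
    rcases hs with rfl | rfl
    · refine le_trans ?_ (neg_le_abs _)
      have : 2 * val f T = -(((r : ℤ) - 1) * ((S.card : ℤ) - 4 * A.card)) := by rw [h2v]; ring
      linarith
    · refine le_trans ?_ (le_abs_self _)
      have : 2 * val f T = ((r : ℤ) - 1) * ((S.card : ℤ) - 4 * A.card) := by rw [h2v]; ring
      linarith
  have hbase : ∀ x ∈ S, ∃ w ∈ S, (g x0 + g w = 2 ∨ g x0 + g w = -2) ∧ (g x + g w = 2 ∨ g x + g w = -2) := by
    intro x hx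
    obtain ⟨w, hw, h1, h2, -⟩ := hcom x0 hx0 x hx x hx
    have e1 := gedge x0 hx0 w hw h1
    have e2 := gedge x hx w hw h2
    have e3 := hff h1
    have e4 := hff h2
    refine ⟨w, hw, ?_, ?_⟩ <;> omega
  by_cases hc : g x0 = 3 ∨ g x0 = -1
  · refine hgen 1 (Or.inl rfl) ?_
    intro x hx
    obtain ⟨w, hw, h1, h2⟩ := hbase x hx
    have := gval x hx
    have := gval w hw
    omega
  · refine hgen (-1) (Or.inr rfl) ?_
    intro x hx
    obtain ⟨w, hw, h1, h2⟩ := hbase x hx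
    have := gval x hx
    have := gval w hw
    have := gval x0 hx0
    omega

lemma exists_til {S : Finset V} {D k : ℕ} (hr : 3 ≤ r)
    (hD : ∀ v ∈ S, ∀ Z ⊆ S, (∀ u ∈ Z, ¬ G.Adj v u) → Z.card ≤ D)
    (hk : S.card = r * k) (hDk : D ≤ k) : ∃ T, Til G r S T := by
  obtain ⟨c, h1, h2, h3⟩ := hajnal_szemeredi r k Gᶜ S (range k) (card_range k) hk (by
    intro v hv
    refine le_trans ?_ hDk
    have hvn : v ∉ nb Gᶜ S v := fun h => Gᶜ.irrefl (mem_nb.1 h).2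
    rw [← card_insert_of_notMem hvn]
    apply hD v hv
    · exact insert_subset hv fun x hx => (mem_nb.1 hx).1
    · intro u hu
      rcases mem_insert.1 hu with rfl | hu
      · exact G.irrefl
      · exact (G.compl_adj v u |>.1 (mem_nb.1 hu).2).2)
  refine ⟨(range k).image (fib S c), ?_, ?_, ?_⟩
  · intro K hK
    obtain ⟨i, hi, rfl⟩ := mem_image.1 hK
    refine ⟨?_, h3 i hi⟩
    intro u hu v hv huv
    rw [mem_coe, mem_fib] at hu hv
    by_contra hn
    exact h1 u hu.1 v hv.1 (hu.2.trans hv.2.symm) ((G.compl_adj u v).2 ⟨huv, hn⟩)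
  · intro K hK K' hK' hne
    rw [mem_coe, mem_image] at hK hK'
    obtain ⟨i, hi, rfl⟩ := hK
    obtain ⟨j, hj, rfl⟩ := hK'
    rw [disjoint_left]
    intro v hv hv'
    rw [mem_fib] at hv hv'
    exact hne (by rw [← hv.2, ← hv'.2])
  · intro v
    constructor
    · intro hv
      exact ⟨_, mem_image_of_mem _ (h2 v hv), mem_fib.2 ⟨hv, rfl⟩⟩
    · rintro ⟨K, hK, hv⟩
      obtain ⟨i, hi, rfl⟩ := mem_image.1 hK
      exact (mem_fib.1 hv).1
end disc
end HSz

set_option linter.unusedSectionVars false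
namespace HSz
open Finset
section fin
variable {V : Type*} [DecidableEq V] [Fintype V] {G : SimpleGraph V} {r : ℕ} {f : Sym2 V → ℤ}

/-- There are `m` (with multiplicity) disjoint gadgets. -/
def Gad (G : SimpleGraph V) (r : ℕ) (f : Sym2 V → ℤ) (m : ℕ) : Prop :=
  ∃ X T T', X.card = 2 * r * m ∧ Til G r X T ∧ Til G r X T' ∧ val f T + m ≤ val f T'

lemma gad_zero : Gad G r f 0 :=
  ⟨∅, ∅, ∅, by simp, ⟨by simp, by simp, by simp⟩, ⟨by simp, by simp, by simp⟩, by simp⟩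

lemma gad_cases (M : ℕ) : Gad G r f M ∨ ∃ m < M, Gad G r f m ∧ ¬ Gad G r f (m + 1) := by
  induction M with
  | zero => exact Or.inl gad_zero
  | succ M ih =>
    rcases ih with h | ⟨m, hm, h⟩
    · by_cases h2 : Gad G r f (M + 1)
      · exact Or.inl h2
      · exact Or.inr ⟨M, by omega, h, h2⟩
    · exact Or.inr ⟨m, by omega, h⟩

lemma disc_main {D k M : ℕ} (hr : 3 ≤ r) (hf : ∀ e ∈ G.edgeSet, f e = 1 ∨ f e = -1)
    (hD : ∀ v : V, ∀ Z : Finset V, (∀ u ∈ Z, ¬ G.Adj v u) → Z.card ≤ D)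
    (hV : Fintype.card V = r * k) (hsz : (r + 1) * D + 2 * r + 2 + 2 * r * M < r * k) :
    ∃ T, Til G r univ T ∧ ((M : ℤ) ≤ 2 * |val f T| ∨
      (r * k : ℤ) - 4 * D - 2 * r * M - 2 * r * M * r ≤ |val f T|) := by
  have key : ∀ m ≤ M, ∀ X : Finset V, X.card = 2 * r * m →
      (univ \ X).card = r * (k - 2 * m) ∧ (r + 1) * D + 2 * r + 2 < (univ \ X).card ∧
      ∃ T, Til G r (univ \ X) T := by
    intro m hm X hX
    have hrm : 2 * r * m ≤ 2 * r * M := Nat.mul_le_mul_left _ hm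
    have hc : (univ \ X).card = r * k - 2 * r * m := by
      rw [card_sdiff_of_subset (subset_univ _), card_univ, hV, hX]
    have hc2 : (univ \ X).card = r * (k - 2 * m) := by
      rw [hc, Nat.mul_sub]; congr 1; ring
    refine ⟨hc2, by omega, ?_⟩
    refine exists_til hr (fun v _ Z _ h => hD v Z h) hc2 ?_
    by_contra hlt
    have : r * (k - 2 * m) ≤ r * D := Nat.mul_le_mul_left _ (by omega)
    rw [← hc2, hc] at this
    have h3 : (r + 1) * D = r * D + D := by ring
    omega
  have hun : ∀ X : Finset V, X ∪ (univ \ X) = univ := fun X => by simp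
  have hdis : ∀ X : Finset V, Disjoint X (univ \ X) := fun X => disjoint_sdiff
  rcases gad_cases (G := G) (r := r) (f := f) M with ⟨X, T, T', hX, h1, h2, hv⟩ | ⟨m, hm, ⟨X, T, T', hX, h1, h2, hv⟩, hno⟩
  · obtain ⟨-, -, R, hR⟩ := key M le_rfl X hX
    obtain ⟨a1, b1⟩ := h1.union (f := f) (by omega) hR (hdis X)
    obtain ⟨a2, b2⟩ := h2.union (f := f) (by omega) hR (hdis X)
    rw [hun] at a1 a2
    by_cases hc : (M : ℤ) ≤ 2 * |val f (T ∪ R)|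
    · exact ⟨_, a1, Or.inl hc⟩
    · refine ⟨_, a2, Or.inl ?_⟩
      have e1 := neg_le_abs (val f (T ∪ R))
      have e2 := le_abs_self (val f (T' ∪ R))
      linarith
  · obtain ⟨hc, hc2, R, hR⟩ := key m hm.le X hX
    have hlt : ∀ Y ⊆ univ \ X, Y.card = 2 * r → ∀ A B, Til G r Y A → Til G r Y B → ¬ val f A < val f B := by
      intro Y hY hYc A B hA hB hAB
      have hd : Disjoint X Y := (hdis X).mono_right hY
      obtain ⟨a1, b1⟩ := h1.union (f := f) (by omega) hA hd
      obtain ⟨a2, b2⟩ := h2.union (f := f) (by omega) hB hd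
      refine hno ⟨X ∪ Y, _, _, ?_, a1, a2, ?_⟩
      · rw [card_union_of_disjoint hd, hX, hYc]; ring
      · push_cast; linarith
    have hN : NoGadget G r f (univ \ X) := by
      intro Y hY hYc A B hA hB
      have e1 := hlt Y hY hYc A B hA hB
      have e2 := hlt Y hY hYc B A hB hA
      omega
    have hb := structure_bound hr hf (fun v _ Z _ h => hD v Z h) hc2 hN hR
    obtain ⟨a1, b1⟩ := h1.union (f := f) (by omega) hR (hdis X)
    rw [hun] at a1
    refine ⟨_, a1, Or.inr ?_⟩
    have hx := h1.abs_val_le hf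
    have hsum : (X.card : ℤ) + (univ \ X).card = r * k := by
      have : X.card + (univ \ X).card = r * k := by
        rw [← card_union_of_disjoint (hdis X), hun, card_univ, hV]
      exact_mod_cast this
    have hXM : (X.card : ℤ) ≤ 2 * r * M := by
      rw [hX]; exact_mod_cast Nat.mul_le_mul_left _ hm.le
    have hXr : (X.card : ℤ) * r ≤ 2 * r * M * r := mul_le_mul_of_nonneg_right hXM (by positivity)
    rw [b1]
    have e3 : |val f R| ≤ |val f T + val f R| + |val f T| := by
      have := abs_sub (val f T + val f R) (val f T)
      rwa [add_sub_cancel_left] at this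
    linarith

lemma nonnbr_card [DecidableRel G.Adj] (v : V) (Z : Finset V) (h : ∀ u ∈ Z, ¬ G.Adj v u) :
    Z.card ≤ Fintype.card V - G.minDegree := by
  have hd : Disjoint Z (G.neighborFinset v) := by
    rw [disjoint_left]
    intro u hu hu2
    exact h u hu ((G.mem_neighborFinset v u).1 hu2)
  have h1 := card_le_univ (Z ∪ G.neighborFinset v)
  rw [card_union_of_disjoint hd, G.card_neighborFinset_eq_degree] at h1
  have := G.minDegree_le_degree v
  omega
end fin
end HSz

/-- A discrepancy version of the Hajnal–Szemerédi theorem. -/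
theorem discrepancy_hajnal_szemeredi (r : ℕ) (hr : 3 ≤ r) (η : ℝ) (hη : 0 < η) :
    ∃ (n₀ : ℕ) (γ : ℝ), 0 < γ ∧
      ∀ n : ℕ, n₀ ≤ n → r ∣ n →
        ∀ (G : SimpleGraph (Fin n)) [DecidableRel G.Adj],
          (G.minDegree : ℝ) ≥ (1 - 1 / (r + 1) + η) * n →
          ∀ f : Sym2 (Fin n) → ℤ, (∀ e ∈ G.edgeSet, f e = 1 ∨ f e = -1) →
            ∃ T : Finset (Finset (Fin n)), IsPerfectKTiling G r T ∧
              ((|∑ e ∈ tilingEdges T, f e| : ℤ) : ℝ) ≥ γ * n := by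
    classical
  have hr0 : (3 : ℝ) ≤ r := by exact_mod_cast hr
  set ε : ℝ := η / (r * (r + 1)) with hε
  have hrr : (0 : ℝ) < r * (r + 1) := by positivity
  have hε0 : 0 < ε := by positivity
  have hεη : ε * (r * (r + 1)) = η := by rw [hε]; field_simp
  refine ⟨⌈2 / ε⌉₊ + ⌈4 / η⌉₊ + 1, min η (ε / 4), by positivity, ?_⟩
  intro n hn hdvd G _ hδ f hf
  obtain ⟨k, hk⟩ := hdvd
  have hn' : (⌈2 / ε⌉₊ : ℝ) + ⌈4 / η⌉₊ + 1 ≤ n := by exact_mod_cast hn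
  have hc1 := Nat.le_ceil (2 / ε)
  have hc2 := Nat.le_ceil (4 / η)
  have hc1' : (0 : ℝ) ≤ 2 / ε := by positivity
  have hc2' : (0 : ℝ) ≤ 4 / η := by positivity
  have hnε : 2 ≤ ε * n := by
    have : 2 / ε ≤ n := by linarith
    rw [div_le_iff₀ hε0] at this; linarith
  have hnη : 4 < η * n := by
    have : 4 / η < n := by linarith
    rw [div_lt_iff₀ hη] at this; linarith
  have hn0 : (0 : ℝ) ≤ n := by positivity
  set M : ℕ := ⌊ε * n⌋₊ with hM
  have hM1 : (M : ℝ) ≤ ε * n := Nat.floor_le (by positivity)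
  have hM2 : ε * n < M + 1 := Nat.lt_floor_add_one _
  have hnpos : 0 < n := by omega
  haveI : Nonempty (Fin n) := ⟨⟨0, hnpos⟩⟩
  set D : ℕ := Fintype.card (Fin n) - G.minDegree with hDdef
  have hmd : G.minDegree ≤ n := by
    have := G.minDegree_lt_card
    rw [Fintype.card_fin] at this; omega
  have hDr : (D : ℝ) = n - G.minDegree := by
    rw [hDdef, Fintype.card_fin, Nat.cast_sub hmd]
  have hD1 : ((r : ℝ) + 1) * D ≤ n - (r + 1) * (η * n) := by
    have h1 : (D : ℝ) ≤ (1 / (r + 1) - η) * n := by rw [hDr]; linarith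
    have h2 : ((r : ℝ) + 1) * D ≤ (r + 1) * ((1 / (r + 1) - η) * n) :=
      mul_le_mul_of_nonneg_left h1 (by positivity)
    have h3 : ((r : ℝ) + 1) * ((1 / (r + 1) - η) * n) = n - (r + 1) * (η * n) := by
      field_simp
    linarith
  have hMr : (r : ℝ) * (r + 1) * M ≤ η * n := by
    have : (r : ℝ) * (r + 1) * M ≤ r * (r + 1) * (ε * n) := mul_le_mul_of_nonneg_left hM1 hrr.le
    calc _ ≤ _ := this
      _ = (ε * (r * (r + 1))) * n := by ring
      _ = _ := by rw [hεη]
  have hM0 : (0 : ℝ) ≤ M := by positivity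
  have hrM : 4 * ((r : ℝ) * M) ≤ (r + 1) * (r * M) :=
    mul_le_mul_of_nonneg_right (by linarith) (by positivity)
  have hrη : (r : ℝ) * 4 ≤ r * (η * n) := mul_le_mul_of_nonneg_left hnη.le (by linarith)
  have hnk : (n : ℝ) = r * k := by exact_mod_cast hk
  have hsz : (r + 1) * D + 2 * r + 2 + 2 * r * M < r * k := by
    have : ((r : ℝ) + 1) * D + 2 * r + 2 + 2 * r * M < r * k := by
      rw [← hnk]; nlinarith
    exact_mod_cast this
  obtain ⟨T, hT, hv⟩ := HSz.disc_main (f := f) (k := k) (M := M) hr hf (HSz.nonnbr_card (G := G))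
    (by rw [Fintype.card_fin, hk]) hsz
  refine ⟨T, ⟨hT.clq, hT.dj, fun v => (hT.cov v).1 (Finset.mem_univ v)⟩, ?_⟩
  change min η (ε / 4) * (n : ℝ) ≤ ((|HSz.val f T| : ℤ) : ℝ)
  rcases hv with hv | hv
  · have hv' : (M : ℝ) ≤ 2 * ((|HSz.val f T| : ℤ) : ℝ) := by exact_mod_cast hv
    have : min η (ε / 4) * (n : ℝ) ≤ ε / 4 * n := mul_le_mul_of_nonneg_right (min_le_right _ _) hn0
    linarith
  · have hv' : (r * k : ℝ) - 4 * D - 2 * r * M - 2 * r * M * r ≤ ((|HSz.val f T| : ℤ) : ℝ) := by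
      exact_mod_cast hv
    have : min η (ε / 4) * (n : ℝ) ≤ η * n := mul_le_mul_of_nonneg_right (min_le_left _ _) hn0
    have hD0 : (0 : ℝ) ≤ D := by positivity
    have h4 : 4 * (D : ℝ) ≤ (r + 1) * D := mul_le_mul_of_nonneg_right (by linarith) hD0
    have h5 : 4 * (η * n) ≤ (r + 1) * (η * n) := mul_le_mul_of_nonneg_right (by linarith) (by positivity)
    rw [← hnk] at hv'
    nlinarith
end

section
/- Let 0 < c < 1/4 and let n ∈ ℕ be sufficiently large. If G is an n-vertex graph with δ(G) ≥ (3/4 + c)n and f: E(G) → {−1,1}, then there is a Hamilton cycle in G with absolute discrepancy at least cn/32 (with respect to f). -/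
namespace HamDisc

variable {V : Type*}

/-- Edges of the path visiting the vertices of a list in order. -/
def pe : List V → Multiset (Sym2 V)
  | [] => 0
  | [_] => 0
  | a :: b :: t => s(a, b) ::ₘ pe (b :: t)

/-- Edges of the closed walk visiting the vertices of a list in cyclic order. -/
def ce : List V → Multiset (Sym2 V)
  | [] => 0
  | a :: t => pe (a :: (t ++ [a]))

@[simp] lemma pe_nil : pe ([] : List V) = 0 := rfl
@[simp] lemma pe_single (a : V) : pe [a] = 0 := rfl
@[simp] lemma pe_cons_cons (a b : V) (t : List V) :
    pe (a :: b :: t) = s(a, b) ::ₘ pe (b :: t) := rfl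
@[simp] lemma ce_cons (a : V) (t : List V) : ce (a :: t) = pe (a :: (t ++ [a])) := rfl

lemma pe_append (l₁ : List V) (a : V) (l₂ : List V) :
    pe (l₁ ++ a :: l₂) = pe (l₁ ++ [a]) + pe (a :: l₂) := by
  induction l₁ with
  | nil => simp
  | cons x t ih =>
    cases t with
    | nil => simp
    | cons y t => simpa using ih

lemma pe_join (l₁ : List V) (p q : V) (l₂ : List V) :
    pe (l₁ ++ p :: q :: l₂) = s(p, q) ::ₘ (pe (l₁ ++ [p]) + pe (q :: l₂)) := by
  rw [pe_append]; simp

lemma pe_reverse (l : List V) : pe l.reverse = pe l := by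
  induction l with
  | nil => rfl
  | cons x t ih =>
    cases t with
    | nil => rfl
    | cons y t =>
      have := pe_join t.reverse y x []
      simp only [List.reverse_cons, List.append_assoc, List.cons_append, List.nil_append] at *
      rw [this, ih, Sym2.eq_swap]; simp

lemma ce_rotate (l₁ l₂ : List V) : ce (l₁ ++ l₂) = ce (l₂ ++ l₁) := by
  cases l₁ with
  | nil => simp
  | cons a t =>
    cases l₂ with
    | nil => simp
    | cons b s =>
      have h1 := pe_append (a :: t) b (s ++ [a])
      have h2 := pe_append (b :: s) a (t ++ [b])
      simp only [List.cons_append, ce_cons, List.append_assoc] at *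
      rw [h1, h2, add_comm]

lemma ce_reverse (l : List V) : ce l.reverse = ce l := by
  cases l with
  | nil => rfl
  | cons a t =>
    rw [List.reverse_cons, ce_rotate]
    have := pe_reverse (a :: (t ++ [a]))
    simpa using this

lemma mem_of_mem_pe {l : List V} {e : Sym2 V} (he : e ∈ pe l) {x : V} (hx : x ∈ e) : x ∈ l := by
  induction l with
  | nil => simp at he
  | cons a t ih =>
    cases t with
    | nil => simp at he
    | cons b t =>
      simp only [pe_cons_cons, Multiset.mem_cons] at he
      rcases he with rfl | he
      · simp only [Sym2.mem_iff] at hx; rcases hx with rfl | rfl <;> simp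
      · exact List.mem_cons_of_mem _ (ih he)

lemma exists_split_of_mem_pe {l : List V} {e : Sym2 V} (he : e ∈ pe l) :
    ∃ l₁ x y l₂, l = l₁ ++ x :: y :: l₂ ∧ e = s(x, y) := by
  induction l with
  | nil => simp at he
  | cons a t ih =>
    cases t with
    | nil => simp at he
    | cons b t =>
      simp only [pe_cons_cons, Multiset.mem_cons] at he
      rcases he with rfl | he
      · exact ⟨[], a, b, t, rfl, rfl⟩
      · obtain ⟨l₁, x, y, l₂, h, h'⟩ := ih he
        exact ⟨a :: l₁, x, y, l₂, by simp [h], h'⟩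

lemma exists_rotate_of_mem_ce {l : List V} (hl : 2 ≤ l.length) {e : Sym2 V} (he : e ∈ ce l) :
    ∃ u v t, e = s(u, v) ∧ (v :: (t ++ [u])).Perm l ∧ ce (v :: (t ++ [u])) = ce l := by
  cases l with
  | nil => simp at hl
  | cons a t =>
    obtain ⟨l₁, x, y, l₂, h, h'⟩ := exists_split_of_mem_pe he
    rcases List.eq_nil_or_concat l₂ with rfl | ⟨l₃, z, rfl⟩
    · have h2 : (a :: t) ++ [a] = (l₁ ++ [x]) ++ [y] := by simpa using h
      obtain ⟨h3, h4⟩ := List.append_inj' h2 rfl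
      cases l₁ with
      | nil => simp at h3; simp [h3] at hl
      | cons b l₁ =>
        simp only [List.cons_append, List.cons.injEq] at h3 h4
        obtain ⟨rfl, rfl⟩ := h3
        obtain ⟨rfl, -⟩ := h4
        exact ⟨x, a, l₁, h', List.Perm.refl _, rfl⟩
    · have h2 : (a :: t) ++ [a] = (l₁ ++ x :: y :: l₃) ++ [z] := by simpa using h
      obtain ⟨h3, h4⟩ := List.append_inj' h2 rfl
      have e1 : a :: t = (l₁ ++ [x]) ++ (y :: l₃) := by simp [h3]
      have e2 : y :: ((l₃ ++ l₁) ++ [x]) = (y :: l₃) ++ (l₁ ++ [x]) := by simp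
      refine ⟨x, y, l₃ ++ l₁, h', ?_, ?_⟩
      · rw [e1, e2]; exact List.perm_append_comm
      · rw [e1, e2]; exact ce_rotate _ _

lemma exists_front_of_mem_ce {l : List V} (hl : 2 ≤ l.length) {b c : V} (he : s(b, c) ∈ ce l) :
    ∃ t, (b :: c :: t).Perm l ∧ ce (b :: c :: t) = ce l := by
  obtain ⟨u, v, t, h, hp, hc⟩ := exists_rotate_of_mem_ce hl he
  rw [Sym2.eq_iff] at h
  rcases h with ⟨rfl, rfl⟩ | ⟨rfl, rfl⟩
  · refine ⟨t, ?_, ?_⟩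
    · exact (List.perm_append_comm (l₁ := [b]) (l₂ := c :: t)).trans (by simpa using hp)
    · rw [← hc]; exact ce_rotate [b] (c :: t)
  · refine ⟨t.reverse, ?_, ?_⟩
    · refine List.Perm.trans ?_ hp
      refine List.Perm.cons _ ?_
      refine (List.perm_append_comm (l₁ := [c]) (l₂ := t.reverse)).trans ?_
      exact List.Perm.append_right _ (List.reverse_perm t)
    · rw [← hc, ← ce_reverse (b :: (t ++ [c]))]
      have := ce_rotate [b] (c :: t.reverse)
      simpa using this

lemma exists_segment {l : List V} (hn : l.Nodup) (hl : 2 ≤ l.length) {a b c d : V}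
    (hac : a ≠ c) (hbd : b ≠ d) (had : a ≠ d)
    (h1 : s(a, b) ∈ ce l) (h2 : s(b, c) ∈ ce l) (h3 : s(c, d) ∈ ce l) :
    ∃ t, (a :: b :: c :: d :: t).Perm l ∧ ce (a :: b :: c :: d :: t) = ce l := by
  obtain ⟨t, hp, hc⟩ := exists_front_of_mem_ce hl h2
  have hn' := hp.nodup_iff.mpr hn
  rw [← hc] at h1
  rcases List.eq_nil_or_concat t with rfl | ⟨r, x, rfl⟩
  · simp [hac] at h1
    simp at hn'
    grind
  have e1 := pe_join (b :: c :: r) x b []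
  have hxa : x = a := by
    simp only [List.concat_eq_append, ce_cons, List.append_assoc, List.cons_append,
      List.nil_append] at h1 e1
    rw [e1] at h1
    simp only [pe_cons_cons, Multiset.mem_cons, Multiset.mem_add, pe_single,
      Multiset.notMem_zero, or_false] at h1
    rcases h1 with h | h | h
    · grind
    · grind
    · have := mem_of_mem_pe h (x := b) (by simp)
      grind
  subst hxa
  have e2 : ce (x :: b :: c :: r) = ce l := by
    rw [← hc, List.concat_eq_append]; exact ce_rotate [x] (b :: c :: r)
  have e3 : (x :: b :: c :: r).Perm l := by
    refine List.Perm.trans ?_ hp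
    rw [List.concat_eq_append]; exact List.perm_append_comm (l₁ := [x]) (l₂ := b :: c :: r)
  have hn2 := e3.nodup_iff.mpr hn
  rw [← e2] at h3
  cases r with
  | nil => simp at h3; grind
  | cons y r =>
    have : y = d := by
      simp only [ce_cons, List.cons_append, pe_cons_cons, Multiset.mem_cons] at h3
      rcases h3 with h | h | h | h
      · grind
      · grind
      · grind
      · have := mem_of_mem_pe h (x := c) (by simp)
        grind
    subst this
    exact ⟨r, e3, e2⟩

lemma sum_pe (φ : V → ℤ) (g : Sym2 V → ℤ) (hg : ∀ x y, g s(x, y) = φ x + φ y) (a b : V)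
    (l : List V) :
    ((pe (a :: (l ++ [b]))).map g).sum = φ a + 2 * (l.map φ).sum + φ b := by
  induction l generalizing a with
  | nil => simp [hg]
  | cons x t ih =>
    have := ih x
    simp only [List.cons_append, pe_cons_cons, Multiset.map_cons, Multiset.sum_cons, hg,
      List.map_cons, List.sum_cons] at *
    rw [this]; ring

lemma sum_ce (φ : V → ℤ) (g : Sym2 V → ℤ) (hg : ∀ x y, g s(x, y) = φ x + φ y) (l : List V) :
    ((ce l).map g).sum = 2 * (l.map φ).sum := by
  cases l with
  | nil => rfl
  | cons a t => rw [ce_cons, sum_pe φ g hg]; simp; ring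

lemma exists_walk (G : SimpleGraph V) (a b : V) (l : List V)
    (h : ∀ e ∈ pe (a :: (l ++ [b])), e ∈ G.edgeSet) :
    ∃ p : G.Walk a b, p.support = a :: (l ++ [b]) ∧ (p.edges : Multiset (Sym2 V)) = pe (a :: (l ++ [b])) := by
  induction l generalizing a with
  | nil =>
    have : G.Adj a b := by simpa using h
    exact ⟨.cons this .nil, by simp, by simp⟩
  | cons x t ih =>
    simp only [List.cons_append, pe_cons_cons, Multiset.mem_cons, forall_eq_or_imp] at h
    obtain ⟨p, hp, hp'⟩ := ih x h.2
    have hadj : G.Adj a x := h.1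
    refine ⟨.cons hadj p, by simp [hp], ?_⟩
    simp only [SimpleGraph.Walk.edges_cons, List.cons_append, pe_cons_cons]
    rw [← hp']; rfl

lemma exists_cycle [Fintype V] [DecidableEq V] (G : SimpleGraph V) (hV : 3 ≤ Fintype.card V)
    (l : List V) (hn : l.Nodup)
    (hl : l.length = Fintype.card V) (h : ∀ e ∈ ce l, e ∈ G.edgeSet) (f : Sym2 V → ℤ) :
    ∃ (u : V) (p : G.Walk u u), p.IsHamiltonianCycle ∧
      ∑ e ∈ p.edges.toFinset, f e = ((ce l).map f).sum := by
  cases l with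
  | nil => simp at hl; omega
  | cons a t =>
    obtain ⟨p, hp, hp'⟩ := exists_walk G a a t h
    have hlen : p.length = Fintype.card V := by
      have := p.length_support
      rw [hp] at this; simp at this hl; omega
    have hnil : ¬ p.Nil := by
      rw [SimpleGraph.Walk.not_nil_iff_lt_length]; omega
    have hc : p.IsCycle := by
      rw [SimpleGraph.Walk.isCycle_iff_isPath_tail_and_le_length]
      refine ⟨?_, by omega⟩
      rw [SimpleGraph.Walk.isPath_def, SimpleGraph.Walk.support_tail_of_not_nil _ hnil, hp]
      simp only [List.tail_cons]
      exact (List.perm_append_comm (l₁ := t) (l₂ := [a])).nodup_iff.mpr (by simpa using hn)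
    refine ⟨a, p, SimpleGraph.Walk.isHamiltonianCycle_iff_isCycle_and_length_eq.mpr ⟨hc, hlen⟩, ?_⟩
    rw [List.sum_toFinset _ hc.edges_nodup, ce_cons, ← hp']
    simp

lemma mem_pe_of_eq {l l₁ l₂ : List V} {x y : V} (h : l = l₁ ++ x :: y :: l₂) : s(x, y) ∈ pe l := by
  rw [h, pe_join]; simp

lemma mem_pe_infix {l m : List V} (h : l <:+: m) {e : Sym2 V} (he : e ∈ pe l) : e ∈ pe m := by
  obtain ⟨l₁, x, y, l₂, rfl, rfl⟩ := exists_split_of_mem_pe he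
  obtain ⟨s, t, rfl⟩ := h
  exact mem_pe_of_eq (l₁ := s ++ l₁) (l₂ := l₂ ++ t) (by simp)

lemma mem_ce_infix {l m : List V} (h : l <:+: m) {e : Sym2 V} (he : e ∈ pe l) : e ∈ ce m := by
  have := mem_pe_infix h he
  cases m with
  | nil => simp at this
  | cons a t => exact mem_pe_infix ⟨[], [a], by simp⟩ this

lemma pe_nodup {l : List V} (h : l.Nodup) : (pe l).Nodup := by
  induction l with
  | nil => simp
  | cons a t ih =>
    cases t with
    | nil => simp
    | cons b t =>
      rw [pe_cons_cons, Multiset.nodup_cons]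
      refine ⟨fun hm => ?_, ih h.of_cons⟩
      have := mem_of_mem_pe hm (x := a) (by simp)
      exact (List.nodup_cons.mp h).1 this

lemma count_splits [DecidableEq V] (A B : V → Prop) [DecidablePred A] [DecidablePred B]
    (F : Finset (Sym2 V)) (a : V) (l : List V)
    (h : ∀ l₁ p q l₂, a :: l = l₁ ++ p :: q :: l₂ → A p → B q → s(p, q) ∈ F) :
    (a :: l).dropLast.countP (fun x => decide (A x)) + l.countP (fun x => decide (B x))
      ≤ l.length + ((pe (a :: l)).filter (· ∈ F)).card := by
  induction l generalizing a with
  | nil => simp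
  | cons b t ih =>
    have h1 := ih b (fun l₁ p q l₂ e => h (a :: l₁) p q l₂ (by simp [e]))
    have h2 := h [] a b t rfl
    simp only [pe_cons_cons, List.dropLast_cons_cons, List.countP_cons, List.length_cons,
      Multiset.filter_cons, Multiset.card_add, decide_eq_true_eq] at *
    have h3 : (if A a then 1 else 0) + (if B b then 1 else 0) ≤
        1 + Multiset.card (if s(a, b) ∈ F then {s(a, b)} else (0 : Multiset (Sym2 V))) := by
      split_ifs <;> simp_all
    omega

section Posa

variable [Fintype V] [DecidableEq V] (G : SimpleGraph V) [DecidableRel G.Adj]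

lemma countP_adj {l : List V} (hn : l.Nodup) (hl : l.length = Fintype.card V) (u : V) :
    l.countP (fun x => decide (G.Adj u x)) = G.degree u := by
  have hu : l.toFinset = Finset.univ := by
    rw [← Finset.card_eq_iff_eq_univ, List.toFinset_card_of_nodup hn, hl]
  rw [← SimpleGraph.card_neighborFinset_eq_degree, List.countP_eq_length_filter,
    ← List.toFinset_card_of_nodup (hn.filter _)]
  congr 1
  ext x
  have : x ∈ l := by rw [← List.mem_toFinset, hu]; simp
  simp [this]

lemma exists_switch (F : Finset (Sym2 V)) (k : ℕ) (hk : ∀ v, k ≤ G.degree v)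
    (hF : Fintype.card V + F.card ≤ 2 * k) (u v : V) (t : List V)
    (hn : (v :: (t ++ [u])).Nodup) (hl : (v :: (t ++ [u])).length = Fintype.card V)
    (huv : ¬ G.Adj u v) :
    ∃ l₁ p q l₂, v :: (t ++ [u]) = l₁ ++ p :: q :: l₂ ∧ G.Adj u p ∧ G.Adj v q ∧ s(p, q) ∉ F := by
  by_contra! hcon
  have h := count_splits (G.Adj u) (G.Adj v) F v (t ++ [u]) (fun l₁ p q l₂ e => hcon l₁ p q l₂ e)
  have h1 := countP_adj G hn hl u
  have h2 := countP_adj G hn hl v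
  have h3 : (v :: (t ++ [u])).dropLast = v :: t := by
    rw [← List.cons_append, List.dropLast_concat]
  rw [h3] at h
  have h4 : ((pe (v :: (t ++ [u]))).filter (· ∈ F)).card ≤ F.card := by
    rw [← Multiset.toFinset_card_of_nodup ((pe_nodup hn).filter _)]
    apply Finset.card_le_card
    intro e he
    simp at he; exact he.2
  simp [List.countP_cons, List.countP_append] at h1 h2 h hl
  have := hk u
  have := hk v
  simp [huv] at *
  omega

lemma posa (F : Finset (Sym2 V)) (hFG : ∀ e ∈ F, e ∈ G.edgeSet) (k : ℕ) (hk : ∀ v, k ≤ G.degree v)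
    (hF : Fintype.card V + F.card ≤ 2 * k) (hV : 2 ≤ Fintype.card V) (N : ℕ) (l : List V)
    (hn : l.Nodup) (hl : l.length = Fintype.card V) (hFl : ∀ e ∈ F, e ∈ ce l)
    (hN : ((ce l).filter (· ∉ G.edgeSet)).card ≤ N) :
    ∃ l' : List V, l'.Nodup ∧ l'.length = Fintype.card V ∧ (∀ e ∈ F, e ∈ ce l') ∧
      ∀ e ∈ ce l', e ∈ G.edgeSet := by
  induction N generalizing l with
  | zero =>
    refine ⟨l, hn, hl, hFl, fun e he => ?_⟩
    by_contra hc
    have : e ∈ (ce l).filter (· ∉ G.edgeSet) := by simp [he, hc]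
    rw [Nat.le_zero, Multiset.card_eq_zero] at hN
    rw [hN] at this; simp at this
  | succ N ih =>
    by_cases hall : ∀ e ∈ ce l, e ∈ G.edgeSet
    · exact ⟨l, hn, hl, hFl, hall⟩
    push Not at hall
    obtain ⟨e, he, heG⟩ := hall
    obtain ⟨u, v, t, rfl, hp, hc⟩ := exists_rotate_of_mem_ce (by omega) he
    have hn' := hp.nodup_iff.mpr hn
    have hl' := hp.length_eq.trans hl
    obtain ⟨l₁, p, q, l₂, heq, hup, hvq, hpq⟩ := exists_switch G F k hk hF u v t hn' hl' heG
    have huv : s(u, v) ∉ F := fun h => heG (hFG _ h)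
    -- rewrite the pieces
    have c0 : ce (v :: (t ++ [u])) = s(u, v) ::ₘ pe (v :: (t ++ [u])) := by
      have := pe_join (v :: t) u v []
      simpa using this
    have c1 : pe (v :: (t ++ [u])) = s(p, q) ::ₘ (pe (l₁ ++ [p]) + pe (q :: l₂)) := by
      rw [heq, pe_join]
    -- the two parts, reading first and last vertices
    obtain ⟨m₁, hm₁⟩ : ∃ m₁, l₁ ++ [p] = v :: m₁ := by
      cases l₁ with
      | nil => simp at heq; exact ⟨[], by simp [heq.1]⟩
      | cons a l₁ => simp at heq; exact ⟨l₁ ++ [p], by simp [heq.1]⟩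
    obtain ⟨m₂, hm₂⟩ : ∃ m₂, q :: l₂ = m₂ ++ [u] := by
      rcases List.eq_nil_or_concat (q :: l₂) with h | ⟨m₂, z, h⟩
      · simp at h
      · have e1 : (v :: t) ++ [u] = (l₁ ++ p :: m₂) ++ [z] := by
          rw [List.concat_eq_append] at h
          rw [List.cons_append, heq, h]; simp
        have := (List.append_inj' e1 rfl).2
        simp at this; subst this
        exact ⟨m₂, by simpa using h⟩
    set L := (l₁ ++ [p]).reverse ++ (q :: l₂) with hL
    have c2 : ce L = s(u, p) ::ₘ s(v, q) ::ₘ (pe (l₁ ++ [p]) + pe (q :: l₂)) := by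
      have e0 : L = p :: (l₁.reverse ++ (q :: l₂)) := by simp [hL]
      have e1 : p :: (l₁.reverse ++ (q :: l₂) ++ [p]) = m₁.reverse ++ v :: q :: (l₂ ++ [p]) := by
        have : p :: (l₁.reverse ++ (q :: l₂) ++ [p]) = (l₁ ++ [p]).reverse ++ (q :: l₂) ++ [p] := by
          simp
        rw [this, hm₁]; simp
      have e2 : q :: (l₂ ++ [p]) = m₂ ++ u :: p :: [] := by
        rw [← List.cons_append, hm₂]; simp
      have e3 : m₁.reverse ++ [v] = (l₁ ++ [p]).reverse := by rw [hm₁]; simp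
      rw [e0, ce_cons, e1, pe_join, e3, pe_reverse, e2, pe_join, ← hm₂, pe_single,
        Multiset.cons_swap]
      simp [Multiset.add_cons]
    have hLp : L.Perm l := by
      refine List.Perm.trans ?_ hp
      rw [heq]
      have : l₁ ++ p :: q :: l₂ = (l₁ ++ [p]) ++ (q :: l₂) := by simp
      rw [this]
      exact List.Perm.append_right _ (List.reverse_perm _)
    refine ih L (hLp.nodup_iff.mpr hn) (hLp.length_eq.trans hl) ?_ ?_
    · intro e he
      have h1 := hFl e he
      rw [← hc, c0, c1] at h1
      rw [c2]
      simp only [Multiset.mem_cons, Multiset.mem_add] at h1 ⊢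
      rcases h1 with rfl | rfl | h1
      · exact absurd he huv
      · exact absurd he hpq
      · tauto
    · rw [← hc, c0, c1] at hN
      rw [c2]
      rw [Multiset.filter_cons_of_neg (p := fun e => e ∉ G.edgeSet) _ (by simpa using hup),
        Multiset.filter_cons_of_neg (p := fun e => e ∉ G.edgeSet) _ (by simpa using hvq)]
      rw [Multiset.filter_cons_of_pos (p := fun e => e ∉ G.edgeSet) _ heG,
        Multiset.card_cons] at hN
      have : Multiset.card ((pe (l₁ ++ [p]) + pe (q :: l₂)).filter (· ∉ G.edgeSet)) ≤
          Multiset.card ((s(p, q) ::ₘ (pe (l₁ ++ [p]) + pe (q :: l₂))).filter (· ∉ G.edgeSet)) :=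
        Multiset.card_le_card (Multiset.filter_le_filter (fun e => e ∉ G.edgeSet)
          (Multiset.le_cons_self _ _))
      omega

end Posa

/-- A gadget: two paths on the same four vertices with the same ends, of different weight. -/
structure IsGad (G : SimpleGraph V) (f : Sym2 V → ℤ) (a b c d : V) : Prop where
  ab : G.Adj a b
  bc : G.Adj b c
  cd : G.Adj c d
  ac : G.Adj a c
  bd : G.Adj b d
  ad : a ≠ d
  pos : f s(a, c) + f s(b, d) + 2 ≤ f s(a, b) + f s(c, d)

/-- A list of gadgets. -/
def GadList (G : SimpleGraph V) (f : Sym2 V → ℤ) (L : List (List V)) : Prop :=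
  ∀ g ∈ L, ∃ a b c d, g = [a, b, c, d] ∧ IsGad G f a b c d

lemma flip (G : SimpleGraph V) (f : Sym2 V → ℤ) (L : List (List V)) (hL : GadList G f L)
    (hLn : L.flatten.Nodup) (l : List V) (hn : l.Nodup) (hl : 2 ≤ l.length)
    (hG : ∀ e ∈ ce l, e ∈ G.edgeSet) (hF : ∀ g ∈ L, ∀ e ∈ pe g, e ∈ ce l) :
    ∃ l' : List V, l'.Perm l ∧ (∀ e ∈ ce l', e ∈ G.edgeSet) ∧
      ((ce l').map f).sum + 2 * L.length ≤ ((ce l).map f).sum := by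
  induction L generalizing l with
  | nil => exact ⟨l, List.Perm.refl _, hG, by simp⟩
  | cons g L ih =>
    obtain ⟨a, b, c, d, rfl, hg⟩ := hL g (by simp)
    have hF1 := hF _ (List.mem_cons_self)
    simp only [pe_cons_cons, pe_single, Multiset.mem_cons, Multiset.notMem_zero, or_false,
      forall_eq_or_imp, forall_eq] at hF1
    obtain ⟨t, hp, hc⟩ := exists_segment hn hl hg.ac.ne hg.bd.ne hg.ad hF1.1 hF1.2.1 hF1.2.2
    have hp' : (a :: c :: b :: d :: t).Perm l :=
      (List.Perm.cons _ (List.Perm.swap _ _ _)).trans hp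
    have h1 : ce (a :: b :: c :: d :: t) =
        s(a, b) ::ₘ s(b, c) ::ₘ s(c, d) ::ₘ pe (d :: (t ++ [a])) := by simp
    have h2 : ce (a :: c :: b :: d :: t) =
        s(a, c) ::ₘ s(c, b) ::ₘ s(b, d) ::ₘ pe (d :: (t ++ [a])) := by simp
    rw [h1] at hc
    obtain ⟨l', q1, q2, q3⟩ := ih (fun g hg => hL g (by simp [hg]))
      (by simp only [List.flatten_cons] at hLn; exact (List.nodup_append.mp hLn).2.1)
      (a :: c :: b :: d :: t) (hp'.nodup_iff.mpr hn) (by simp) (by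
        intro e he
        rw [h2] at he
        simp only [Multiset.mem_cons] at he
        rcases he with rfl | rfl | rfl | he
        · exact hg.ac
        · exact hg.bc.symm
        · exact hg.bd
        · exact hG e (by rw [← hc]; simp [he])) (by
        intro g' hg' e he
        have h3 := hF g' (by simp [hg']) e he
        have hdis : ∀ x ∈ e, x ≠ b ∧ x ≠ c := by
          intro x hx
          have hx1 := mem_of_mem_pe he hx
          have hx2 : x ∈ L.flatten := List.mem_flatten.mpr ⟨g', hg', hx1⟩
          simp only [List.flatten_cons] at hLn
          have h4 := (List.nodup_append.mp hLn).2.2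
          exact ⟨fun hb => h4 b (by simp) x hx2 hb.symm, fun hb => h4 c (by simp) x hx2 hb.symm⟩
        rw [← hc] at h3
        rw [h2]
        simp only [Multiset.mem_cons] at h3 ⊢
        rcases h3 with rfl | rfl | rfl | h3
        · exact absurd rfl (hdis b (by simp)).1
        · exact absurd rfl (hdis b (by simp)).1
        · exact absurd rfl (hdis c (by simp)).2
        · simp [h3])
    refine ⟨l', q1.trans hp', q2, ?_⟩
    rw [h2] at q3
    rw [← hc]
    have := hg.pos
    simp only [Multiset.map_cons, Multiset.sum_cons, List.length_cons, Nat.cast_add,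
      Nat.cast_one, Sym2.eq_swap (a := c) (b := b)] at q3 ⊢
    linarith

section Main

variable [Fintype V] [DecidableEq V] (G : SimpleGraph V) [DecidableRel G.Adj]

lemma case_many (f : Sym2 V → ℤ) (L : List (List V)) (hL : GadList G f L)
    (hLn : L.flatten.Nodup) (k : ℕ) (hk : ∀ v, k ≤ G.degree v)
    (hF : Fintype.card V + 3 * L.length ≤ 2 * k) (hV : 3 ≤ Fintype.card V) :
    ∃ (u : V) (p : G.Walk u u), p.IsHamiltonianCycle ∧
      (L.length : ℤ) ≤ |∑ e ∈ p.edges.toFinset, f e| := by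
  set F : Finset (Sym2 V) := (L.map pe).sum.toFinset with hFdef
  have memF : ∀ e, e ∈ F ↔ ∃ g ∈ L, e ∈ pe g := by
    intro e
    rw [hFdef, Multiset.mem_toFinset]
    clear hL hLn hF hFdef F
    induction L with
    | nil => simp
    | cons g L ih => simp [ih]
  have cardF : F.card ≤ 3 * L.length := by
    refine (Multiset.toFinset_card_le _).trans ?_
    clear memF hF hFdef F hLn
    induction L with
    | nil => simp
    | cons g L ih =>
      obtain ⟨a, b, c, d, rfl, -⟩ := hL g (by simp)
      have := ih (fun g hg => hL g (by simp [hg]))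
      simp at *
      omega
  have hFG : ∀ e ∈ F, e ∈ G.edgeSet := by
    intro e he
    obtain ⟨g, hg, he⟩ := (memF e).mp he
    obtain ⟨a, b, c, d, rfl, h⟩ := hL g hg
    simp at he
    rcases he with rfl | rfl | rfl
    exacts [h.ab, h.bc, h.cd]
  set l₀ : List V := L.flatten ++ (Finset.univ.filter (· ∉ L.flatten)).toList with hl₀
  have hn₀ : l₀.Nodup := by
    rw [hl₀, List.nodup_append]
    refine ⟨hLn, Finset.nodup_toList _, ?_⟩
    rintro x hx y hy rfl
    rw [Finset.mem_toList, Finset.mem_filter] at hy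
    exact hy.2 hx
  have hlen₀ : l₀.length = Fintype.card V := by
    rw [← List.toFinset_card_of_nodup hn₀, Finset.card_eq_iff_eq_univ]
    ext x
    by_cases hx : x ∈ L.flatten
    · simp only [hl₀, List.toFinset_append, Finset.mem_union, List.mem_toFinset, hx]; simp
    · simp only [hl₀, List.toFinset_append, Finset.mem_union, List.mem_toFinset, hx,
        Finset.mem_toList, Finset.mem_filter]; simp
  have hF₀ : ∀ e ∈ F, e ∈ ce l₀ := by
    intro e he
    obtain ⟨g, hg, he⟩ := (memF e).mp he
    obtain ⟨L₁, L₂, h⟩ := List.append_of_mem hg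
    refine mem_ce_infix ⟨L₁.flatten, L₂.flatten ++ (Finset.univ.filter (· ∉ L.flatten)).toList, ?_⟩ he
    rw [hl₀]
    conv_rhs => rw [h]
    rw [h]
    simp
  obtain ⟨l, hn, hlen, hFl, hlG⟩ := posa G F hFG k hk (by omega) (by omega) _ l₀ hn₀ hlen₀ hF₀ le_rfl
  obtain ⟨l', hp, hG', hs⟩ := flip G f L hL hLn l hn (by omega) hlG
    (fun g hg e he => hFl e ((memF e).mpr ⟨g, hg, he⟩))
  obtain ⟨u, p, hp1, hp2⟩ := exists_cycle G hV l hn hlen hlG f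
  obtain ⟨u', p', hp1', hp2'⟩ := exists_cycle G hV l' (hp.nodup_iff.mpr hn)
    (hp.length_eq.trans hlen) hG' f
  by_cases hb : (L.length : ℤ) ≤ ((ce l).map f).sum
  · exact ⟨u, p, hp1, by rw [hp2]; exact hb.trans (le_abs_self _)⟩
  · refine ⟨u', p', hp1', ?_⟩
    rw [hp2']
    refine le_trans ?_ (neg_le_abs _)
    omega

lemma exists_common (U : Finset V) (k : ℕ) (hk : ∀ v, k ≤ G.degree v)
    (h3 : 3 * Fintype.card V + U.card < Fintype.card V + 3 * k) (x y z : V) :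
    ∃ w, w ∉ U ∧ G.Adj x w ∧ G.Adj y w ∧ G.Adj z w := by
  by_contra! hcon
  have hsub : (Finset.univ : Finset V) ⊆
      U ∪ ((G.neighborFinset x)ᶜ ∪ ((G.neighborFinset y)ᶜ ∪ (G.neighborFinset z)ᶜ)) := by
    intro w _
    have := hcon w
    simp only [Finset.mem_union, Finset.mem_compl, SimpleGraph.mem_neighborFinset]
    tauto
  have h1 := Finset.card_le_card hsub
  have h2 := Finset.card_union_le U
    ((G.neighborFinset x)ᶜ ∪ ((G.neighborFinset y)ᶜ ∪ (G.neighborFinset z)ᶜ))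
  have h4 := Finset.card_union_le (G.neighborFinset x)ᶜ
    ((G.neighborFinset y)ᶜ ∪ (G.neighborFinset z)ᶜ)
  have h5 := Finset.card_union_le (G.neighborFinset y)ᶜ (G.neighborFinset z)ᶜ
  have a1 := hk x
  have a2 := hk y
  have a3 := hk z
  have b1 := Finset.card_compl_add_card (G.neighborFinset x)
  have b2 := Finset.card_compl_add_card (G.neighborFinset y)
  have b3 := Finset.card_compl_add_card (G.neighborFinset z)
  rw [SimpleGraph.card_neighborFinset_eq_degree] at b1 b2 b3
  rw [Finset.card_univ] at h1
  omega

lemma finish (f : Sym2 V → ℤ) (hf : ∀ e ∈ G.edgeSet, f e = 1 ∨ f e = -1) (U : Finset V) (k : ℕ)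
    (hk : ∀ v, k ≤ G.degree v) (hV : 3 ≤ Fintype.card V) (hV2 : Fintype.card V ≤ 2 * k)
    (H : V → ℤ) (hH : ∀ x, x ∉ U → H x = 1 ∨ H x = -3)
    (hHf : ∀ x y, x ∉ U → y ∉ U → G.Adj x y → H x + H y = 2 * f s(x, y)) :
    ∃ (u : V) (p : G.Walk u u), p.IsHamiltonianCycle ∧
      (Fintype.card V : ℤ) - 4 * (U.card + (Fintype.card V - k)) ≤ ∑ e ∈ p.edges.toFinset, f e := by
  have hl₀ : (Finset.univ : Finset V).toList.length = Fintype.card V := by simp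
  obtain ⟨l, hn, hlen, -, hlG⟩ := posa G ∅ (by simp) k hk (by simpa using hV2) (by omega) _
    (Finset.univ : Finset V).toList (Finset.nodup_toList _) hl₀ (by simp) le_rfl
  obtain ⟨u, p, hp1, hp2⟩ := exists_cycle G hV l hn hlen hlG f
  refine ⟨u, p, hp1, ?_⟩
  rw [hp2]
  set I : Finset V := Finset.univ.filter (fun x => x ∉ U ∧ H x = -3) with hI
  have hIk : I.card + k ≤ Fintype.card V := by
    rcases I.eq_empty_or_nonempty with h | ⟨v, hv⟩
    · rw [h]
      have : Nonempty V := Fintype.card_pos_iff.mp (by omega)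
      have h1 := hk this.some
      have h2 := G.degree_lt_card_verts this.some
      simp; omega
    · have hd : Disjoint I (G.neighborFinset v) := by
        rw [Finset.disjoint_left]
        intro w hw hvw
        simp only [hI, Finset.mem_filter, Finset.mem_univ, true_and,
          SimpleGraph.mem_neighborFinset] at hw hvw hv
        have h1 := hHf v w hv.1 hw.1 hvw
        have h2 := hf s(v, w) hvw
        omega
      have h1 := Finset.card_le_univ (I ∪ G.neighborFinset v)
      rw [Finset.card_union_of_disjoint hd, SimpleGraph.card_neighborFinset_eq_degree] at h1
      have := hk v
      omega
  set φ : V → ℤ := fun v => if v ∈ U ∪ I then -3 else 1 with hφ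
  set g : Sym2 V → ℤ := Sym2.lift ⟨fun x y => φ x + φ y, fun x y => add_comm _ _⟩ with hg
  have hgs := sum_ce φ g (fun x y => by simp [hg]) l
  have hle : ((ce l).map g).sum ≤ ((ce l).map (fun e => 2 * f e)).sum := by
    apply Multiset.sum_map_le_sum_map
    intro e he
    have heG := hlG e he
    induction e using Sym2.ind with
    | _ x y =>
      have hfe := hf _ heG
      have hx := hH x
      have hy := hH y
      have hxy := hHf x y
      have heG' : G.Adj x y := heG
      simp only [hg, Sym2.lift_mk, hφ, Finset.mem_union, hI, Finset.mem_filter, Finset.mem_univ,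
        true_and]
      split_ifs with h1 h2 h2
      · omega
      · omega
      · omega
      · push Not at h1 h2
        have := hx h1.1
        have := hy h2.1
        have := hxy h1.1 h2.1 heG'
        have := h1.2 h1.1
        have := h2.2 h2.1
        omega
  have hsum : (l.map φ).sum = (Fintype.card V : ℤ) - 4 * (U ∪ I).card := by
    have hu : l.toFinset = Finset.univ := by
      rw [← Finset.card_eq_iff_eq_univ, List.toFinset_card_of_nodup hn, hlen]
    rw [← List.sum_toFinset _ hn, hu]
    have : ∀ v, φ v = 1 - 4 * (if v ∈ U ∪ I then 1 else 0) := by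
      intro v; simp only [hφ]; split_ifs <;> norm_num
    simp only [this, Finset.sum_sub_distrib, ← Finset.mul_sum]
    rw [Finset.sum_ite_mem, Finset.univ_inter]
    simp
  rw [hgs, hsum, Multiset.sum_map_mul_left] at hle
  have := Finset.card_union_le U I
  omega

lemma case_few (f : Sym2 V → ℤ) (hf : ∀ e ∈ G.edgeSet, f e = 1 ∨ f e = -1) (U : Finset V) (k : ℕ)
    (hk : ∀ v, k ≤ G.degree v) (hV : 3 ≤ Fintype.card V) (hV2 : Fintype.card V ≤ 2 * k)
    (h3 : 3 * Fintype.card V + U.card < Fintype.card V + 3 * k)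
    (hno : ∀ a b c d, a ∉ U → b ∉ U → c ∉ U → d ∉ U → ¬ IsGad G f a b c d) :
    ∃ (u : V) (p : G.Walk u u), p.IsHamiltonianCycle ∧
      (Fintype.card V : ℤ) - 4 * (U.card + (Fintype.card V - k)) ≤
        |∑ e ∈ p.edges.toFinset, f e| := by
  have hcom := exists_common G U k hk h3
  have hsw : ∀ x y, f s(x, y) = f s(y, x) := fun x y => by rw [Sym2.eq_swap]
  have hf' : ∀ x y, G.Adj x y → f s(x, y) = 1 ∨ f s(x, y) = -1 := fun x y h => hf s(x, y) h
  have heq : ∀ a b c d, a ∉ U → b ∉ U → c ∉ U → d ∉ U → G.Adj a b → G.Adj b c → G.Adj c d →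
      G.Adj a c → G.Adj b d → f s(a, b) + f s(c, d) = f s(a, c) + f s(b, d) := by
    intro a b c d ha hb hc hd hab hbc hcd hac hbd
    by_cases had : a = d
    · subst had; rw [hsw a b, hsw c a]; ring
    have g1 := hno a b c d ha hb hc hd
    have g2 := hno a c b d ha hc hb hd
    have v1 := hf' _ _ hab
    have v2 := hf' _ _ hcd
    have v3 := hf' _ _ hac
    have v4 := hf' _ _ hbd
    have g1' : ¬ (f s(a, c) + f s(b, d) + 2 ≤ f s(a, b) + f s(c, d)) :=
      fun h => g1 ⟨hab, hbc, hcd, hac, hbd, had, h⟩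
    have g2' : ¬ (f s(a, b) + f s(c, d) + 2 ≤ f s(a, c) + f s(b, d)) :=
      fun h => g2 ⟨hac, hbc.symm, hbd, hab, hcd, had, h⟩
    omega
  -- the vertex potential
  have hex : ∀ x, ∃ h : ℤ, x ∉ U → ∀ y z, y ∉ U → z ∉ U → G.Adj x y → G.Adj x z → G.Adj y z →
      f s(x, y) + f s(x, z) - f s(y, z) = h := by
    intro x
    by_cases hx : x ∈ U
    · exact ⟨0, fun h => absurd hx h⟩
    obtain ⟨y, hy, hxy, -, -⟩ := hcom x x x
    obtain ⟨z, hz, hxz, hyz, -⟩ := hcom x y y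
    refine ⟨f s(x, y) + f s(x, z) - f s(y, z), fun _ => ?_⟩
    intro y' z' hy' hz' hxy' hxz' hyz'
    obtain ⟨w, hw, hxw, hyw, hyw'⟩ := hcom x y y'
    have e1 := heq z x y w hz hx hy hw hxz.symm hxy hyw hyz.symm hxw
    have e2 := heq z' x y' w hz' hx hy' hw hxz'.symm hxy' hyw' hyz'.symm hxw
    have e3 := heq y x w y' hy hx hw hy' hxy.symm hxw hyw'.symm hyw hxy'
    rw [hsw z x, hsw z y] at e1
    rw [hsw z' x, hsw z' y'] at e2
    rw [hsw y x, hsw w y'] at e3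
    linarith
  choose H hH using hex
  have hHf : ∀ x y, x ∉ U → y ∉ U → G.Adj x y → H x + H y = 2 * f s(x, y) := by
    intro x y hx hy hxy
    obtain ⟨z, hz, hxz, hyz, -⟩ := hcom x y y
    have e1 := hH x hx y z hy hz hxy hxz hyz
    have e2 := hH y hy x z hx hz hxy.symm hyz hxz
    rw [hsw y x] at e2
    linarith
  have hval : ∀ x, x ∉ U → H x = 1 ∨ H x = -3 ∨ H x = -1 ∨ H x = 3 := by
    intro x hx
    obtain ⟨y, hy, hxy, -, -⟩ := hcom x x x
    obtain ⟨z, hz, hxz, hyz, -⟩ := hcom x y y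
    have e1 := hH x hx y z hy hz hxy hxz hyz
    have v1 := hf' _ _ hxy
    have v2 := hf' _ _ hxz
    have v3 := hf' _ _ hyz
    omega
  have hadj : ∀ x y, x ∉ U → y ∉ U → G.Adj x y → (H x = 1 ∨ H x = -3) → (H y = 1 ∨ H y = -3) := by
    intro x y hx hy hxy h
    have := hval y hy
    have := hHf x y hx hy hxy
    have := hf' _ _ hxy
    omega
  have hconn : ∀ x y, x ∉ U → y ∉ U → (H x = 1 ∨ H x = -3) → (H y = 1 ∨ H y = -3) := by
    intro x y hx hy h
    obtain ⟨w, hw, hxw, hyw, -⟩ := hcom x y y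
    exact hadj w y hw hy hyw.symm (hadj x w hx hw hxw h)
  by_cases hP : ∃ x, x ∉ U ∧ (H x = 1 ∨ H x = -3)
  · obtain ⟨x, hx, hPx⟩ := hP
    obtain ⟨u, p, hp, hs⟩ := finish G f hf U k hk hV hV2 H (fun y hy => hconn x y hx hy hPx) hHf
    exact ⟨u, p, hp, hs.trans (le_abs_self _)⟩
  · push Not at hP
    obtain ⟨u, p, hp, hs⟩ := finish G (fun e => - f e)
      (fun e he => by have := hf e he; omega) U k hk hV hV2 (fun x => - H x)
      (fun y hy => by have := hval y hy; have := hP y hy; omega)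
      (fun x y hx hy hxy => by have := hHf x y hx hy hxy; linarith)
    refine ⟨u, p, hp, hs.trans ?_⟩
    rw [Finset.sum_neg_distrib]
    exact neg_le_abs _

lemma dichotomy (f : Sym2 V → ℤ) (k : ℕ) :
    (∃ L : List (List V), GadList G f L ∧ L.flatten.Nodup ∧ L.length = k) ∨
    (∃ U : Finset V, U.card ≤ 4 * (k - 1) ∧
      ∀ a b c d, a ∉ U → b ∉ U → c ∉ U → d ∉ U → ¬ IsGad G f a b c d) := by
  induction k with
  | zero => exact Or.inl ⟨[], by simp [GadList], by simp, rfl⟩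
  | succ k ih =>
    rcases ih with ⟨L, hL, hn, hk⟩ | ⟨U, hU, hno⟩
    · by_cases hex : ∃ a b c d, a ∉ L.flatten ∧ b ∉ L.flatten ∧ c ∉ L.flatten ∧ d ∉ L.flatten ∧
          IsGad G f a b c d
      · left
        obtain ⟨a, b, c, d, ha, hb, hc, hd, hg⟩ := hex
        refine ⟨[a, b, c, d] :: L, ?_, ?_, by simp [hk]⟩
        · intro g hg'
          rcases List.mem_cons.mp hg' with rfl | h
          · exact ⟨a, b, c, d, rfl, hg⟩
          · exact hL g h
        · rw [List.flatten_cons, List.nodup_append]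
          refine ⟨?_, hn, ?_⟩
          · have := hg.ab.ne
            have := hg.ac.ne
            have := hg.ad
            have := hg.bc.ne
            have := hg.bd.ne
            have := hg.cd.ne
            simp; tauto
          · rintro x hx y hy rfl
            simp only [List.mem_cons, List.not_mem_nil, or_false] at hx
            rcases hx with rfl | rfl | rfl | rfl <;> contradiction
      · right
        push Not at hex
        refine ⟨L.flatten.toFinset, ?_, ?_⟩
        · refine (List.toFinset_card_le _).trans ?_
          have : L.flatten.length = 4 * L.length := by
            clear hex hn hk
            induction L with
            | nil => simp
            | cons g L ih =>
              obtain ⟨a, b, c, d, rfl, -⟩ := hL g (by simp)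
              have := ih (fun g hg => hL g (by simp [hg]))
              rw [List.flatten_cons, List.length_append, this]
              simp; ring
          rw [this, hk]; simp
        · intro a b c d ha hb hc hd
          rw [List.mem_toFinset] at ha hb hc hd
          exact hex a b c d ha hb hc hd
    · exact Or.inr ⟨U, by omega, hno⟩

end Main

end HamDisc

/-- Balogh–Csaba–Jing–Pluhár: minimum degree `(3/4 + c)n` forces a Hamilton cycle
of absolute discrepancy at least `cn/32`. -/
theorem hamilton_discrepancy (c : ℝ) (hc0 : 0 < c) (hc1 : c < 1 / 4) :
    ∃ n₀ : ℕ, ∀ n : ℕ, n₀ ≤ n →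
      ∀ (G : SimpleGraph (Fin n)) [DecidableRel G.Adj],
        (G.minDegree : ℝ) ≥ (3 / 4 + c) * n →
        ∀ f : Sym2 (Fin n) → ℤ, (∀ e ∈ G.edgeSet, f e = 1 ∨ f e = -1) →
          ∃ (u : Fin n) (p : G.Walk u u), p.IsHamiltonianCycle ∧
            ((|∑ e ∈ p.edges.toFinset, f e| : ℤ) : ℝ) ≥ c * n / 32 := by
  refine ⟨100, fun n hn G _ hδ f hf => ?_⟩
  have hn' : (100 : ℝ) ≤ n := by exact_mod_cast hn
  have hcn : 0 < c * n := by positivity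
  have hk : ∀ v, G.minDegree ≤ G.degree v := G.minDegree_le_degree
  have hcard : Fintype.card (Fin n) = n := Fintype.card_fin n
  set k := G.minDegree with hkdef
  set t := ⌈c * n / 32⌉₊ with ht
  have ht1 : c * n / 32 ≤ t := Nat.le_ceil _
  have ht2 : (t : ℝ) < c * n / 32 + 1 := Nat.ceil_lt_add_one (by positivity)
  have ht0 : 1 ≤ t := Nat.one_le_iff_ne_zero.mpr (by
    intro h; rw [h] at ht1; norm_num at ht1; linarith)
  rcases HamDisc.dichotomy G f t with ⟨L, hL, hLn, hLt⟩ | ⟨U, hU, hno⟩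
  · obtain ⟨u, p, hp, hs⟩ := HamDisc.case_many G f L hL hLn k hk (by
      rw [hcard, hLt]
      have : (n : ℝ) + 3 * t ≤ 2 * k := by linarith
      exact_mod_cast this) (by omega)
    refine ⟨u, p, hp, ?_⟩
    have hs' : ((L.length : ℤ) : ℝ) ≤ ((|∑ e ∈ p.edges.toFinset, f e| : ℤ) : ℝ) := by
      exact_mod_cast hs
    rw [hLt] at hs'
    push_cast at hs' ⊢
    linarith
  · have hUr : (U.card : ℝ) + 4 ≤ 4 * t := by
      have : U.card + 4 ≤ 4 * t := by omega
      exact_mod_cast this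
    obtain ⟨u, p, hp, hs⟩ := HamDisc.case_few G f hf U k hk (by omega) (by
      rw [hcard]
      have : (n : ℝ) ≤ 2 * k := by linarith
      exact_mod_cast this) (by
      rw [hcard]
      have : 3 * (n : ℝ) + U.card < n + 3 * k := by linarith
      exact_mod_cast this) hno
    refine ⟨u, p, hp, ?_⟩
    rw [hcard] at hs
    have hs' : (((n : ℤ) - 4 * (U.card + (n - k)) : ℤ) : ℝ) ≤
        ((|∑ e ∈ p.edges.toFinset, f e| : ℤ) : ℝ) := by
      exact_mod_cast hs
    rw [ge_iff_le]
    refine le_trans ?_ hs'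
    push_cast
    linarith
end

section
/- Let r ≥ 2 be an integer. Every graph G whose order n is divisible by r and whose minimum degree satisfies δ(G) ≥ (1 − 1/r)n contains a perfect K_r-tiling. -/
namespace HSz

open Classical in
/-- Simple path reachability inside `P`. -/
inductive SPath (R : ℕ → ℕ → Prop) (a : ℕ) : Finset ℕ → ℕ → Prop
  | refl (P : Finset ℕ) : a ∈ P → SPath R a P a
  | step (P : Finset ℕ) (b b' : ℕ) : b ∈ P → R b b' → SPath R a (P.erase b) b' → SPath R a P b

section
open Classical

variable {R R' : ℕ → ℕ → Prop} {a : ℕ}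

theorem SPath.mono {P : Finset ℕ} {b : ℕ} (h : SPath R a P b) :
    ∀ {Q : Finset ℕ}, P ⊆ Q → SPath R a Q b := by
  induction h with
  | refl P ha => intro Q hQ; exact .refl _ (hQ ha)
  | step P b b' hb hr _ ih =>
    intro Q hQ
    exact .step _ b b' (hQ hb) hr (ih (Finset.erase_subset_erase _ hQ))

theorem SPath.start_mem {P : Finset ℕ} {b : ℕ} (h : SPath R a P b) : b ∈ P := by
  cases h <;> assumption

theorem SPath.end_mem {P : Finset ℕ} {b : ℕ} (h : SPath R a P b) : a ∈ P := by
  induction h with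
  | refl P ha => exact ha
  | step P b b' hb hr _ ih => exact Finset.mem_of_mem_erase ih

theorem SPath.rel {P : Finset ℕ} {b : ℕ} (h : SPath R a P b) :
    (∀ c ∈ P, ∀ d ∈ P, R c d → R' c d) → SPath R' a P b := by
  induction h with
  | refl P ha => intro _; exact .refl _ ha
  | step P b b' hb hr h' ih =>
    intro H
    exact .step _ b b' hb (H _ hb _ (Finset.mem_of_mem_erase h'.start_mem) hr)
      (ih fun c hc d hd => H c (Finset.mem_of_mem_erase hc) d (Finset.mem_of_mem_erase hd))

theorem SPath.avoid {P : Finset ℕ} {b : ℕ} (h : SPath R a P b) (w : ℕ) :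
    SPath R a (P.erase w) b ∨ SPath R a P w := by
  induction h with
  | refl P ha =>
    by_cases hw : a = w
    · subst hw; exact Or.inr (.refl _ ha)
    · exact Or.inl (.refl _ (Finset.mem_erase.2 ⟨hw, ha⟩))
  | step P b b' hb hr h' ih =>
    by_cases hw : b = w
    · subst hw; exact Or.inr (.step _ _ b' hb hr h')
    · rcases ih with ih | ih
      · left
        refine .step _ b b' (Finset.mem_erase.2 ⟨hw, hb⟩) hr ?_
        rwa [Finset.erase_right_comm]
      · exact Or.inr (ih.mono (Finset.erase_subset _ _))

theorem SPath.cons {P : Finset ℕ} {b b' : ℕ} (hb : b ∈ P) (hr : R b b') (h : SPath R a P b') :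
    SPath R a P b := by
  rcases h.avoid b with h | h
  · exact .step _ b b' hb hr h
  · exact h

theorem SPath.inside {P : Finset ℕ} {b : ℕ} (h : SPath R a P b) :
    SPath R a (P.filter (fun c => SPath R a P c)) b := by
  induction h with
  | refl P ha => exact .refl _ (Finset.mem_filter.2 ⟨ha, .refl _ ha⟩)
  | step P b b' hb hr h' ih =>
    refine .step _ b b' (Finset.mem_filter.2 ⟨hb, .step _ b b' hb hr h'⟩) hr (ih.mono ?_)
    intro c hc
    simp only [Finset.mem_filter, Finset.mem_erase] at hc ⊢
    exact ⟨hc.1.1, hc.1.2, hc.2.mono (Finset.erase_subset _ _)⟩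

variable {V : Type*}

def Mov (G : SimpleGraph V) (Y : Finset V) (f : V → ℕ) (b c : ℕ) : Prop :=
  ∃ w ∈ Y, f w = b ∧ ∀ x ∈ Y, f x = c → ¬ G.Adj w x

def Pr (G : SimpleGraph V) (Y : Finset V) (f : V → ℕ) : Prop :=
  ∀ x ∈ Y, ∀ y ∈ Y, G.Adj x y → f x ≠ f y

theorem shift_s3 (G : SimpleGraph V) {P : Finset ℕ} {b : ℕ} (h : SPath R a P b) :
    ∀ (Y : Finset V) (f : V → ℕ) (v : V), v ∉ Y →
      (∀ c ∈ P, ∀ d ∈ P, R c d → Mov G Y f c d) →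
      (∀ x ∈ Y, f x = b → ¬ G.Adj v x) → Pr G Y f →
      ∃ f' : V → ℕ, Pr G (insert v Y) f' ∧
        (∀ x ∈ Y, f' x = f x ∨ (f x ∈ P ∧ f' x ∈ P)) ∧ f' v ∈ P ∧
        ∀ i, ((insert v Y).filter (fun x => f' x = i)).card =
          (Y.filter (fun x => f x = i)).card + if i = a then 1 else 0 := by
  induction h with
  | refl P ha =>
    intro Y f v hv _ hf hp
    refine ⟨Function.update f v a, ?_, ?_, ?_, ?_⟩
    · intro x hx y hy hxy
      by_cases h1 : x = v <;> by_cases h2 : y = v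
      · subst h1; subst h2; exact absurd hxy (G.loopless.irrefl _)
      · subst h1
        have hy' : y ∈ Y := Finset.mem_of_mem_insert_of_ne hy h2
        simp only [Function.update_self, Function.update_of_ne h2]
        exact fun h => hf y hy' h.symm hxy
      · subst h2
        have hx' : x ∈ Y := Finset.mem_of_mem_insert_of_ne hx h1
        simp only [Function.update_self, Function.update_of_ne h1]
        exact fun h => hf x hx' h hxy.symm
      · simp only [Function.update_of_ne h1, Function.update_of_ne h2]
        exact hp x (Finset.mem_of_mem_insert_of_ne hx h1) y
          (Finset.mem_of_mem_insert_of_ne hy h2) hxy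
    · intro x hx
      left
      rw [Function.update_of_ne]; rintro rfl; exact hv hx
    · simpa using ha
    · intro i
      rw [Finset.filter_insert]
      have e : Y.filter (fun x => Function.update f v a x = i) = Y.filter (fun x => f x = i) := by
        apply Finset.filter_congr
        intro x hx
        rw [Function.update_of_ne]; rintro rfl; exact hv hx
      rw [e]
      by_cases hi : a = i
      · subst hi
        simp [hv]
      · simp [hi, Ne.symm hi]
  | step P b b' hb hr h' ih =>
    intro Y f v hv hR hf hp
    have hb' := h'.start_mem
    obtain ⟨w, hwY, hwb, hw⟩ := hR b hb b' (Finset.mem_of_mem_erase hb') hr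
    have hwv : w ≠ v := by rintro rfl; exact hv hwY
    have key : ∀ x, x ∈ insert v (Y.erase w) ↔ (x = v ∨ (x ≠ w ∧ x ∈ Y)) := by
      intro x; simp
    have hup : ∀ x ∈ Y, Function.update f v b x = f x := by
      intro x hx; rw [Function.update_of_ne]; rintro rfl; exact hv hx
    obtain ⟨f', h1, h2, h3, h4⟩ := ih (insert v (Y.erase w)) (Function.update f v b) w
      (by simp [hwv]) (by
        intro c hc d hd hcd
        obtain ⟨hcb, hc⟩ := Finset.mem_erase.1 hc
        obtain ⟨hdb, hd⟩ := Finset.mem_erase.1 hd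
        obtain ⟨u, hu, huc, hud⟩ := hR c hc d hd hcd
        refine ⟨u, (key u).2 (Or.inr ⟨?_, hu⟩), by rw [hup u hu, huc], ?_⟩
        · rintro rfl; exact hcb (huc.symm.trans hwb)
        · intro x hx hxd
          rcases (key x).1 hx with rfl | ⟨_, hxY⟩
          · simp at hxd; exact absurd hxd.symm hdb
          · rw [hup x hxY] at hxd; exact hud x hxY hxd) (by
        intro x hx hxd
        rcases (key x).1 hx with rfl | ⟨_, hxY⟩
        · simp at hxd
          exact absurd hxd.symm (Finset.ne_of_mem_erase hb')
        · rw [hup x hxY] at hxd; exact hw x hxY hxd) (by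
        intro x hx y hy hxy
        rcases (key x).1 hx with rfl | ⟨_, hxY⟩ <;> rcases (key y).1 hy with rfl | ⟨_, hyY⟩
        · exact absurd hxy (G.loopless.irrefl _)
        · rw [hup y hyY, Function.update_self]; exact fun h => hf y hyY h.symm hxy
        · rw [hup x hxY, Function.update_self]; exact fun h => hf x hxY h hxy.symm
        · rw [hup x hxY, hup y hyY]; exact hp x hxY y hyY hxy)
    have e : insert w (insert v (Y.erase w)) = insert v Y := by
      rw [Finset.insert_comm, Finset.insert_erase hwY]
    rw [e] at h1 h4
    refine ⟨f', h1, ?_, ?_, ?_⟩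
    · intro x hx
      by_cases hxw : x = w
      · subst hxw
        exact Or.inr ⟨hwb ▸ hb, Finset.mem_of_mem_erase h3⟩
      · rcases h2 x ((key x).2 (Or.inr ⟨hxw, hx⟩)) with h | h
        · rw [hup x hx] at h; exact Or.inl h
        · rw [hup x hx] at h
          exact Or.inr ⟨Finset.mem_of_mem_erase h.1, Finset.mem_of_mem_erase h.2⟩
    · rcases h2 v ((key v).2 (Or.inl rfl)) with h | h
      · rw [h]; simpa using hb
      · exact Finset.mem_of_mem_erase h.2
    · intro i
      rw [h4 i]
      congr 1
      rw [Finset.filter_insert]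
      have e2 : (Y.erase w).filter (fun x => Function.update f v b x = i)
          = (Y.filter (fun x => f x = i)).erase w := by
        ext x
        simp only [Finset.mem_filter, Finset.mem_erase]
        constructor
        · rintro ⟨⟨hxw, hx⟩, hi⟩
          rw [hup x hx] at hi; exact ⟨hxw, hx, hi⟩
        · rintro ⟨hxw, hx, hi⟩
          exact ⟨⟨hxw, hx⟩, by rw [hup x hx]; exact hi⟩
      rw [e2, Function.update_self]
      by_cases hi : b = i
      · rw [if_pos hi, Finset.card_insert_of_notMem (by simp [hv])]
        apply Finset.card_erase_add_one
        simp [hwY, hwb, hi]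
      · rw [if_neg hi, Finset.erase_eq_of_notMem]
        simp [hwb, hi]

/-- weighted double counting -/
theorem count22 (G : SimpleGraph V) (B W : Finset V) (q t s : ℕ) (hB : B.card = q * s + 1)
    (hW : W.card ≤ s)
    (h1 : ∀ y ∈ B, 1 ≤ (W.filter (fun x => G.Adj y x)).card)
    (h2 : ∀ x ∈ W, (B.filter (fun y => G.Adj x y)).card ≤ q + t)
    (h3 : ∀ x ∈ W, (∃ y ∈ B, G.Adj y x ∧ (W.filter (fun x => G.Adj y x)).card = 1) →
      (B.filter (fun y => G.Adj x y)).card ≤ q) : q < t := by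
  by_contra hqt
  push Not at hqt
  let w : V → ℕ := fun x =>
    if (∃ y ∈ B, G.Adj y x ∧ (W.filter (fun x => G.Adj y x)).card = 1) then 2 else 1
  have hw1 : ∀ x, 1 ≤ w x := by intro x; simp only [w]; split_ifs <;> norm_num
  have lower : 2 * B.card ≤ ∑ y ∈ B, ∑ x ∈ W, if G.Adj y x then w x else 0 := by
    rw [mul_comm, ← smul_eq_mul]
    apply Finset.card_nsmul_le_sum
    intro y hy
    rw [← Finset.sum_filter]
    by_cases hc : (W.filter (fun x => G.Adj y x)).card = 1
    · obtain ⟨x, hx⟩ := Finset.card_eq_one.1 hc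
      have hxm : x ∈ W.filter (fun x => G.Adj y x) := by rw [hx]; simp
      rw [hx, Finset.sum_singleton]
      simp only [w]
      rw [if_pos ⟨y, hy, (Finset.mem_filter.1 hxm).2, hc⟩]
    · have := h1 y hy
      calc 2 ≤ (W.filter (fun x => G.Adj y x)).card := by omega
        _ = ∑ x ∈ W.filter (fun x => G.Adj y x), 1 := by simp
        _ ≤ _ := Finset.sum_le_sum fun x _ => hw1 x
  rw [Finset.sum_comm] at lower
  have upper : (∑ x ∈ W, ∑ y ∈ B, if G.Adj y x then w x else 0) ≤ W.card * (2 * q) := by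
    rw [← smul_eq_mul]
    apply Finset.sum_le_card_nsmul
    intro x hx
    rw [← Finset.sum_filter, Finset.sum_const, smul_eq_mul]
    have e : B.filter (fun y => G.Adj y x) = B.filter (fun y => G.Adj x y) :=
      Finset.filter_congr fun y _ => G.adj_comm y x
    rw [e]
    have i2 := h2 x hx
    have i3 := h3 x hx
    simp only [w]
    split_ifs with hh
    · have := i3 hh; omega
    · omega
  have : W.card * (2 * q) ≤ s * (2 * q) := Nat.mul_le_mul_right _ hW
  have e : s * (2 * q) = 2 * (q * s) := by ring
  omega

theorem count3 (G : SimpleGraph V) (B A : Finset V) (Sp : V → V → Prop) (q t s : ℕ)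
    (hB : B.card = q * s + 1) (hA : A.card = t * s) (hqt : q ≤ t)
    (h1 : ∀ y ∈ B, (B.filter (fun x => G.Adj y x)).card + 1 ≤ q)
    (h2 : ∀ y ∈ B, t + (B.filter (fun x => G.Adj y x)).card + 1 ≤ (A.filter (Sp y)).card + q) :
    ∃ z ∈ A, ∃ y₁ ∈ B, ∃ y₂ ∈ B, y₁ ≠ y₂ ∧ ¬ G.Adj y₁ y₂ ∧ Sp y₁ z ∧ Sp y₂ z := by
  obtain ⟨I, hI, hmax⟩ := Finset.exists_max_image
    (B.powerset.filter (fun I => ∀ x ∈ I, ∀ y ∈ I, ¬ G.Adj x y)) Finset.card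
    ⟨∅, by simp⟩
  simp only [Finset.mem_filter, Finset.mem_powerset] at hI hmax
  obtain ⟨hIB, hInd⟩ := hI
  have hdom : ∀ y ∈ B, y ∈ I ∨ ∃ x ∈ I, G.Adj x y := by
    intro y hy
    by_contra hcon
    push Not at hcon
    obtain ⟨hyI, hn⟩ := hcon
    have := hmax (insert y I) ⟨Finset.insert_subset hy hIB, by
      intro u hu v hv
      rcases Finset.mem_insert.1 hu with rfl | hu' <;>
        rcases Finset.mem_insert.1 hv with rfl | hv'
      · exact G.loopless.irrefl _
      · exact fun h => hn v hv' h.symm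
      · exact hn u hu'
      · exact hInd u hu' v hv'⟩
    rw [Finset.card_insert_of_notMem hyI] at this
    omega
  have hcov : B.card ≤ ∑ y ∈ I, ((B.filter (fun x => G.Adj y x)).card + 1) := by
    have hsub : B ⊆ I.biUnion (fun y => insert y (B.filter (fun x => G.Adj y x))) := by
      intro y hy
      rw [Finset.mem_biUnion]
      rcases hdom y hy with h | ⟨x, hx, h⟩
      · exact ⟨y, h, by simp⟩
      · exact ⟨x, hx, by simp [hy, h]⟩
    exact (Finset.card_le_card hsub).trans (Finset.card_biUnion_le.trans
      (Finset.sum_le_sum fun y _ => Finset.card_insert_le _ _))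
  have hIs : q * s + 1 ≤ I.card * q := by
    rw [← hB, ← smul_eq_mul]
    exact hcov.trans (Finset.sum_le_card_nsmul _ _ _ fun y hy => h1 y (hIB hy))
  have hsI : s ≤ I.card := by
    by_contra hlt
    push Not at hlt
    have := Nat.mul_le_mul_right q hlt.le
    have e : s * q = q * s := mul_comm _ _
    omega
  have hsum : I.card * t + (q * s + 1) ≤ ∑ y ∈ I, (A.filter (Sp y)).card + I.card * q := by
    calc I.card * t + (q * s + 1) ≤ I.card * t + ∑ y ∈ I, ((B.filter (fun x => G.Adj y x)).card + 1) := by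
            rw [← hB]; omega
      _ = ∑ y ∈ I, (t + ((B.filter (fun x => G.Adj y x)).card + 1)) := by
            rw [Finset.sum_add_distrib (f := fun _ => t)]; simp
      _ ≤ ∑ y ∈ I, ((A.filter (Sp y)).card + q) :=
            Finset.sum_le_sum fun y hy => by have := h2 y (hIB hy); omega
      _ = _ := by rw [Finset.sum_add_distrib]; simp
  have hbig : t * s + 1 ≤ ∑ y ∈ I, (A.filter (Sp y)).card := by
    obtain ⟨d, rfl⟩ := Nat.exists_eq_add_of_le hqt
    have := Nat.mul_le_mul_left d hsI
    have e1 : I.card * (q + d) = I.card * q + d * I.card := by ring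
    have e2 : (q + d) * s = q * s + d * s := by ring
    omega
  have hdc : ∑ y ∈ I, (A.filter (Sp y)).card = ∑ z ∈ A, (I.filter (fun y => Sp y z)).card := by
    simp only [Finset.card_filter]
    rw [Finset.sum_comm]
  by_contra hcon
  push Not at hcon
  have : ∑ z ∈ A, (I.filter (fun y => Sp y z)).card ≤ A.card * 1 := by
    rw [← smul_eq_mul]
    apply Finset.sum_le_card_nsmul
    intro z hz
    apply Finset.card_le_one.2
    intro y₁ hy₁ y₂ hy₂
    rw [Finset.mem_filter] at hy₁ hy₂
    by_contra hne
    exact hcon z hz y₁ (hIB hy₁.1) y₂ (hIB hy₂.1) hne (hInd _ hy₁.1 _ hy₂.1) hy₁.2 hy₂.2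
  omega

/-- equitable colourings -/
def Good (G : SimpleGraph V) (X : Finset V) (K : Finset ℕ) (s : ℕ) (f : V → ℕ) : Prop :=
  (∀ x ∈ X, f x ∈ K) ∧ Pr G X f ∧ ∀ i ∈ K, (X.filter (fun x => f x = i)).card = s

/-- nearly equitable colourings -/
def Near (G : SimpleGraph V) (X : Finset V) (K : Finset ℕ) (s : ℕ) (f : V → ℕ) (a b : ℕ) : Prop :=
  (∀ x ∈ X, f x ∈ K) ∧ Pr G X f ∧ a ∈ K ∧ b ∈ K ∧ a ≠ b ∧
  ∀ i ∈ K, (X.filter (fun x => f x = i)).card + (if i = a then 1 else 0)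
    = s + (if i = b then 1 else 0)

theorem sum_nb (G : SimpleGraph V) (X : Finset V) (f : V → ℕ) (v : V) (C : Finset ℕ) :
    ∑ c ∈ C, (X.filter (fun x => f x = c ∧ G.Adj v x)).card
      = (X.filter (fun x => f x ∈ C ∧ G.Adj v x)).card := by
  rw [Finset.card_eq_sum_card_fiberwise (f := f) (t := C)]
  · apply Finset.sum_congr rfl
    intro c hc
    congr 1
    ext x
    simp only [Finset.mem_filter]
    constructor
    · rintro ⟨h1, h2, h3⟩; subst h2; exact ⟨⟨h1, hc, h3⟩, rfl⟩
    · rintro ⟨⟨h1, h2, h3⟩, h4⟩; exact ⟨h1, h4, h3⟩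
  · intro x hx
    simp at hx
    exact hx.2.1

theorem lemma21 (G : SimpleGraph V) (X : Finset V) (K : Finset ℕ) (s : ℕ) (f : V → ℕ) (a b : ℕ)
    (h : Near G X K s f a b) (hacc : SPath (Mov G X f) a K b) : ∃ f', Good G X K s f' := by
  obtain ⟨hK, hp, ha, hb, hab, hs⟩ := h
  cases hacc with
  | refl => exact absurd rfl hab
  | step _ _ b' _ hr h' =>
    obtain ⟨w, hwX, hwb, hw⟩ := hr
    obtain ⟨f', h1, h2, h3, h4⟩ := shift_s3 G h' (X.erase w) f w (by simp) (by
        intro c hc d hd hcd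
        obtain ⟨u, hu, huc, hud⟩ := hcd
        refine ⟨u, Finset.mem_erase.2 ⟨?_, hu⟩, huc, fun x hx => hud x (Finset.mem_of_mem_erase hx)⟩
        rintro rfl
        exact (Finset.ne_of_mem_erase hc) (huc.symm.trans hwb)) (by
        intro x hx; exact hw x (Finset.mem_of_mem_erase hx)) (by
        intro x hx y hy
        exact hp x (Finset.mem_of_mem_erase hx) y (Finset.mem_of_mem_erase hy))
    rw [Finset.insert_erase hwX] at h1 h4
    refine ⟨f', ?_, h1, ?_⟩
    · intro x hx
      by_cases hxw : x = w
      · subst hxw; exact Finset.mem_of_mem_erase h3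
      · rcases h2 x (Finset.mem_erase.2 ⟨hxw, hx⟩) with h | h
        · rw [h]; exact hK x hx
        · exact Finset.mem_of_mem_erase h.2
    · intro i hi
      rw [h4 i, Finset.filter_erase]
      have := hs i hi
      by_cases hib : i = b
      · subst hib
        have hm : w ∈ X.filter (fun x => f x = i) := by simp [hwX, hwb]
        have := Finset.card_erase_add_one hm
        rw [if_neg (Ne.symm hab)] at *
        rw [if_pos rfl] at *
        omega
      · rw [Finset.erase_eq_of_notMem (by simp [hwb, Ne.symm hib])]
        rw [if_neg hib] at this
        omega

/-- choice of the terminal family -/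
theorem exists_terminal_s3 (K A : Finset ℕ) (hAdef : ∀ c, c ∈ A ↔ SPath R a K c)
    (ha : a ∈ K) (hne : ∃ c ∈ A, c ≠ a) :
    ∃ U ∈ A, ∃ T : Finset ℕ, T ⊆ A ∧ T.Nonempty ∧ U ∉ T ∧ a ∉ T ∧
      (∀ W ∈ T, ∀ c ∈ A, c ≠ W → SPath R a (A.erase W) c) ∧
      (∀ W ∈ T, ∀ c ∈ A, c ∉ T → c ≠ U → ¬ R W c) := by
  have haA : a ∈ A := (hAdef a).2 (.refl _ ha)
  have hAK : A ⊆ K := fun c hc => ((hAdef c).1 hc).start_mem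
  let T : ℕ → Finset ℕ := fun U => A.filter (fun c => c ≠ U ∧ ¬ SPath R a (K.erase U) c)
  have hT : ∀ U c, c ∈ T U ↔ c ∈ A ∧ c ≠ U ∧ ¬ SPath R a (K.erase U) c := by
    intro U c; simp [T]
  obtain ⟨U, hU, hmin⟩ := Finset.exists_min_image (A.filter (fun U => (T U).Nonempty))
    (fun U => (T U).card) (by
      refine ⟨a, Finset.mem_filter.2 ⟨haA, ?_⟩⟩
      obtain ⟨c, hc, hca⟩ := hne
      exact ⟨c, (hT _ _).2 ⟨hc, hca, fun h => by simpa using h.end_mem⟩⟩)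
  rw [Finset.mem_filter] at hU
  obtain ⟨hUA, hUne⟩ := hU
  have haT : a ∉ T U := by
    intro h
    obtain ⟨_, h1, h2⟩ := (hT _ _).1 h
    exact h2 (.refl _ (Finset.mem_erase.2 ⟨h1, ha⟩))
  refine ⟨U, hUA, T U, Finset.filter_subset _ _, hUne, by simp [T], haT, ?_, ?_⟩
  · intro W hW c hc hcW
    obtain ⟨hWA, hWU, hWn⟩ := (hT _ _).1 hW
    have hWa : W ≠ a := by rintro rfl; exact haT hW
    have hTW : T W = ∅ := by
      by_contra hne
      have hne := Finset.nonempty_iff_ne_empty.2 hne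
      have hle := hmin W (Finset.mem_filter.2 ⟨hWA, hne⟩)
      have hss : T W ⊂ T U := by
        refine (Finset.ssubset_iff_of_subset ?_).2 ⟨W, hW, by simp [T]⟩
        intro d hd
        obtain ⟨hdA, hdW, hdn⟩ := (hT _ _).1 hd
        refine (hT _ _).2 ⟨hdA, ?_, ?_⟩
        · rintro rfl
          apply hdn
          have hd0 := (hAdef d).1 hdA
          cases hd0 with
          | refl => exact .refl _ (Finset.mem_erase.2 ⟨Ne.symm hWa, ha⟩)
          | step _ _ b' hb hr h' =>
            rcases h'.avoid W with h | h
            · refine .step _ _ b' (Finset.mem_erase.2 ⟨hdW, hb⟩) hr ?_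
              rwa [Finset.erase_right_comm]
            · exact absurd h hWn
        · intro h
          rcases h.avoid W with h | h
          · exact hdn (h.mono (Finset.erase_subset_erase _ (Finset.erase_subset _ _)))
          · exact hWn h
      have := Finset.card_lt_card hss
      omega
    have hcT : c ∉ T W := by rw [hTW]; simp
    have hp : SPath R a (K.erase W) c := by
      by_contra h
      exact hcT ((hT _ _).2 ⟨hc, hcW, h⟩)
    refine hp.inside.mono ?_
    intro d hd
    simp only [Finset.mem_filter, Finset.mem_erase] at hd ⊢
    exact ⟨hd.1.1, (hAdef d).2 (hd.2.mono (Finset.erase_subset _ _))⟩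
  · intro W hW c hc hcT hcU hr
    obtain ⟨hWA, hWU, hWn⟩ := (hT _ _).1 hW
    have hp : SPath R a (K.erase U) c := by
      by_contra h
      exact hcT ((hT _ _).2 ⟨hc, hcU, h⟩)
    exact hWn (SPath.cons (Finset.mem_erase.2 ⟨hWU, hAK hWA⟩) hr hp)

theorem case1 (G : SimpleGraph V) (X : Finset V) (K A : Finset ℕ) (s : ℕ) (f g : V → ℕ)
    (a b : ℕ) (h : Near G X K s f a b) (hAK : A ⊆ K) (hbA : b ∉ A)
    (z y : V) (hz : z ∈ X) (hzA : f z ∈ A) (hza : f z ≠ a) (hy : y ∈ X) (hyA : f y ∉ A)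
    (hsolo : ∀ x ∈ X, f x = f z → G.Adj y x → x = z)
    (c : ℕ) (hc : SPath (Mov G X f) a (A.erase (f z)) c)
    (hmov : ∀ x ∈ X, f x = c → ¬ G.Adj z x)
    (hg : Good G ((X.filter (fun x => f x ∉ A)).erase y) (K \ A) s g) :
    ∃ f', Good G X K s f' := by
  obtain ⟨hK, hp, ha, hb, hab, hs⟩ := h
  obtain ⟨hgK, hgp, hgs⟩ := hg
  obtain ⟨f', h1, h2, h3, h4⟩ := shift_s3 G hc (X.erase z) f z (by simp) (by
    intro c hc d hd hcd
    obtain ⟨u, hu, huc, hud⟩ := hcd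
    refine ⟨u, Finset.mem_erase.2 ⟨?_, hu⟩, huc, fun x hx => hud x (Finset.mem_of_mem_erase hx)⟩
    rintro rfl
    exact (Finset.ne_of_mem_erase hc) huc.symm) (by
    intro x hx; exact hmov x (Finset.mem_of_mem_erase hx)) (by
    intro x hx y hy
    exact hp x (Finset.mem_of_mem_erase hx) y (Finset.mem_of_mem_erase hy))
  rw [Finset.insert_erase hz] at h1 h4
  have hyz : y ≠ z := by rintro rfl; exact hyA hzA
  -- facts about the shifted colouring
  have fA : ∀ x ∈ X, f x ∈ A → f' x ∈ A := by
    intro x hx hxA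
    by_cases hxz : x = z
    · subst hxz; exact Finset.mem_of_mem_erase h3
    · rcases h2 x (Finset.mem_erase.2 ⟨hxz, hx⟩) with h | h
      · rwa [h]
      · exact Finset.mem_of_mem_erase h.2
  have fB : ∀ x ∈ X, f x ∉ A → f' x = f x := by
    intro x hx hxA
    have hxz : x ≠ z := by rintro rfl; exact hxA hzA
    rcases h2 x (Finset.mem_erase.2 ⟨hxz, hx⟩) with h | h
    · exact h
    · exact absurd (Finset.mem_of_mem_erase h.1) hxA
  have fW : ∀ x ∈ X, f' x = f z → f x = f z ∧ x ≠ z := by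
    intro x hx hxW
    have hxz : x ≠ z := by
      rintro rfl
      rw [hxW] at h3; simp at h3
    refine ⟨?_, hxz⟩
    rcases h2 x (Finset.mem_erase.2 ⟨hxz, hx⟩) with h | h
    · rw [← h, hxW]
    · rw [hxW] at h; simp at h
  have hmem : ∀ x, x ∈ (X.filter (fun x => f x ∉ A)).erase y ↔ x ≠ y ∧ x ∈ X ∧ f x ∉ A := by
    intro x; simp
  let k : V → ℕ := fun x => if x = y then f z else if f x ∈ A then f' x else g x
  have ky : k y = f z := by simp [k]
  have kA : ∀ x, f x ∈ A → k x = f' x := by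
    intro x hx
    have : x ≠ y := by rintro rfl; exact hyA hx
    simp [k, this, hx]
  have kB : ∀ x, x ≠ y → f x ∉ A → k x = g x := by
    intro x h hx; simp [k, h, hx]
  have gB : ∀ x ∈ X, x ≠ y → f x ∉ A → g x ∈ K ∧ g x ∉ A := by
    intro x hx h hxA
    have := hgK x ((hmem x).2 ⟨h, hx, hxA⟩)
    simpa using this
  have yprop : ∀ x ∈ X, G.Adj y x → k x ≠ f z := by
    intro x hx hyx hk
    by_cases hxy : x = y
    · subst hxy; exact G.loopless.irrefl _ hyx
    by_cases hxA : f x ∈ A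
    · rw [kA x hxA] at hk
      obtain ⟨e, hne⟩ := fW x hx hk
      exact hne (hsolo x hx e hyx)
    · rw [kB x hxy hxA] at hk
      exact (gB x hx hxy hxA).2 (hk ▸ hzA)
  refine ⟨k, ?_, ?_, ?_⟩
  · intro x hx
    by_cases hxy : x = y
    · subst hxy; rw [ky]; exact hK z hz
    by_cases hxA : f x ∈ A
    · rw [kA x hxA]; exact hAK (fA x hx hxA)
    · rw [kB x hxy hxA]; exact (gB x hx hxy hxA).1
  · intro u hu v hv huv
    by_cases huy : u = y
    · subst huy; rw [ky]; exact (yprop v hv huv).symm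
    by_cases hvy : v = y
    · subst hvy; rw [ky]; exact yprop u hu huv.symm
    by_cases huA : f u ∈ A <;> by_cases hvA : f v ∈ A
    · rw [kA u huA, kA v hvA]; exact h1 u hu v hv huv
    · rw [kA u huA, kB v hvy hvA]
      intro e; exact (gB v hv hvy hvA).2 (e ▸ fA u hu huA)
    · rw [kB u huy huA, kA v hvA]
      intro e; exact (gB u hu huy huA).2 (e ▸ fA v hv hvA)
    · rw [kB u huy huA, kB v hvy hvA]
      exact hgp u ((hmem u).2 ⟨huy, hu, huA⟩) v ((hmem v).2 ⟨hvy, hv, hvA⟩) huv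
  · intro i hi
    by_cases hiA : i ∈ A
    · have hib : i ≠ b := by rintro rfl; exact hbA hiA
      have hsi := hs i hi
      rw [if_neg hib] at hsi
      by_cases hiW : i = f z
      · have e : X.filter (fun x => k x = i) = insert y (X.filter (fun x => f' x = i)) := by
          ext x
          simp only [Finset.mem_filter, Finset.mem_insert]
          by_cases hxy : x = y
          · subst hxy; simp [ky, hiW, hy]
          by_cases hxA : f x ∈ A
          · rw [kA x hxA]; simp [hxy]
          · rw [kB x hxy hxA]
            constructor
            · rintro ⟨hx, hxi⟩; exact absurd hiA (hxi ▸ (gB x hx hxy hxA).2)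
            · rintro (h | ⟨hx, hxi⟩)
              · exact absurd h hxy
              · rw [fB x hx hxA] at hxi; exact absurd hiA (hxi ▸ hxA)
        rw [e, Finset.card_insert_of_notMem, h4 i, Finset.filter_erase]
        · have hm : z ∈ X.filter (fun x => f x = i) := by simp [hz, hiW]
          have := Finset.card_erase_add_one hm
          rw [if_neg (hiW ▸ hza)] at *
          omega
        · simp only [Finset.mem_filter, not_and]
          intro _
          rw [fB y hy hyA]
          exact fun h => hyA (h ▸ hiA)
      · have e : X.filter (fun x => k x = i) = X.filter (fun x => f' x = i) := by
          apply Finset.filter_congr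
          intro x hx
          by_cases hxy : x = y
          · subst hxy
            rw [ky, fB x hx hyA]
            constructor
            · intro h; exact absurd h.symm hiW
            · intro h; exact absurd hiA (h ▸ hyA)
          by_cases hxA : f x ∈ A
          · rw [kA x hxA]
          · rw [kB x hxy hxA, fB x hx hxA]
            constructor
            · intro h; exact absurd hiA (h ▸ (gB x hx hxy hxA).2)
            · intro h; exact absurd hiA (h ▸ hxA)
        rw [e, h4 i, Finset.filter_erase, Finset.erase_eq_of_notMem (by simp [Ne.symm hiW])]
        omega
    · rw [← hgs i (Finset.mem_sdiff.2 ⟨hi, hiA⟩)]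
      congr 1
      ext x
      simp only [Finset.mem_filter, hmem]
      by_cases hxy : x = y
      · subst hxy
        simp only [ky, ne_eq, not_true_eq_false, false_and, iff_false, not_and]
        intro _ h; exact hiA (h ▸ hzA)
      by_cases hxA : f x ∈ A
      · rw [kA x hxA]
        simp only [hxA, not_true_eq_false, and_false, false_and, iff_false, not_and]
        intro hx h; exact hiA (h ▸ fA x hx hxA)
      · rw [kB x hxy hxA]; simp [hxy, hxA]

theorem case2 (G : SimpleGraph V) (X : Finset V) (K A : Finset ℕ) (s : ℕ) (f g : V → ℕ)
    (a b : ℕ) (h : Near G X K s f a b) (hAdef : ∀ c, c ∈ A ↔ SPath (Mov G X f) a K c)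
    (hbA : b ∉ A)
    (z y y₂ : V) (hz : z ∈ X) (hzA : f z ∈ A) (hza : f z ≠ a) (hy : y ∈ X) (hyA : f y ∉ A)
    (hsolo : ∀ x ∈ X, f x = f z → G.Adj y x → x = z)
    (hy₂ : y₂ ∈ X) (hyA₂ : f y₂ ∉ A)
    (hsolo₂ : ∀ x ∈ X, f x = f z → G.Adj y₂ x → x = z) (hyy : y ≠ y₂) (hnadj : ¬ G.Adj y y₂)
    (hterm : ∀ c ∈ A, c ≠ f z → SPath (Mov G X f) a (A.erase (f z)) c)
    (hnm : ∀ c ∈ A, c ≠ f z → ∃ x ∈ X, f x = c ∧ G.Adj z x)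
    (hg : Good G ((X.filter (fun x => f x ∉ A)).erase y) (K \ A) s g)
    (d : ℕ) (hd : d ∈ K \ A)
    (hdz : ∀ x ∈ (X.filter (fun x => f x ∉ A)).erase y, g x = d → ¬ G.Adj z x) :
    ∃ f', Near G X K s f' a d ∧ ∃ e ∈ K, e ∉ A ∧ SPath (Mov G X f') a K e ∧
      ∀ c ∈ A, SPath (Mov G X f') a K c := by
  obtain ⟨hK, hp, ha, hb, hab, hs⟩ := h
  obtain ⟨hgK, hgp, hgs⟩ := hg
  have hAK : A ⊆ K := fun c hc => ((hAdef c).1 hc).start_mem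
  have haA : a ∈ A := (hAdef a).2 (.refl _ ha)
  obtain ⟨hdK, hdA⟩ := Finset.mem_sdiff.1 hd
  have hyz : y ≠ z := by rintro rfl; exact hyA hzA
  have hmem : ∀ x, x ∈ (X.filter (fun x => f x ∉ A)).erase y ↔ x ≠ y ∧ x ∈ X ∧ f x ∉ A := by
    intro x; simp
  let k : V → ℕ := fun x => if x = y then f z else if x = z then d else
    if f x ∈ A then f x else g x
  have ky : k y = f z := by simp [k]
  have kz : k z = d := by simp [k, Ne.symm hyz]
  have kA : ∀ x, x ≠ z → f x ∈ A → k x = f x := by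
    intro x hxz hx
    have : x ≠ y := by rintro rfl; exact hyA hx
    simp [k, this, hx, hxz]
  have kB : ∀ x, x ≠ y → f x ∉ A → k x = g x := by
    intro x h hx
    have : x ≠ z := by rintro rfl; exact hx hzA
    simp [k, h, hx, this]
  have gB : ∀ x ∈ X, x ≠ y → f x ∉ A → g x ∈ K ∧ g x ∉ A := by
    intro x hx h hxA
    have := hgK x ((hmem x).2 ⟨h, hx, hxA⟩)
    simpa using this
  -- classes of k in A
  have kcls : ∀ x ∈ X, k x ∈ A → x = y ∨ (x ≠ z ∧ f x = k x) := by
    intro x hx hk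
    by_cases hxy : x = y
    · exact Or.inl hxy
    right
    by_cases hxz : x = z
    · subst hxz; rw [kz] at hk; exact absurd hk hdA
    by_cases hxA : f x ∈ A
    · exact ⟨hxz, (kA x hxz hxA).symm⟩
    · rw [kB x hxy hxA] at hk; exact absurd hk (gB x hx hxy hxA).2
  have kWprop : ∀ v, (∀ x ∈ X, f x = f z → G.Adj v x → x = z) → ¬ G.Adj v y →
      ∀ x ∈ X, k x = f z → ¬ G.Adj v x := by
    intro v hv hvy x hx hk hadj
    rcases kcls x hx (hk ▸ hzA) with rfl | ⟨hxz, e⟩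
    · exact hvy hadj
    · exact hxz (hv x hx (e.trans hk) hadj)
  have yprop := kWprop y hsolo (G.loopless.irrefl y)
  have zprop : ∀ x ∈ X, k x = d → ¬ G.Adj z x := by
    intro x hx hk hadj
    by_cases hxy : x = y
    · subst hxy; rw [ky] at hk; exact hdA (hk ▸ hzA)
    by_cases hxz : x = z
    · subst hxz; exact G.loopless.irrefl _ hadj
    by_cases hxA : f x ∈ A
    · rw [kA x hxz hxA] at hk; exact hdA (hk ▸ hxA)
    · rw [kB x hxy hxA] at hk
      exact hdz x ((hmem x).2 ⟨hxy, hx, hxA⟩) hk hadj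
  have had : a ≠ d := by rintro rfl; exact hdA haA
  have hmovP : ∀ c ∈ A.erase (f z), ∀ e ∈ A.erase (f z), Mov G X f c e → Mov G X k c e := by
    rintro c hc e he ⟨u, hu, huc, hue⟩
    obtain ⟨hcW, hcA⟩ := Finset.mem_erase.1 hc
    obtain ⟨heW, heA⟩ := Finset.mem_erase.1 he
    have huz : u ≠ z := by rintro rfl; exact hcW huc.symm
    refine ⟨u, hu, by rw [kA u huz (huc ▸ hcA), huc], ?_⟩
    intro x hx hk
    rcases kcls x hx (hk ▸ heA) with rfl | ⟨_, e'⟩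
    · rw [ky] at hk; exact absurd hk.symm heW
    · exact hue x hx (e'.trans hk)
  have accA : ∀ c ∈ A, c ≠ f z → SPath (Mov G X k) a K c := fun c hc hcz =>
    ((hterm c hc hcz).rel hmovP).mono ((Finset.erase_subset _ _).trans hAK)
  have accW : SPath (Mov G X k) a K (f z) := by
    have h0 := (hAdef _).1 hzA
    generalize hw : f z = w at h0
    cases h0 with
    | refl => exact absurd hw hza
    | step _ _ b' hb hr h' =>
      subst hw
      have hb'A : b' ∈ A := (hAdef _).2 (h'.mono (Finset.erase_subset _ _))
      have hb'W : b' ≠ f z := Finset.ne_of_mem_erase h'.start_mem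
      obtain ⟨u, hu, huW, hub⟩ := hr
      refine SPath.cons hb ⟨u, hu, ?_, ?_⟩ (accA b' hb'A hb'W)
      · rw [kA u _ (huW ▸ hzA), huW]
        rintro rfl
        obtain ⟨x, hx, hxb, hadj⟩ := hnm b' hb'A hb'W
        exact hub x hx hxb hadj
      · intro x hx hk
        rcases kcls x hx (hk ▸ hb'A) with rfl | ⟨_, e'⟩
        · rw [ky] at hk; exact absurd hk.symm hb'W
        · exact hub x hx (e'.trans hk)
  refine ⟨k, ⟨?_, ?_, ha, hdK, had, ?_⟩, k y₂, ?_, ?_, ?_, ?_⟩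
  · intro x hx
    by_cases hxy : x = y
    · subst hxy; rw [ky]; exact hK z hz
    by_cases hxz : x = z
    · subst hxz; rw [kz]; exact hdK
    by_cases hxA : f x ∈ A
    · rw [kA x hxz hxA]; exact hK x hx
    · rw [kB x hxy hxA]; exact (gB x hx hxy hxA).1
  · intro u hu v hv huv
    by_cases huy : u = y
    · subst huy; rw [ky]; exact fun e => yprop v hv e.symm huv
    by_cases hvy : v = y
    · subst hvy; rw [ky]; exact fun e => yprop u hu e huv.symm
    by_cases huz : u = z
    · subst huz; rw [kz]; exact fun e => zprop v hv e.symm huv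
    by_cases hvz : v = z
    · subst hvz; rw [kz]; exact fun e => zprop u hu e huv.symm
    by_cases huA : f u ∈ A <;> by_cases hvA : f v ∈ A
    · rw [kA u huz huA, kA v hvz hvA]; exact hp u hu v hv huv
    · rw [kA u huz huA, kB v hvy hvA]
      intro e; exact (gB v hv hvy hvA).2 (e ▸ huA)
    · rw [kB u huy huA, kA v hvz hvA]
      intro e; exact (gB u hu huy huA).2 (e ▸ hvA)
    · rw [kB u huy huA, kB v hvy hvA]
      exact hgp u ((hmem u).2 ⟨huy, hu, huA⟩) v ((hmem v).2 ⟨hvy, hv, hvA⟩) huv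
  · intro i hi
    by_cases hiA : i ∈ A
    · have hib : i ≠ b := by rintro rfl; exact hbA hiA
      have hid : i ≠ d := by rintro rfl; exact hdA hiA
      have hsi := hs i hi
      rw [if_neg hib] at hsi
      rw [if_neg hid, ← hsi]
      congr 1
      by_cases hiW : i = f z
      · have e : X.filter (fun x => k x = i) = insert y ((X.filter (fun x => f x = i)).erase z) := by
          ext x
          simp only [Finset.mem_filter, Finset.mem_insert, Finset.mem_erase]
          constructor
          · rintro ⟨hx, hk⟩
            rcases kcls x hx (hk ▸ hiA) with h | ⟨h, e⟩
            · exact Or.inl h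
            · exact Or.inr ⟨h, hx, e.trans hk⟩
          · rintro (rfl | ⟨h, hx, e⟩)
            · exact ⟨hy, by rw [ky, hiW]⟩
            · exact ⟨hx, by rw [kA x h (e ▸ hiA), e]⟩
        rw [e, Finset.card_insert_of_notMem]
        · exact Finset.card_erase_add_one (by simp [hz, hiW])
        · simp only [Finset.mem_filter, Finset.mem_erase, not_and]
          intro _ _ h; exact hyA (h ▸ hiA)
      · congr 1
        apply Finset.filter_congr
        intro x hx
        constructor
        · intro hk
          rcases kcls x hx (hk ▸ hiA) with rfl | ⟨h, e⟩
          · rw [ky] at hk; exact absurd hk.symm hiW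
          · exact e.trans hk
        · intro e
          rw [kA x _ (e ▸ hiA), e]
          rintro rfl; exact hiW e.symm
    · have hia : i ≠ a := by rintro rfl; exact hiA haA
      rw [if_neg hia, ← hgs i (Finset.mem_sdiff.2 ⟨hi, hiA⟩)]
      have base : ∀ x, x ≠ z → ((x ∈ X ∧ k x = i) ↔ (x ≠ y ∧ x ∈ X ∧ f x ∉ A) ∧ g x = i) := by
        intro x hxz
        by_cases hxy : x = y
        · subst hxy
          simp only [ky, ne_eq, not_true_eq_false, false_and, iff_false, not_and]
          intro _ h; exact hiA (h ▸ hzA)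
        by_cases hxA : f x ∈ A
        · rw [kA x hxz hxA]
          simp only [hxA, not_true_eq_false, and_false, false_and, iff_false, not_and]
          intro hx h; exact hiA (h ▸ hxA)
        · rw [kB x hxy hxA]; simp [hxy, hxA]
      have hzn : z ∉ ((X.filter (fun x => f x ∉ A)).erase y).filter (fun x => g x = i) := by
        simp [hzA]
      by_cases hid : i = d
      · rw [if_pos hid, add_zero, ← Finset.card_insert_of_notMem hzn]
        congr 1
        ext x
        simp only [Finset.mem_filter, Finset.mem_insert, hmem]
        by_cases hxz : x = z
        · subst hxz; simp [hz, kz, hid]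
        · rw [base x hxz]; simp [hxz]
      · rw [if_neg hid, add_zero, add_zero]
        congr 1
        ext x
        simp only [Finset.mem_filter, hmem]
        by_cases hxz : x = z
        · subst hxz; simp [kz, Ne.symm hid, hzA]
        · exact base x hxz
  · rw [kB y₂ hyy.symm hyA₂]; exact (gB y₂ hy₂ hyy.symm hyA₂).1
  · rw [kB y₂ hyy.symm hyA₂]; exact (gB y₂ hy₂ hyy.symm hyA₂).2
  · refine SPath.cons ?_ ⟨y₂, hy₂, rfl, ?_⟩ accW
    · rw [kB y₂ hyy.symm hyA₂]; exact (gB y₂ hy₂ hyy.symm hyA₂).1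
    · exact kWprop y₂ hsolo₂ (fun h => hnadj h.symm)
  · intro c hc
    by_cases hcz : c = f z
    · rw [hcz]; exact accW
    · exact accA c hc hcz

theorem sum_cls (X : Finset V) (f : V → ℕ) (C : Finset ℕ) :
    (X.filter (fun x => f x ∈ C)).card = ∑ c ∈ C, (X.filter (fun x => f x = c)).card := by
  rw [Finset.card_eq_sum_card_fiberwise (f := f) (t := C)]
  · apply Finset.sum_congr rfl
    intro c hc
    congr 1
    ext x
    simp only [Finset.mem_filter]
    constructor
    · rintro ⟨⟨h1, h2⟩, h4⟩; exact ⟨h1, h4⟩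
    · rintro ⟨h1, h2⟩; subst h2; exact ⟨⟨h1, hc⟩, rfl⟩
  · intro x hx
    simp at hx
    exact hx.2

theorem near_good (G : SimpleGraph V) (X : Finset V) (K : Finset ℕ) (s : ℕ)
    (hdeg : ∀ x ∈ X, (X.filter (fun y => G.Adj x y)).card < K.card)
    (IH : ∀ Y, Y ⊂ X → ∀ K' : Finset ℕ, Y.card = K'.card * s →
      (∀ x ∈ Y, (Y.filter (fun y => G.Adj x y)).card < K'.card) → ∃ f, Good G Y K' s f) :
    ∀ (n : ℕ) (f : V → ℕ) (a b : ℕ), Near G X K s f a b →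
      K.card ≤ (K.filter (fun c => SPath (Mov G X f) a K c)).card + n →
      ∃ f', Good G X K s f' := by
  intro n
  induction n with
  | zero =>
    intro f a b h hn
    have e := Finset.eq_of_subset_of_card_le (Finset.filter_subset _ K) hn
    have hb : b ∈ K := h.2.2.2.1
    rw [← e] at hb
    exact lemma21 G X K s f a b h (Finset.mem_filter.1 hb).2
  | succ n ihn =>
    intro f a b h hn
    obtain ⟨A, hA⟩ : ∃ A, A = K.filter (fun c => SPath (Mov G X f) a K c) := ⟨_, rfl⟩
    rw [← hA] at hn
    have hAdef : ∀ c, c ∈ A ↔ SPath (Mov G X f) a K c := by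
      intro c; rw [hA, Finset.mem_filter]
      exact ⟨fun h => h.2, fun h => ⟨h.start_mem, h⟩⟩
    by_cases hbA : b ∈ A
    · exact lemma21 G X K s f a b h ((hAdef b).1 hbA)
    have hnear := h
    obtain ⟨hK, hp, ha, hb, hab, hs⟩ := h
    have hAK : A ⊆ K := fun c hc => ((hAdef c).1 hc).start_mem
    have haA : a ∈ A := (hAdef a).2 (.refl _ ha)
    obtain ⟨q, hq⟩ : ∃ q, q = (K \ A).card := ⟨_, rfl⟩
    have hKq : K.card = A.card + q := by
      rw [hq, Finset.card_sdiff_of_subset hAK]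
      have := Finset.card_le_card hAK
      omega
    have hbKA : b ∈ K \ A := Finset.mem_sdiff.2 ⟨hb, hbA⟩
    have hq0 : 0 < q := by rw [hq]; exact Finset.card_pos.2 ⟨b, hbKA⟩
    obtain ⟨B, hBdef⟩ : ∃ B, B = X.filter (fun x => f x ∉ A) := ⟨_, rfl⟩
    have hBm : ∀ x, x ∈ B ↔ x ∈ X ∧ f x ∉ A := by intro x; rw [hBdef, Finset.mem_filter]
    have hBX : B ⊆ X := by rw [hBdef]; exact Finset.filter_subset _ _
    have hBeq : B = X.filter (fun x => f x ∈ K \ A) := by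
      rw [hBdef]; apply Finset.filter_congr
      intro x hx; simp [hK x hx]
    have hBcard : B.card = q * s + 1 := by
      rw [hBeq, sum_cls]
      have : ∀ c ∈ K \ A, (X.filter (fun x => f x = c)).card = s + if c = b then 1 else 0 := by
        intro c hc
        obtain ⟨hcK, hcA⟩ := Finset.mem_sdiff.1 hc
        have := hs c hcK
        rwa [if_neg (by rintro rfl; exact hcA haA), add_zero] at this
      rw [Finset.sum_congr rfl this, Finset.sum_add_distrib, Finset.sum_ite_eq', if_pos hbKA]
      simp [hq]
    -- neighbour counts
    let nb : V → ℕ → ℕ := fun v c => (X.filter (fun x => f x = c ∧ G.Adj v x)).card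
    let dB : V → ℕ := fun v => (B.filter (fun y => G.Adj v y)).card
    have hdBsum : ∀ v, dB v = ∑ c ∈ K \ A, nb v c := by
      intro v
      simp only [dB, nb]
      rw [sum_nb, hBeq, Finset.filter_filter]
    have hdegsum : ∀ v ∈ X, ∑ c ∈ A, nb v c + dB v < A.card + q := by
      intro v hv
      have h1 := hdeg v hv
      have h2 : (X.filter (fun y => G.Adj v y)).card = ∑ c ∈ K, nb v c := by
        simp only [nb]
        rw [sum_nb]
        congr 1
        apply Finset.filter_congr
        intro x hx; simp [hK x hx]
      rw [hdBsum, add_comm, Finset.sum_sdiff hAK, ← h2, ← hKq]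
      exact h1
    have nb_pos : ∀ v c, (∃ x ∈ X, f x = c ∧ G.Adj v x) → 1 ≤ nb v c := by
      rintro v c ⟨x, hx, h1, h2⟩
      exact Finset.card_pos.2 ⟨x, Finset.mem_filter.2 ⟨hx, h1, h2⟩⟩
    -- vertices of B are adjacent to each class in A
    have hBnb : ∀ y ∈ B, ∀ c ∈ A, 1 ≤ nb y c := by
      intro y hy c hc
      obtain ⟨hyX, hyA⟩ := (hBm y).1 hy
      apply nb_pos
      by_contra hcon
      push Not at hcon
      apply hyA
      exact (hAdef _).2 (SPath.cons (hK y hyX) ⟨y, hyX, rfl, hcon⟩ ((hAdef c).1 hc))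
    have hdBB : ∀ y ∈ B, dB y + 1 ≤ q := by
      intro y hy
      have h1 := hdegsum y (hBX hy)
      have h2 : A.card • 1 ≤ ∑ c ∈ A, nb y c := Finset.card_nsmul_le_sum _ _ _ (hBnb y hy)
      simp only [smul_eq_mul, mul_one] at h2
      omega
    have nb_eq : ∀ v c, nb v c = ((X.filter (fun x => f x = c)).filter (fun x => G.Adj v x)).card := by
      intro v c; simp only [nb]; rw [Finset.filter_filter]
    have hA2 : ∃ c ∈ A, c ≠ a := by
      by_contra hcon
      push Not at hcon
      have hAa : A = {a} := by
        ext c; rw [Finset.mem_singleton]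
        exact ⟨hcon c, fun h => h ▸ haA⟩
      have := count22 G B (X.filter (fun x => f x = a)) q 0 s hBcard
        (by have := hs a ha; rw [if_pos rfl, if_neg hab] at this; omega)
        (by intro y hy; rw [← nb_eq]; exact hBnb y hy a haA)
        (by
          intro x hx
          have := hdegsum x (Finset.mem_filter.1 hx).1
          rw [hAa] at this
          simp only [Finset.card_singleton, dB] at this
          omega)
        (by
          intro x hx _
          have := hdegsum x (Finset.mem_filter.1 hx).1
          rw [hAa] at this
          simp only [Finset.card_singleton, dB] at this
          omega)
      omega
    obtain ⟨U, hUA, T, hTA, hTne, hUT, haT, hterm, hTmov⟩ := exists_terminal_s3 K A hAdef ha hA2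
    obtain ⟨t, ht⟩ : ∃ t, t = T.card := ⟨_, rfl⟩
    -- induction hypothesis on B minus a vertex
    have hBIH : ∀ y ∈ B, ∃ g, Good G (B.erase y) (K \ A) s g := by
      intro y hy
      apply IH
      · exact (Finset.erase_ssubset hy).trans_subset hBX
      · rw [Finset.card_erase_of_mem hy, hBcard, ← hq]; omega
      · intro x hx
        have h1 := hdBB x (Finset.mem_of_mem_erase hx)
        have h2 : ((B.erase y).filter (fun y => G.Adj x y)).card ≤ dB x :=
          Finset.card_le_card (Finset.filter_subset_filter _ (Finset.erase_subset _ _))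
        omega
    have hsoloU : ∀ y z, z ∈ X → G.Adj y z → nb y (f z) = 1 →
        ∀ x ∈ X, f x = f z → G.Adj y x → x = z := by
      intro y z hz hyz h1 x hx hxz hyx
      exact Finset.card_le_one.1 h1.le x (Finset.mem_filter.2 ⟨hx, hxz, hyx⟩) z
        (Finset.mem_filter.2 ⟨hz, rfl, hyz⟩)
    by_cases hcase : ∃ z ∈ X, f z ∈ T ∧ ∃ y ∈ B, G.Adj y z ∧ nb y (f z) = 1 ∧
        ∃ c ∈ A, c ≠ f z ∧ ∀ x ∈ X, f x = c → ¬ G.Adj z x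
    · obtain ⟨z, hz, hzT, y, hy, hyz, hnb, c, hcA, hcz, hc⟩ := hcase
      obtain ⟨g, hg⟩ := hBIH y hy
      obtain ⟨hyX, hyA⟩ := (hBm y).1 hy
      rw [hBdef] at hg
      exact case1 G X K A s f g a b hnear hAK hbA z y hz (hTA hzT)
        (by rintro e; exact haT (e ▸ hzT)) hyX hyA (hsoloU y z hz hyz hnb) c
        (hterm _ hzT c hcA hcz) hc hg
    · push Not at hcase
      have hTnb : ∀ z ∈ X, f z ∈ T → dB z ≤ q + t := by
        intro z hz hzT
        have h1 := hdegsum z hz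
        have h2 : ((A \ T).erase U).card • 1 ≤ ∑ c ∈ (A \ T).erase U, nb z c := by
          apply Finset.card_nsmul_le_sum
          intro c hc
          simp only [Finset.mem_erase, Finset.mem_sdiff] at hc
          apply nb_pos
          by_contra hcon
          push Not at hcon
          exact hTmov _ hzT c hc.2.1 hc.2.2 hc.1 ⟨z, hz, rfl, hcon⟩
        have h3 : ∑ c ∈ (A \ T).erase U, nb z c ≤ ∑ c ∈ A, nb z c :=
          Finset.sum_le_sum_of_subset ((Finset.erase_subset _ _).trans Finset.sdiff_subset)
        rw [smul_eq_mul, mul_one, Finset.card_erase_of_mem (Finset.mem_sdiff.2 ⟨hUA, hUT⟩),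
          Finset.card_sdiff_of_subset hTA, ← ht] at h2
        omega
      have hSnb : ∀ z ∈ X, f z ∈ T → (∃ y ∈ B, G.Adj y z ∧ nb y (f z) = 1) → dB z ≤ q := by
        rintro z hz hzT ⟨y, hy, hyz, hnb⟩
        have h1 := hdegsum z hz
        have h2 : (A.erase (f z)).card • 1 ≤ ∑ c ∈ A.erase (f z), nb z c := by
          apply Finset.card_nsmul_le_sum
          intro c hc
          simp only [Finset.mem_erase] at hc
          exact nb_pos _ _ (hcase z hz hzT y hy hyz hnb c hc.2 hc.1)
        have h3 : ∑ c ∈ A.erase (f z), nb z c ≤ ∑ c ∈ A, nb z c :=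
          Finset.sum_le_sum_of_subset (Finset.erase_subset _ _)
        rw [smul_eq_mul, mul_one, Finset.card_erase_of_mem (hTA hzT)] at h2
        omega
      have hTs : ∀ W ∈ T, (X.filter (fun x => f x = W)).card = s := by
        intro W hW
        have := hs W (hAK (hTA hW))
        rwa [if_neg (by rintro rfl; exact haT hW), if_neg (by rintro rfl; exact hbA (hTA hW))]
          at this
      have hqt : q < t := by
        obtain ⟨W, hW⟩ := hTne
        refine count22 G B (X.filter (fun x => f x = W)) q t s hBcard (hTs W hW).le ?_ ?_ ?_
        · intro y hy; rw [← nb_eq]; exact hBnb y hy W (hTA hW)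
        · intro x hx
          obtain ⟨hxX, hxW⟩ := Finset.mem_filter.1 hx
          exact hTnb x hxX (hxW ▸ hW)
        · rintro x hx ⟨y, hy, hyx, h1⟩
          obtain ⟨hxX, hxW⟩ := Finset.mem_filter.1 hx
          rw [← nb_eq] at h1
          exact hSnb x hxX (hxW ▸ hW) ⟨y, hy, hyx, hxW ▸ h1⟩
      obtain ⟨Sp, hSp⟩ : ∃ Sp : V → V → Prop, ∀ y z, Sp y z ↔ (G.Adj y z ∧ nb y (f z) = 1) :=
        ⟨fun y z => G.Adj y z ∧ nb y (f z) = 1, fun _ _ => Iff.rfl⟩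
      obtain ⟨z, hzA', y₁, hy₁, y₂, hy₂, hne, hnadj, hsp1, hsp2⟩ :=
        count3 G B (X.filter (fun x => f x ∈ T)) Sp q t s
          hBcard (by rw [sum_cls, Finset.sum_congr rfl hTs]; simp [ht]) hqt.le hdBB (by
            intro y hy
            have h1 := hdegsum y (hBX hy)
            have e : ((X.filter (fun x => f x ∈ T)).filter (Sp y)).card
                = ∑ c ∈ T, if nb y c = 1 then 1 else 0 := by
              rw [Finset.card_eq_sum_card_fiberwise (f := f) (t := T)]
              · apply Finset.sum_congr rfl
                intro c hc
                split_ifs with h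
                · refine Eq.trans ?_ h
                  simp only [nb]
                  congr 1
                  ext x
                  simp only [Finset.mem_filter, hSp]
                  constructor
                  · rintro ⟨⟨⟨h1, h2⟩, h3, h4⟩, h5⟩; exact ⟨h1, h5, h3⟩
                  · rintro ⟨h1, h2, h3⟩
                    exact ⟨⟨⟨h1, h2 ▸ hc⟩, h3, by rw [h2]; exact h⟩, h2⟩
                · rw [Finset.card_eq_zero, Finset.filter_eq_empty_iff]
                  intro x hx hxc
                  simp only [Finset.mem_filter, hSp] at hx
                  exact h (hxc ▸ hx.2.2)
              · intro x hx
                simp at hx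
                exact hx.1.2
            rw [e]
            have h2 : T.card • 2 ≤ ∑ c ∈ T, (nb y c + if nb y c = 1 then 1 else 0) := by
              apply Finset.card_nsmul_le_sum
              intro c hc
              have := hBnb y hy c (hTA hc)
              split_ifs <;> omega
            rw [Finset.sum_add_distrib, smul_eq_mul, ← ht] at h2
            have h3 : (A \ T).card • 1 ≤ ∑ c ∈ A \ T, nb y c :=
              Finset.card_nsmul_le_sum _ _ _ fun c hc => hBnb y hy c (Finset.mem_sdiff.1 hc).1
            rw [smul_eq_mul, mul_one, Finset.card_sdiff_of_subset hTA, ← ht] at h3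
            have h4 := Finset.sum_sdiff (f := fun c => nb y c) hTA
            have h5 := Finset.card_le_card hTA
            rw [← ht] at h5
            change t + dB y + 1 ≤ _
            omega)
      obtain ⟨hs11, hs12⟩ := (hSp _ _).1 hsp1
      obtain ⟨hs21, hs22⟩ := (hSp _ _).1 hsp2
      obtain ⟨hz, hzT⟩ := Finset.mem_filter.1 hzA'
      obtain ⟨g, hg⟩ := hBIH y₁ hy₁
      obtain ⟨hyX, hyA⟩ := (hBm y₁).1 hy₁
      obtain ⟨hyX₂, hyA₂⟩ := (hBm y₂).1 hy₂
      obtain ⟨d, hd, hdz⟩ : ∃ d ∈ K \ A, ∀ x ∈ B.erase y₁, g x = d → ¬ G.Adj z x := by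
        by_contra hcon
        push Not at hcon
        have h1 : (K \ A).card • 1 ≤
            ∑ c ∈ K \ A, ((B.erase y₁).filter (fun x => g x = c ∧ G.Adj z x)).card := by
          apply Finset.card_nsmul_le_sum
          intro c hc
          obtain ⟨x, hx, h1, h2⟩ := hcon c hc
          exact Finset.card_pos.2 ⟨x, Finset.mem_filter.2 ⟨hx, h1, h2⟩⟩
        rw [sum_nb, smul_eq_mul, mul_one, ← hq] at h1
        have h2 : ((B.erase y₁).filter (fun x => g x ∈ K \ A ∧ G.Adj z x)).card ≤
            ((B.filter (fun x => G.Adj z x)).erase y₁).card := by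
          apply Finset.card_le_card
          intro x hx
          simp only [Finset.mem_filter, Finset.mem_erase] at hx ⊢
          exact ⟨hx.1.1, hx.1.2, hx.2.2⟩
        have h3 := Finset.card_erase_add_one
          (Finset.mem_filter.2 ⟨hy₁, hs11.symm⟩ : y₁ ∈ B.filter (fun x => G.Adj z x))
        have h4 : (B.filter (fun x => G.Adj z x)).card ≤ q := hSnb z hz hzT ⟨y₁, hy₁, hs11, hs12⟩
        omega
      rw [hBdef] at hg hdz
      obtain ⟨f', hf', e, heK, heA, hacc, haccA⟩ := case2 G X K A s f g a b hnear hAdef hbA z y₁ y₂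
        hz (hTA hzT) (by rintro e; exact haT (e ▸ hzT)) hyX hyA (hsoloU y₁ z hz hs11 hs12)
        hyX₂ hyA₂ (hsoloU y₂ z hz hs21 hs22) hne hnadj (hterm _ hzT)
        (hcase z hz hzT y₁ hy₁ hs11 hs12) hg d hd hdz
      refine ihn f' a d hf' ?_
      have hsub : insert e A ⊆ K.filter (fun c => SPath (Mov G X f') a K c) := by
        intro c hc
        rcases Finset.mem_insert.1 hc with rfl | hc
        · exact Finset.mem_filter.2 ⟨heK, hacc⟩
        · exact Finset.mem_filter.2 ⟨hAK hc, haccA c hc⟩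
      have := Finset.card_le_card hsub
      rw [Finset.card_insert_of_notMem heA] at this
      omega

theorem base_good (K : Finset ℕ) (s : ℕ) : ∀ X : Finset V, X.card = K.card * s →
    ∃ f : V → ℕ, (∀ x ∈ X, f x ∈ K) ∧ ∀ i ∈ K, (X.filter (fun x => f x = i)).card = s := by
  induction K using Finset.induction_on with
  | empty =>
    intro X hX
    simp at hX
    subst hX
    exact ⟨fun _ => 0, by simp, by simp⟩
  | insert k K hk ih =>
    intro X hX
    rw [Finset.card_insert_of_notMem hk, add_mul, one_mul] at hX
    obtain ⟨S, hS, hSc⟩ := Finset.exists_subset_card_eq (s := X) (n := s) (by omega)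
    obtain ⟨f, hf, hfs⟩ := ih (X \ S) (by rw [Finset.card_sdiff_of_subset hS]; omega)
    refine ⟨fun x => if x ∈ S then k else f x, ?_, ?_⟩
    · intro x hx
      by_cases hxS : x ∈ S
      · simp [hxS]
      · simp only [hxS, if_false]
        exact Finset.mem_insert_of_mem (hf x (Finset.mem_sdiff.2 ⟨hx, hxS⟩))
    · intro i hi
      by_cases hik : i = k
      · subst hik
        rw [← hSc]
        congr 1
        ext x
        simp only [Finset.mem_filter]
        by_cases hxS : x ∈ S
        · simp [hxS, hS hxS]
        · simp only [hxS, if_false, iff_false, not_and]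
          intro hx h
          exact hk (h ▸ hf x (Finset.mem_sdiff.2 ⟨hx, hxS⟩))
      · have hiK : i ∈ K := Finset.mem_of_mem_insert_of_ne hi hik
        rw [← hfs i hiK]
        congr 1
        ext x
        simp only [Finset.mem_filter, Finset.mem_sdiff]
        by_cases hxS : x ∈ S
        · simp [hxS, Ne.symm hik]
        · simp [hxS]

/-- edges of `G` inside `T` -/
def restr (G : SimpleGraph V) (T : Finset V) : SimpleGraph V where
  Adj x y := G.Adj x y ∧ x ∈ T ∧ y ∈ T
  symm := ⟨fun _ _ h => ⟨h.1.symm, h.2.2, h.2.1⟩⟩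
  loopless := ⟨fun _ h => G.loopless.irrefl _ h.1⟩

theorem main (n : ℕ) : ∀ (G : SimpleGraph V) (X : Finset V) (K : Finset ℕ) (s : ℕ), X.card = n →
    X.card = K.card * s → (∀ x ∈ X, (X.filter (fun y => G.Adj x y)).card < K.card) →
    ∃ f, Good G X K s f := by
  induction n using Nat.strong_induction_on with
  | _ n IH =>
  intro G X K s hn hX hdeg
  have key : ∀ T : Finset V, ∃ f, Good (restr G T) X K s f := by
    intro T
    induction T using Finset.induction_on with
    | empty =>
      obtain ⟨f, h1, h2⟩ := base_good K s X hX
      exact ⟨f, h1, fun x _ y _ h => by simp [restr] at h, h2⟩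
    | insert u T hu ih =>
      obtain ⟨f, hf⟩ := ih
      by_cases huX : u ∈ X
      swap
      · refine ⟨f, hf.1, ?_, hf.2.2⟩
        intro x hx y hy h
        refine hf.2.1 x hx y hy ⟨h.1, ?_, ?_⟩
        · exact Finset.mem_of_mem_insert_of_ne h.2.1 (by rintro rfl; exact huX hx)
        · exact Finset.mem_of_mem_insert_of_ne h.2.2 (by rintro rfl; exact huX hy)
      obtain ⟨hK, hp, hs⟩ := hf
      have hdeg' : ∀ x ∈ X, (X.filter (fun y => (restr G (insert u T)).Adj x y)).card < K.card := by
        intro x hx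
        refine lt_of_le_of_lt (Finset.card_le_card ?_) (hdeg x hx)
        intro y hy
        rw [Finset.mem_filter] at hy ⊢
        exact ⟨hy.1, hy.2.1⟩
      obtain ⟨c, hc, hcu⟩ : ∃ c ∈ K, ∀ x ∈ X, f x = c → ¬ G.Adj u x := by
        by_contra hcon
        push Not at hcon
        have h1 : K.card • 1 ≤
            ∑ c ∈ K, (X.filter (fun x => f x = c ∧ G.Adj u x)).card := by
          apply Finset.card_nsmul_le_sum
          intro c hc
          obtain ⟨x, hx, h1, h2⟩ := hcon c hc
          exact Finset.card_pos.2 ⟨x, Finset.mem_filter.2 ⟨hx, h1, h2⟩⟩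
        rw [sum_nb, smul_eq_mul, mul_one] at h1
        have h2 : (X.filter (fun x => f x ∈ K ∧ G.Adj u x)).card ≤
            (X.filter (fun x => G.Adj u x)).card := by
          apply Finset.card_le_card
          intro x hx
          simp only [Finset.mem_filter] at hx ⊢
          exact ⟨hx.1, hx.2.2⟩
        have := hdeg u huX
        omega
      let h : V → ℕ := Function.update f u c
      have hu' : h u = c := by simp [h]
      have hne : ∀ x, x ≠ u → h x = f x := fun x hx => by simp [h, hx]
      have hprop : Pr (restr G (insert u T)) X h := by
        intro x hx y hy hxy
        by_cases hxu : x = u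
        · subst hxu
          have hyx : y ≠ x := hxy.1.symm.ne
          rw [hu', hne y hyx]
          exact fun e => hcu y hy e.symm hxy.1
        by_cases hyu : y = u
        · subst hyu
          rw [hu', hne x hxu]
          exact fun e => hcu x hx e hxy.1.symm
        rw [hne x hxu, hne y hyu]
        exact hp x hx y hy ⟨hxy.1, Finset.mem_of_mem_insert_of_ne hxy.2.1 hxu,
          Finset.mem_of_mem_insert_of_ne hxy.2.2 hyu⟩
      by_cases hcf : f u = c
      · have e : h = f := by
          funext x
          by_cases hxu : x = u
          · subst hxu; rw [hu', hcf]
          · exact hne x hxu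
        rw [e] at hprop
        exact ⟨f, hK, hprop, hs⟩
      · refine near_good (restr G (insert u T)) X K s hdeg' ?_ K.card h (f u) c ?_ (by omega)
        · intro Y hY K' hYc hYd
          exact IH Y.card (hn ▸ Finset.card_lt_card hY) _ Y K' s rfl hYc hYd
        · refine ⟨?_, hprop, hK u huX, hc, hcf, ?_⟩
          · intro x hx
            by_cases hxu : x = u
            · subst hxu; rw [hu']; exact hc
            · rw [hne x hxu]; exact hK x hx
          · intro i hi
            rw [← hs i hi]
            by_cases hia : i = f u
            · rw [if_pos hia, if_neg (by rw [hia]; exact hcf), add_zero]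
              have e : X.filter (fun x => h x = i) = (X.filter (fun x => f x = i)).erase u := by
                ext x
                simp only [Finset.mem_filter, Finset.mem_erase]
                by_cases hxu : x = u
                · subst hxu; simp [hu', hia, Ne.symm hcf]
                · rw [hne x hxu]; simp [hxu]
              rw [e]
              exact Finset.card_erase_add_one (by simp [huX, hia])
            · rw [if_neg hia, add_zero]
              by_cases hic : i = c
              · rw [if_pos hic]
                have hnm : u ∉ X.filter (fun x => f x = i) := by simp [Ne.symm hia]
                rw [← Finset.card_insert_of_notMem hnm]
                congr 1
                ext x
                simp only [Finset.mem_filter, Finset.mem_insert]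
                by_cases hxu : x = u
                · subst hxu; simp [hu', hic, huX]
                · rw [hne x hxu]; simp [hxu]
              · rw [if_neg hic, add_zero]
                congr 1
                ext x
                simp only [Finset.mem_filter]
                by_cases hxu : x = u
                · subst hxu; simp [hu', Ne.symm hic, Ne.symm hia]
                · rw [hne x hxu]
  obtain ⟨f, h1, h2, h3⟩ := key X
  exact ⟨f, h1, fun x hx y hy h => h2 x hx y hy ⟨h, hx, hy⟩, h3⟩

theorem tiling (r k n : ℕ) (hn : n = r * k) (G : SimpleGraph (Fin n))
    (hd : ∀ v, n ≤ G.degree v + k) :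
    ∃ T : Finset (Finset (Fin n)), IsPerfectKTiling G r T := by
  obtain ⟨f, h1, h2, h3⟩ := main n Gᶜ Finset.univ (Finset.range k) r (by simp)
    (by simp [hn, mul_comm]) (by
      intro x _
      have e : (Finset.univ.filter (fun y => Gᶜ.Adj x y)).card = Gᶜ.degree x := by
        rw [← SimpleGraph.card_neighborFinset_eq_degree]
        congr 1
        ext y; simp
      have h := SimpleGraph.degree_compl G x
      have h' := hd x
      have hx := G.degree_lt_card_verts x
      simp only [Fintype.card_fin] at h hx
      rw [Finset.card_range]
      have goal : Gᶜ.degree x < k := by omega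
      rw [← e] at goal
      convert goal)
  refine ⟨(Finset.range k).image (fun i => Finset.univ.filter (fun x => f x = i)), ?_, ?_, ?_⟩
  · intro S hS
    obtain ⟨i, hi, rfl⟩ := Finset.mem_image.1 hS
    refine ⟨?_, h3 i hi⟩
    intro x hx y hy hxy
    simp at hx hy
    by_contra hadj
    exact h2 x (Finset.mem_univ _) y (Finset.mem_univ _)
      ((SimpleGraph.compl_adj _ _ _).2 ⟨hxy, hadj⟩) (hx.trans hy.symm)
  · intro S hS S' hS' hne
    obtain ⟨i, hi, rfl⟩ := Finset.mem_image.1 (Finset.mem_coe.1 hS)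
    obtain ⟨j, hj, rfl⟩ := Finset.mem_image.1 (Finset.mem_coe.1 hS')
    rw [Finset.disjoint_left]
    intro x hx hy
    simp at hx hy
    apply hne
    rw [← hx, ← hy]
  · intro v
    exact ⟨_, Finset.mem_image_of_mem _ (h1 v (Finset.mem_univ _)), by simp⟩

end
end HSz

/-- The Hajnal–Szemerédi theorem: if `r ∣ n` and `δ(G) ≥ (1 - 1/r)n`, then the
`n`-vertex graph `G` has a perfect `K_r`-tiling. -/
theorem hajnal_szemeredi (r : ℕ) (hr : 2 ≤ r) (n : ℕ) (hn : r ∣ n)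
    (G : SimpleGraph (Fin n)) [DecidableRel G.Adj]
    (hδ : (G.minDegree : ℝ) ≥ (1 - 1 / r) * n) :
    ∃ T : Finset (Finset (Fin n)), IsPerfectKTiling G r T := by
  obtain ⟨k, hk⟩ := hn
  refine HSz.tiling r k n hk G ?_
  · intro v
    have hr0 : (r : ℝ) ≠ 0 := by
      have : r ≠ 0 := by omega
      exact_mod_cast this
    have e : (1 - 1 / (r : ℝ)) * n = n - k := by
      have : (n : ℝ) = r * k := by exact_mod_cast hk
      rw [this]; field_simp
    rw [e] at hδ
    have h1 : (n : ℝ) ≤ (G.minDegree : ℝ) + k := by linarith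
    have h2 : n ≤ G.minDegree + k := by exact_mod_cast h1
    have h3 := G.minDegree_le_degree v
    have h4 : n ≤ G.degree v + k := by omega
    convert h4
end
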